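/- Fix an integer d ≥ 2 and δ ∈ (0,1). Let a^{jk} : ℝ → ℝ (1 ≤ j,k ≤ d) be measurable functions of x¹ only, with a^{jk} = a^{kj} and δ|θ|² ≤ Σ_{j,k=1}^d a^{jk}(x¹) θ^j θ^k ≤ δ⁻¹|θ|² for all x¹ and θ ∈ ℝ^d. Set L₀u = u_t + Σ_{j,k} a^{jk}(x¹) u_{x^j x^k}. Then there is N = N(d,δ) such that for every κ ≥ 4, r > 0, and every smooth compactly supported u : ℝ^{d+1} → ℝ, for w = u_t and for each w = u_{x^j x^k} with 1 ≤ j ≤ d, 2 ≤ k ≤ d: ⨍_{Q_r} |w − (w)_{Q_r}|² dx dt ≤ N κ^{d+2} (|L₀u|²)_{Q_{κr}} + N κ^{-2} (|u_{xx}|²)_{Q_{κr}}. -/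

import Mathlib

open MeasureTheory

/-- Partial derivative in `t`. -/
noncomputable def pdt {d : ℕ} (u : ℝ × (Fin d → ℝ) → ℝ) : ℝ × (Fin d → ℝ) → ℝ :=
  fun p => fderiv ℝ u p (1, 0)

/-- Partial derivative in `x^j`. -/
noncomputable def pdx {d : ℕ} (j : Fin d) (u : ℝ × (Fin d → ℝ) → ℝ) :
    ℝ × (Fin d → ℝ) → ℝ :=
  fun p => fderiv ℝ u p (0, Pi.single j 1)

/-- Second partial derivative in `x^j, x^k`. -/
noncomputable def pdxx {d : ℕ} (j k : Fin d) (u : ℝ × (Fin d → ℝ) → ℝ) :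
    ℝ × (Fin d → ℝ) → ℝ :=
  pdx j (pdx k u)

/-- Open Euclidean ball `B_r ⊂ ℝ^d` centered at the origin. -/
def ballE (d : ℕ) (r : ℝ) : Set (Fin d → ℝ) := {x | ∑ j, (x j) ^ 2 < r ^ 2}

/-- Parabolic cylinder `Q_r = (0,r²) × B_r`. -/
def Qc (d : ℕ) (r : ℝ) : Set (ℝ × (Fin d → ℝ)) := Set.Ioo 0 (r ^ 2) ×ˢ ballE d r

/-- Average of `f` over a set `s` (of finite positive measure). -/
noncomputable def avg {d : ℕ} (s : Set (ℝ × (Fin d → ℝ)))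
    (f : ℝ × (Fin d → ℝ) → ℝ) : ℝ :=
  ((volume s).toReal)⁻¹ * ∫ p in s, f p


section P1
section Basics
open scoped ContDiff

variable {d : ℕ}

abbrev EE (d : ℕ) := ℝ × (Fin d → ℝ)

/-- Basis vectors of space-time; `none` is the time direction. -/
def ev (i : Option (Fin d)) : EE d :=
  match i with
  | none => (1, 0)
  | some j => (0, Pi.single j 1)

/-- Partial derivative in direction `i`. -/
noncomputable def DD (i : Option (Fin d)) (u : EE d → ℝ) : EE d → ℝ :=
  fun p => fderiv ℝ u p (ev i)

def Sm (u : EE d → ℝ) : Prop := ContDiff ℝ (⊤ : ℕ∞) u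
def TF (u : EE d → ℝ) : Prop := Sm u ∧ HasCompactSupport u

theorem Sm.diff {u : EE d → ℝ} (h : Sm u) : Differentiable ℝ u :=
  ContDiff.differentiable h (by simp)

theorem Sm.cont {u : EE d → ℝ} (h : Sm u) : Continuous u := ContDiff.continuous h

theorem Sm.DD {u : EE d → ℝ} (h : Sm u) (i : Option (Fin d)) : Sm (DD i u) := by
  unfold Sm at *
  have h1 : ContDiff ℝ (⊤ : ℕ∞) (fderiv ℝ u) := h.fderiv_right (by simp)
  exact h1.clm_apply contDiff_const

theorem TF.DD {u : EE d → ℝ} (h : TF u) (i : Option (Fin d)) : TF (DD i u) := by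
  refine ⟨h.1.DD i, ?_⟩
  exact (h.2.fderiv_apply ℝ (ev i))

theorem Sm.mul {u v : EE d → ℝ} (h : Sm u) (h2 : Sm v) : Sm (fun p => u p * v p) :=
  ContDiff.mul h h2
theorem Sm.add {u v : EE d → ℝ} (h : Sm u) (h2 : Sm v) : Sm (fun p => u p + v p) :=
  ContDiff.add h h2
theorem Sm.sub {u v : EE d → ℝ} (h : Sm u) (h2 : Sm v) : Sm (fun p => u p - v p) :=
  ContDiff.sub h h2
theorem TF.mul {u v : EE d → ℝ} (h : TF u) (h2 : Sm v) : TF (fun p => u p * v p) :=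
  ⟨h.1.mul h2, h.2.mul_right⟩

theorem DD_add {u v : EE d → ℝ} (h : Sm u) (h2 : Sm v) (i : Option (Fin d)) :
    DD i (fun p => u p + v p) = fun p => DD i u p + DD i v p := by
  funext p
  simp only [DD]
  rw [fderiv_fun_add (h.diff p) (h2.diff p)]; rfl

theorem DD_sub {u v : EE d → ℝ} (h : Sm u) (h2 : Sm v) (i : Option (Fin d)) :
    DD i (fun p => u p - v p) = fun p => DD i u p - DD i v p := by
  funext p
  simp only [DD]
  rw [fderiv_fun_sub (h.diff p) (h2.diff p)]; rfl

theorem DD_mul {u v : EE d → ℝ} (h : Sm u) (h2 : Sm v) (i : Option (Fin d)) :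
    DD i (fun p => u p * v p) = fun p => DD i u p * v p + u p * DD i v p := by
  funext p
  simp only [DD]
  rw [fderiv_fun_mul (h.diff p) (h2.diff p)]
  simp; ring

theorem DD_comm {u : EE d → ℝ} (h : Sm u) (i j : Option (Fin d)) :
    DD i (DD j u) = DD j (DD i u) := by
  funext p
  have hs : IsSymmSndFDerivAt ℝ u p :=
    (ContDiff.contDiffAt h).isSymmSndFDerivAt (by
      simp only [minSmoothness_of_isRCLikeNormedField]
      exact WithTop.coe_le_coe.2 (le_top : (2 : ℕ∞) ≤ ⊤))
  have h1 : Differentiable ℝ (fderiv ℝ u) := by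
    have : ContDiff ℝ (⊤ : ℕ∞) (fderiv ℝ u) := ContDiff.fderiv_right h (by simp)
    exact this.differentiable (by simp)
  have key : ∀ a b : EE d, fderiv ℝ (fun q => fderiv ℝ u q a) p b = fderiv ℝ (fderiv ℝ u) p b a := by
    intro a b
    rw [fderiv_clm_apply (h1 p) (differentiableAt_const a)]
    simp
  show fderiv ℝ (fun q => fderiv ℝ u q (ev j)) p (ev i) = fderiv ℝ (fun q => fderiv ℝ u q (ev i)) p (ev j)
  rw [key, key]
  exact hs.eq _ _

theorem DD_congr {u v : EE d → ℝ} {p : EE d} (h : u =ᶠ[nhds p] v) (i : Option (Fin d)) :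
    DD i u =ᶠ[nhds p] DD i v := by
  have := h.fderiv (𝕜 := ℝ)
  filter_upwards [this] with q hq
  simp [DD, hq]

/-- Locally bounded measurable functions. -/
def LB (F : EE d → ℝ) : Prop :=
  Measurable F ∧ ∀ R : ℝ, ∃ C : ℝ, ∀ p : EE d, ‖p‖ ≤ R → |F p| ≤ C

theorem LB.const (c : ℝ) : LB (fun _ : EE d => c) :=
  ⟨measurable_const, fun _ => ⟨|c|, fun _ _ => le_rfl⟩⟩

theorem LB.add {F G : EE d → ℝ} (hF : LB F) (hG : LB G) : LB (fun p => F p + G p) := by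
  refine ⟨hF.1.add hG.1, fun R => ?_⟩
  obtain ⟨C, hC⟩ := hF.2 R
  obtain ⟨C2, hC2⟩ := hG.2 R
  exact ⟨C + C2, fun p hp => (abs_add_le _ _).trans (add_le_add (hC p hp) (hC2 p hp))⟩

theorem LB.neg {F : EE d → ℝ} (hF : LB F) : LB (fun p => - F p) := by
  refine ⟨hF.1.neg, fun R => ?_⟩
  obtain ⟨C, hC⟩ := hF.2 R
  exact ⟨C, fun p hp => by simpa using hC p hp⟩

theorem LB.sub {F G : EE d → ℝ} (hF : LB F) (hG : LB G) : LB (fun p => F p - G p) := by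
  simpa [sub_eq_add_neg] using hF.add hG.neg

theorem LB.mul {F G : EE d → ℝ} (hF : LB F) (hG : LB G) : LB (fun p => F p * G p) := by
  refine ⟨hF.1.mul hG.1, fun R => ?_⟩
  obtain ⟨C, hC⟩ := hF.2 R
  obtain ⟨C2, hC2⟩ := hG.2 R
  refine ⟨C * C2, fun p hp => ?_⟩
  rw [abs_mul]
  exact mul_le_mul (hC p hp) (hC2 p hp) (abs_nonneg _) ((abs_nonneg _).trans (hC p hp))

theorem LB.sq {F : EE d → ℝ} (hF : LB F) : LB (fun p => F p ^ 2) := by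
  simpa [pow_two] using hF.mul hF

theorem LB.abs {F : EE d → ℝ} (hF : LB F) : LB (fun p => |F p|) := by
  refine ⟨continuous_abs.measurable.comp hF.1, fun R => ?_⟩
  obtain ⟨C, hC⟩ := hF.2 R
  exact ⟨C, fun p hp => by simpa using hC p hp⟩

theorem LB.sum {ι : Type*} (s : Finset ι) {F : ι → EE d → ℝ} (hF : ∀ i ∈ s, LB (F i)) :
    LB (fun p => ∑ i ∈ s, F i p) := by
  classical
  induction s using Finset.induction_on with
  | empty => simpa using LB.const 0
  | insert a s ha ih =>
    simp only [Finset.sum_insert ha]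
    exact (hF a (by simp)).add (ih fun i hi => hF i (by simp [hi]))

theorem LB.of_cont {F : EE d → ℝ} (hF : Continuous F) : LB F := by
  refine ⟨hF.measurable, fun R => ?_⟩
  obtain ⟨C, hC⟩ := (isCompact_closedBall (0 : EE d) R).exists_bound_of_continuousOn hF.continuousOn
  exact ⟨C, fun p hp => by simpa using hC p (by simpa using hp)⟩

theorem Sm.LB {u : EE d → ℝ} (h : Sm u) : LB u := LB.of_cont h.cont

theorem LB.integrableOn {F : EE d → ℝ} (hF : LB F) {s : Set (EE d)} (hs : Bornology.IsBounded s) :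
    IntegrableOn F s := by
  obtain ⟨R, hR⟩ := hs.subset_closedBall 0
  obtain ⟨C, hC⟩ := hF.2 R
  have : IntegrableOn F (Metric.closedBall 0 R) := by
    refine Measure.integrableOn_of_bounded (M := C) ?_ hF.1.aestronglyMeasurable ?_
    · exact (isCompact_closedBall _ _).measure_lt_top.ne
    · refine (ae_restrict_iff' Metric.isClosed_closedBall.measurableSet).2 (Filter.Eventually.of_forall ?_)
      intro p hp
      exact hC p (by simpa using hp)
  exact this.mono_set hR

theorem LB.integrable {F G : EE d → ℝ} (hF : LB F) (hG : HasCompactSupport G)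
    (h0 : ∀ p, G p = 0 → F p = 0) : Integrable F := by
  have h1 := hF.integrableOn (s := tsupport G) hG.isCompact.isBounded
  rw [integrableOn_iff_integrable_of_support_subset] at h1
  · exact h1
  · intro p hp
    by_contra hc
    exact hp (h0 p (image_eq_zero_of_notMem_tsupport hc))

end Basics
end P1

section P2
section Energy
open MeasureTheory

variable {d : ℕ}

structure Ell (δ : ℝ) (a : ℝ → Fin d → Fin d → ℝ) : Prop where
  meas : ∀ j k, Measurable fun s => a s j k
  symm : ∀ s j k, a s j k = a s k j
  low : ∀ (s : ℝ) (θ : Fin d → ℝ), δ * ∑ j, (θ j) ^ 2 ≤ ∑ j, ∑ k, a s j k * θ j * θ k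
  up : ∀ (s : ℝ) (θ : Fin d → ℝ), ∑ j, ∑ k, a s j k * θ j * θ k ≤ δ⁻¹ * ∑ j, (θ j) ^ 2

theorem Ell.diag_low {δ : ℝ} {a : ℝ → Fin d → Fin d → ℝ} (h : Ell δ a) (s : ℝ) (j : Fin d) :
    δ ≤ a s j j := by
  have := h.low s (Pi.single j 1)
  simpa [Pi.single_apply] using this

theorem Ell.diag_up {δ : ℝ} {a : ℝ → Fin d → Fin d → ℝ} (h : Ell δ a) (s : ℝ) (j : Fin d) :
    a s j j ≤ δ⁻¹ := by
  have := h.up s (Pi.single j 1)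
  simpa [Pi.single_apply] using this

theorem Ell.abs_le {δ : ℝ} (hδ : 0 < δ) {a : ℝ → Fin d → Fin d → ℝ} (h : Ell δ a) (s : ℝ) (j k : Fin d) :
    |a s j k| ≤ δ⁻¹ := by
  by_cases hjk : j = k
  · subst hjk
    rw [abs_of_nonneg (hδ.le.trans (h.diag_low s j))]
    exact h.diag_up s j
  have gen : ∀ ε : ℝ, ε ^ 2 = 1 → a s j j + a s k k + 2 * ε * a s j k ≤ 2 * δ⁻¹ := by
    intro ε hε
    have := h.up s (fun i => if i = j then 1 else if i = k then ε else 0)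
    have e1 : ∀ f : Fin d → ℝ, ∑ i, f i * (if i = j then 1 else if i = k then ε else 0) = f j + f k * ε := by
      intro f
      have : ∀ i, f i * (if i = j then 1 else if i = k then ε else 0)
          = (if i = j then f i else 0) + (if i = k then f i * ε else 0) := by
        intro i
        by_cases h1 : i = j
        · subst h1; simp [hjk]
        · simp [h1]
      simp [this, Finset.sum_add_distrib]
    have e2 : ∑ i, (if i = j then 1 else if i = k then ε else 0 : ℝ) ^ 2 = 1 + ε ^ 2 := by
      simp_rw [pow_two]
      rw [e1]
      simp [Ne.symm hjk]
    simp_rw [e1] at this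
    rw [e2] at this
    have e3 : ∀ i, a s i j * (if i = j then 1 else if i = k then ε else 0) +
        a s i k * (if i = j then 1 else if i = k then ε else 0) * ε
        = (a s i j + a s i k * ε) * (if i = j then 1 else if i = k then ε else 0) := by
      intro i; ring
    simp_rw [e3] at this
    rw [e1, hε] at this
    rw [h.symm s k j] at this
    have e4 : a s k k * ε * ε = a s k k := by rw [mul_assoc, ← pow_two, hε, mul_one]
    linarith [this, e4, add_mul (a s j k) (a s k k * ε) ε]
  have h1 := gen 1 (by norm_num)
  have h2 := gen (-1) (by norm_num)
  have h3 := h.diag_low s j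
  have h4 := h.diag_low s k
  rw [_root_.abs_le]
  constructor <;> linarith

/-- The operator `L₀`. -/
noncomputable def Lop (i0 : Fin d) (a : ℝ → Fin d → Fin d → ℝ) (u : EE d → ℝ) : EE d → ℝ :=
  fun p => DD none u p + ∑ j, ∑ k, a (p.2 i0) j k * DD (some j) (DD (some k) u) p

/-- Half space `t > T`. -/
def HS (d : ℕ) (T : ℝ) : Set (EE d) := {p | T < p.1}

theorem HS_meas (T : ℝ) : MeasurableSet (HS d T) :=
  measurableSet_lt measurable_const measurable_fst

/-- bounded measurable weight -/
def BW (b : ℝ → ℝ) : Prop := Measurable b ∧ ∃ C, ∀ s, |b s| ≤ C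

theorem BW.LB {b : ℝ → ℝ} (h : BW b) (i0 : Fin d) : LB (fun p : EE d => b (p.2 i0)) := by
  obtain ⟨hm, C, hC⟩ := h
  refine ⟨hm.comp ((measurable_pi_apply i0).comp measurable_snd), fun R => ⟨C, fun p _ => hC _⟩⟩

theorem BW.one : BW (fun _ => (1 : ℝ)) := ⟨measurable_const, 1, by simp⟩

theorem Ell.BW {δ : ℝ} (hδ : 0 < δ) {a : ℝ → Fin d → Fin d → ℝ} (h : Ell δ a) (j k : Fin d) :
    BW (fun s => a s j k) := ⟨h.meas j k, δ⁻¹, fun s => h.abs_le hδ s j k⟩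

theorem Ell.inv_bd {δ : ℝ} (hδ : 0 < δ) {a : ℝ → Fin d → Fin d → ℝ} (h : Ell δ a) (s : ℝ) (j : Fin d) :
    δ ≤ (a s j j)⁻¹ ∧ (a s j j)⁻¹ ≤ δ⁻¹ := by
  have h1 := h.diag_low s j
  have h2 := h.diag_up s j
  constructor
  · rw [le_inv_comm₀ hδ (by linarith)]; exact h2
  · exact inv_anti₀ hδ h1

theorem Ell.BW_inv {δ : ℝ} (hδ : 0 < δ) {a : ℝ → Fin d → Fin d → ℝ} (h : Ell δ a) (j : Fin d) :
    _root_.BW (fun s => (a s j j)⁻¹) := by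
  refine ⟨(h.meas j j).inv, δ⁻¹, fun s => ?_⟩
  have := h.inv_bd hδ s j
  rw [abs_of_nonneg (hδ.le.trans this.1)]
  exact this.2

theorem BW.mul {b c : ℝ → ℝ} (h : BW b) (h2 : BW c) : BW (fun s => b s * c s) := by
  obtain ⟨hm, C, hC⟩ := h
  obtain ⟨hm2, C2, hC2⟩ := h2
  refine ⟨hm.mul hm2, C * C2, fun s => ?_⟩
  rw [abs_mul]
  exact mul_le_mul (hC s) (hC2 s) (abs_nonneg _) ((abs_nonneg _).trans (hC s))

theorem Lop_LB {δ : ℝ} (hδ : 0 < δ) {a : ℝ → Fin d → Fin d → ℝ} (h : Ell δ a) (i0 : Fin d)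
    {u : EE d → ℝ} (hu : Sm u) : LB (Lop i0 a u) := by
  refine LB.add (hu.DD _).LB ?_
  refine LB.sum _ fun j _ => LB.sum _ fun k _ => ?_
  exact LB.mul ((h.BW hδ j k).LB i0) ((hu.DD _).DD _).LB

instance EE_haar : (volume : Measure (EE d)).IsAddHaarMeasure := by
  rw [Measure.volume_eq_prod]; infer_instance

theorem ibp_gen (i : Option (Fin d)) {c : EE d → ℝ} (hc : LB c)
    (hl : ∀ p (s : ℝ), c (p + s • ev i) = c p) {F : EE d → ℝ} (hF : TF F) :
    ∫ p, c p * DD i F p = 0 := by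
  have key := integral_bilinear_hasLineDerivAt_right_eq_neg_left_of_integrable
    (μ := (volume : Measure (EE d))) (f := c) (f' := fun _ => 0) (g := F) (g' := DD i F)
    (v := ev i) (B := ContinuousLinearMap.mul ℝ ℝ) (by simp)
    (by
      simp only [ContinuousLinearMap.mul_apply']
      exact (hc.mul (hF.DD i).1.LB).integrable (hF.DD i).2 (by intro p hp; simp [hp]))
    (by
      simp only [ContinuousLinearMap.mul_apply']
      exact (hc.mul hF.1.LB).integrable hF.2 (by intro p hp; simp [hp]))
    (by
      intro x _
      unfold HasLineDerivAt
      have : (fun t : ℝ => c (x + t • ev i)) = fun _ => c x := by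
        funext t; exact hl x t
      rw [this]; exact hasDerivAt_const _ _)
    (by
      intro x _
      exact (hF.1.diff x).hasFDerivAt.hasLineDerivAt _)
  simpa using key

theorem ibp_x (i0 j : Fin d) (hj : j ≠ i0) {b : ℝ → ℝ} (hb : BW b) (T : ℝ)
    {F : EE d → ℝ} (hF : TF F) : ∫ p in HS d T, b (p.2 i0) * DD (some j) F p = 0 := by
  rw [← integral_indicator (HS_meas T)]
  have hI : LB (fun p : EE d => (HS d T).indicator (fun q => b (q.2 i0)) p) := by
    have := hb.LB i0
    refine ⟨this.1.indicator (HS_meas T), fun R => ?_⟩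
    obtain ⟨C, hC⟩ := this.2 R
    refine ⟨C, fun p hp => ?_⟩
    by_cases hm : p ∈ HS d T
    · simpa [hm] using hC p hp
    · simpa [hm] using (abs_nonneg _).trans (hC p hp)
  have := ibp_gen (some j) hI (by
    intro p s
    have h1 : (p + s • ev (some j)).1 = p.1 := by simp [ev]
    have h2 : (p + s • ev (some j)).2 i0 = p.2 i0 := by simp [ev, Ne.symm hj]
    simp only [Set.indicator, HS, Set.mem_ofPred_eq, h1, h2]
    by_cases hT : T < p.1 <;> simp [hT]) hF
  rw [← this]
  congr 1
  funext p
  simp only [Set.indicator]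
  split_ifs <;> simp

theorem ibp_0 (j : Fin d) (T : ℝ) {F : EE d → ℝ} (hF : TF F) :
    ∫ p in HS d T, DD (some j) F p = 0 := by
  rw [← integral_indicator (HS_meas T)]
  have hI : LB (fun p : EE d => (HS d T).indicator (fun _ => (1 : ℝ)) p) := by
    refine ⟨measurable_const.indicator (HS_meas T), fun R => ⟨1, fun p _ => ?_⟩⟩
    by_cases hm : p ∈ HS d T <;> simp [hm]
  have := ibp_gen (some j) hI (by
    intro p s
    have h1 : (p + s • ev (some j)).1 = p.1 := by simp [ev]
    simp only [Set.indicator, HS, Set.mem_ofPred_eq, h1]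
    by_cases hT : T < p.1 <;> simp [hT]) hF
  rw [← this]
  congr 1
  funext p
  simp only [Set.indicator]
  split_ifs <;> simp

theorem ibp_t (i0 : Fin d) {b : ℝ → ℝ} (hb : BW b) (hb0 : ∀ s, 0 ≤ b s) (T : ℝ)
    {F : EE d → ℝ} (hF : TF F) (hF0 : ∀ p, 0 ≤ F p) :
    ∫ p in HS d T, b (p.2 i0) * DD none F p ≤ 0 := by
  have hint : Integrable (fun p : EE d => b (p.2 i0) * DD none F p) :=
    ((hb.LB i0).mul (hF.DD none).1.LB).integrable (hF.DD none).2 (by intro p hp; simp [hp])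
  have hset : HS d T = Set.Ioi T ×ˢ (Set.univ : Set (Fin d → ℝ)) := by
    ext p; simp [HS]
  rw [hset]
  have hint2 : IntegrableOn (fun p : EE d => b (p.2 i0) * DD none F p)
    (Set.Ioi T ×ˢ (Set.univ : Set (Fin d → ℝ))) := hint.integrableOn
  rw [Measure.volume_eq_prod] at hint2 ⊢
  unfold IntegrableOn at hint2
  rw [← Measure.prod_restrict] at hint2 ⊢
  rw [integral_prod_symm _ hint2]
  refine integral_nonpos fun x => ?_
  simp only [Pi.zero_apply]
  rw [integral_const_mul]
  refine mul_nonpos_of_nonneg_of_nonpos (hb0 _) ?_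
  have hd : ∀ t, HasDerivAt (fun s : ℝ => F (s, x)) (DD none F (t, x)) t := by
    intro t
    have h1 : HasDerivAt (fun s : ℝ => ((s, x) : EE d)) (1, 0) t :=
      (hasDerivAt_id t).prodMk (hasDerivAt_const t x)
    exact (hF.1.diff (t, x)).hasFDerivAt.comp_hasDerivAt t h1
  have hcs : ∀ G : EE d → ℝ, TF G → HasCompactSupport (fun s : ℝ => G (s, x)) := by
    intro G hG
    refine HasCompactSupport.comp_isClosedEmbedding hG.2 (g := fun s : ℝ => ((s, x) : EE d)) ?_
    refine ⟨isEmbedding_prodMkLeft x, ?_⟩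
    have : Set.range (fun s : ℝ => ((s, x) : EE d)) = {p | p.2 = x} := by
      ext p; constructor
      · rintro ⟨s, rfl⟩; rfl
      · intro h; exact ⟨p.1, by ext <;> simp_all⟩
    rw [this]
    exact isClosed_eq continuous_snd continuous_const
  have h2 := integral_Ioi_of_hasDerivAt_of_tendsto (a := T) (f := fun s : ℝ => F (s, x))
    (f' := fun t => DD none F (t, x)) (m := 0)
    (hd T).continuousAt.continuousWithinAt (fun t _ => hd t)
    (by
      have : Continuous fun s : ℝ => DD none F (s, x) := (hF.DD none).1.cont.comp (by fun_prop)
      exact (this.integrable_of_hasCompactSupport (hcs _ (hF.DD none))).integrableOn)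
    (by
      have := (hcs F hF)
      have hz := this.is_zero_at_infty
      exact hz.mono_left (atTop_le_cocompact))
  rw [h2]
  have := hF0 (T, x)
  simp; linarith

end Energy
end P2

section P3
section Energy2
open MeasureTheory

variable {d : ℕ}

/-- locally bounded with bounded support -/
def CI (F : EE d → ℝ) : Prop := LB F ∧ ∃ R : ℝ, ∀ p, R < ‖p‖ → F p = 0

theorem CI.add {F G : EE d → ℝ} (hF : CI F) (hG : CI G) : CI (fun p => F p + G p) := by
  obtain ⟨R, hR⟩ := hF.2
  obtain ⟨S, hS⟩ := hG.2
  refine ⟨hF.1.add hG.1, max R S, fun p hp => ?_⟩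
  simp [hR p ((le_max_left _ _).trans_lt hp), hS p ((le_max_right _ _).trans_lt hp)]

theorem CI.mul {F G : EE d → ℝ} (hF : CI F) (hG : LB G) : CI (fun p => F p * G p) := by
  obtain ⟨R, hR⟩ := hF.2
  exact ⟨hF.1.mul hG, R, fun p hp => by simp [hR p hp]⟩

theorem CI.mul' {F G : EE d → ℝ} (hF : LB F) (hG : CI G) : CI (fun p => F p * G p) := by
  obtain ⟨R, hR⟩ := hG.2
  exact ⟨hF.mul hG.1, R, fun p hp => by simp [hR p hp]⟩

theorem CI.sub {F G : EE d → ℝ} (hF : CI F) (hG : CI G) : CI (fun p => F p - G p) := by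
  have := hF.add (CI.mul' (LB.const (-1)) hG)
  simpa [sub_eq_add_neg] using this

theorem CI.sq {F : EE d → ℝ} (hF : CI F) : CI (fun p => F p ^ 2) := by
  simpa [pow_two] using hF.mul hF.1

theorem CI.abs {F : EE d → ℝ} (hF : CI F) : CI (fun p => |F p|) := by
  obtain ⟨R, hR⟩ := hF.2
  exact ⟨hF.1.abs, R, fun p hp => by simp [hR p hp]⟩

theorem CI.sum {ι : Type*} (s : Finset ι) {F : ι → EE d → ℝ} (hF : ∀ i ∈ s, CI (F i)) :
    CI (fun p => ∑ i ∈ s, F i p) := by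
  classical
  induction s using Finset.induction_on with
  | empty => exact ⟨by simpa using LB.const 0, 0, by simp⟩
  | insert a s ha ih =>
    simp only [Finset.sum_insert ha]
    exact (hF a (by simp)).add (ih fun i hi => hF i (by simp [hi]))

theorem CI.int {F : EE d → ℝ} (hF : CI F) : Integrable F := by
  obtain ⟨R, hR⟩ := hF.2
  have h1 := hF.1.integrableOn (s := Metric.closedBall 0 R) Metric.isBounded_closedBall
  rw [integrableOn_iff_integrable_of_support_subset] at h1
  · exact h1
  · intro p hp
    by_contra hc
    exact hp (hR p (by simpa using hc))

theorem CI.int' {F : EE d → ℝ} (hF : CI F) (T : ℝ) : Integrable F (volume.restrict (HS d T)) :=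
  hF.int.restrict

theorem TF.CI {F : EE d → ℝ} (hF : TF F) : CI F := by
  refine ⟨hF.1.LB, ?_⟩
  obtain ⟨R, hR⟩ := hF.2.isCompact.isBounded.subset_closedBall 0
  refine ⟨R, fun p hp => ?_⟩
  apply image_eq_zero_of_notMem_tsupport
  intro h
  have := hR h
  simp at this
  linarith

theorem Lop_CI {δ : ℝ} (hδ : 0 < δ) {a : ℝ → Fin d → Fin d → ℝ} (h : Ell δ a) (i0 : Fin d)
    {u : EE d → ℝ} (hu : TF u) : CI (Lop i0 a u) := by
  refine CI.add (hu.DD _).CI ?_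
  refine CI.sum _ fun j _ => CI.sum _ fun k _ => ?_
  exact CI.mul' ((h.BW hδ j k).LB i0) ((hu.DD _).DD _).CI

theorem energy1 {δ : ℝ} (hδ : 0 < δ) {a : ℝ → Fin d → Fin d → ℝ} (h : Ell δ a) (i0 : Fin d)
    (T : ℝ) {φ : EE d → ℝ} (hφ : TF φ) :
    ∫ p in HS d T, (δ ^ 2 * ∑ j, DD (some j) φ p ^ 2
      + (a (p.2 i0) i0 i0)⁻¹ * (Lop i0 a φ p * φ p)) ≤ 0 := by
  have hb := h.BW_inv hδ i0
  have hbl := hb.LB i0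
  have hc : ∀ j k, BW (fun s => a s j k * (a s i0 i0)⁻¹) := fun j k => (h.BW hδ j k).mul hb
  have hD : ∀ i, TF (DD i φ) := fun i => hφ.DD i
  have hD2 : ∀ i j, TF (DD i (DD j φ)) := fun i j => (hD j).DD i
  -- second order terms
  have h2 : ∀ j k, ∫ p in HS d T, a (p.2 i0) j k * (a (p.2 i0) i0 i0)⁻¹ *
      (DD (some j) (DD (some k) φ) p * φ p + DD (some j) φ p * DD (some k) φ p) = 0 := by
    intro j k
    by_cases hj : j = i0
    · by_cases hk : k = i0
      · subst hk; subst hj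
        have := ibp_0 j T ((hD (some j)).mul hφ.1)
        rw [DD_mul (hD _).1 hφ.1] at this
        rw [← this]
        congr 1; funext p
        have : a (p.2 j) j j ≠ 0 := (hδ.trans_le (h.diag_low _ _)).ne'
        rw [mul_inv_cancel₀ this, one_mul]
      · have := ibp_x i0 k hk (hc j k) T ((hD (some j)).mul hφ.1)
        rw [DD_mul (hD _).1 hφ.1, DD_comm hφ.1] at this
        exact this
    · have := ibp_x i0 j hj (hc j k) T ((hD (some k)).mul hφ.1)
      rw [DD_mul (hD _).1 hφ.1] at this
      rw [← this]
      congr 1; funext p; ring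
  have ht : ∫ p in HS d T, (a (p.2 i0) i0 i0)⁻¹ * (DD none φ p * φ p) ≤ 0 := by
    have := ibp_t i0 hb (fun s => hδ.le.trans (h.inv_bd hδ s i0).1) T (hφ.mul hφ.1)
      (fun p => mul_self_nonneg _)
    rw [DD_mul hφ.1 hφ.1] at this
    have e : ∀ p : EE d, (a (p.2 i0) i0 i0)⁻¹ * (DD none φ p * φ p + φ p * DD none φ p)
      = 2 * ((a (p.2 i0) i0 i0)⁻¹ * (DD none φ p * φ p)) := by intro p; ring
    simp_rw [e] at this
    rw [integral_const_mul] at this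
    linarith
  have hintT : ∀ j k, CI (fun p : EE d => a (p.2 i0) j k * (a (p.2 i0) i0 i0)⁻¹ *
      (DD (some j) (DD (some k) φ) p * φ p + DD (some j) φ p * DD (some k) φ p)) := by
    intro j k
    exact CI.mul' ((hc j k).LB i0)
      (((hD2 _ _).CI.mul hφ.1.LB).add ((hD _).CI.mul (hD _).1.LB))
  have hI1 : CI (fun p : EE d => (a (p.2 i0) i0 i0)⁻¹ * (DD none φ p * φ p)) :=
    CI.mul' hbl ((hD _).CI.mul hφ.1.LB)
  have hI2 : CI (fun p : EE d => ∑ j, ∑ k, a (p.2 i0) j k * (a (p.2 i0) i0 i0)⁻¹ *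
      (DD (some j) (DD (some k) φ) p * φ p + DD (some j) φ p * DD (some k) φ p)) :=
    CI.sum _ fun j _ => CI.sum _ fun k _ => hintT j k
  have hsum : ∫ p in HS d T, ((a (p.2 i0) i0 i0)⁻¹ * (DD none φ p * φ p) +
      ∑ j, ∑ k, a (p.2 i0) j k * (a (p.2 i0) i0 i0)⁻¹ *
      (DD (some j) (DD (some k) φ) p * φ p + DD (some j) φ p * DD (some k) φ p)) ≤ 0 := by
    rw [integral_add (hI1.int' T) (hI2.int' T)]
    rw [integral_finsetSum _ (fun j _ => (CI.sum _ fun k _ => hintT j k).int' T)]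
    simp_rw [integral_finsetSum _ (fun k _ => (hintT _ k).int' T), h2]
    simpa using ht
  refine le_trans (integral_mono ?_ ((hI1.add hI2).int' T) ?_) hsum
  · refine CI.int' (CI.add ?_ ?_) T
    · exact CI.mul' (LB.const _) (CI.sum _ fun j _ => (hD _).CI.sq)
    · exact CI.mul' hbl ((Lop_CI hδ h i0 hφ).mul hφ.1.LB)
  · intro p
    simp only [Lop]
    have hlow := h.low (p.2 i0) (fun j => DD (some j) φ p)
    have hinv := (h.inv_bd hδ (p.2 i0) i0).1
    set B := (a (p.2 i0) i0 i0)⁻¹ with hB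
    have e : ∑ j, ∑ k, a (p.2 i0) j k * B *
      (DD (some j) (DD (some k) φ) p * φ p + DD (some j) φ p * DD (some k) φ p)
      = B * ((∑ j, ∑ k, a (p.2 i0) j k * DD (some j) (DD (some k) φ) p) * φ p) +
        B * (∑ j, ∑ k, a (p.2 i0) j k * DD (some j) φ p * DD (some k) φ p) := by
      simp only [Finset.sum_mul, Finset.mul_sum]
      simp only [← Finset.sum_add_distrib]
      refine Finset.sum_congr rfl fun j _ => Finset.sum_congr rfl fun k _ => ?_
      ring
    rw [e]
    have hS : 0 ≤ ∑ j, DD (some j) φ p ^ 2 := Finset.sum_nonneg fun j _ => sq_nonneg _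
    have h3 : δ * (δ * ∑ j, DD (some j) φ p ^ 2) ≤ B * (∑ j, ∑ k, a (p.2 i0) j k * DD (some j) φ p * DD (some k) φ p) :=
      mul_le_mul hinv hlow (by positivity) (hδ.le.trans hinv)
    nlinarith [h3]

end Energy2
end P3

section P4
section Apriori
open MeasureTheory

variable {d : ℕ}

/-- sum of squares of good second derivatives -/
def Gd (i0 : Fin d) (M : Fin d → Fin d → ℝ) : ℝ := ∑ m, if m = i0 then 0 else ∑ j, M j m ^ 2

theorem Gd_eq (i0 : Fin d) (M : Fin d → Fin d → ℝ) :
    Gd i0 M = ∑ j, ∑ k, if k = i0 then 0 else M j k ^ 2 := by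
  rw [Finset.sum_comm]
  unfold Gd
  refine Finset.sum_congr rfl fun m _ => ?_
  by_cases h : m = i0 <;> simp [h]

theorem Gd_nonneg (i0 : Fin d) (M : Fin d → Fin d → ℝ) : 0 ≤ Gd i0 M := by
  rw [Gd_eq]
  refine Finset.sum_nonneg fun j _ => Finset.sum_nonneg fun k _ => ?_
  split_ifs <;> positivity

theorem Gd_two (i0 : Fin d) (M : Fin d → Fin d → ℝ) :
    2 * Gd i0 M = ∑ j, ∑ k, ((if k = i0 then 0 else M j k ^ 2) + (if j = i0 then 0 else M k j ^ 2)) := by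
  simp only [Finset.sum_add_distrib]
  rw [two_mul]
  congr 1
  · rw [Gd_eq]
  · rw [Gd_eq, Finset.sum_comm]

theorem full_le (i0 : Fin d) {M : Fin d → Fin d → ℝ} (hM : ∀ j k, M j k = M k j) :
    ∑ j, ∑ k, M j k ^ 2 ≤ M i0 i0 ^ 2 + 2 * Gd i0 M := by
  rw [Gd_two]
  have : M i0 i0 ^ 2 = ∑ j, ∑ k, (if j = i0 then (if k = i0 then M i0 i0 ^ 2 else 0) else 0) := by
    simp
  rw [this, ← Finset.sum_add_distrib]
  refine Finset.sum_le_sum fun j _ => ?_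
  rw [← Finset.sum_add_distrib]
  refine Finset.sum_le_sum fun k _ => ?_
  by_cases h1 : j = i0 <;> by_cases h2 : k = i0
  · subst h1; subst h2; simp
  · simp [h1, h2]
  · simp [h1, h2, hM i0 j]
  · simp [h1, h2]; positivity

theorem sq_sum_sum_le (r : Fin d → Fin d → ℝ) :
    (∑ j, ∑ k, r j k) ^ 2 ≤ (d : ℝ) ^ 2 * ∑ j, ∑ k, r j k ^ 2 := by
  have := sq_sum_le_card_mul_sum_sq (s := (Finset.univ : Finset (Fin d × Fin d))) (f := fun x => r x.1 x.2)
  simp only [Fintype.sum_prod_type] at this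
  refine this.trans (le_of_eq ?_)
  simp [pow_two]

theorem rest_le {δ : ℝ} (hδ : 0 < δ) {a : ℝ → Fin d → Fin d → ℝ} (h : Ell δ a) (i0 : Fin d) (s : ℝ)
    {M : Fin d → Fin d → ℝ} (hM : ∀ j k, M j k = M k j) :
    ((a s i0 i0)⁻¹ * (∑ j, ∑ k, a s j k * M j k) - M i0 i0) ^ 2 ≤ 2 * d ^ 2 * (δ⁻¹) ^ 4 * Gd i0 M := by
  set B := (a s i0 i0)⁻¹ with hB
  have hBB : B * a s i0 i0 = 1 := inv_mul_cancel₀ (hδ.trans_le (h.diag_low _ _)).ne'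
  have e : B * (∑ j, ∑ k, a s j k * M j k) - M i0 i0
      = ∑ j, ∑ k, (if j = i0 then (if k = i0 then 0 else B * a s j k * M j k) else B * a s j k * M j k) := by
    have : M i0 i0 = ∑ j, ∑ k, (if j = i0 then (if k = i0 then M i0 i0 else 0) else 0) := by
      simp
    rw [this, Finset.mul_sum, ← Finset.sum_sub_distrib]
    refine Finset.sum_congr rfl fun j _ => ?_
    rw [Finset.mul_sum, ← Finset.sum_sub_distrib]
    refine Finset.sum_congr rfl fun k _ => ?_
    by_cases h1 : j = i0 <;> by_cases h2 : k = i0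
    · subst h1; subst h2; simp [← mul_assoc, hBB]
    all_goals simp [h1, h2, mul_assoc]
  rw [e]
  refine (sq_sum_sum_le _).trans ?_
  have : 2 * (d:ℝ) ^ 2 * (δ⁻¹) ^ 4 * Gd i0 M = (d:ℝ)^2 * ((δ⁻¹) ^ 4 * (2 * Gd i0 M)) := by ring
  rw [this]
  refine mul_le_mul_of_nonneg_left ?_ (by positivity)
  rw [Gd_two, Finset.mul_sum]
  refine Finset.sum_le_sum fun j _ => ?_
  rw [Finset.mul_sum]
  refine Finset.sum_le_sum fun k _ => ?_
  have hb := h.inv_bd hδ s i0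
  have hc : (B * a s j k) ^ 2 ≤ (δ⁻¹) ^ 4 := by
    have h1 : |B * a s j k| ≤ (δ⁻¹) ^ 2 := by
      rw [abs_mul, abs_of_nonneg (hδ.le.trans hb.1), pow_two]
      exact mul_le_mul hb.2 (h.abs_le hδ s j k) (abs_nonneg _) (by positivity)
    rw [← sq_abs]
    calc |B * a s j k| ^ 2 ≤ ((δ⁻¹) ^ 2) ^ 2 := by gcongr
      _ = _ := by ring
  have hc2 : (B * a s j k * M j k) ^ 2 ≤ (δ⁻¹) ^ 4 * M j k ^ 2 := by
    rw [mul_pow]; gcongr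
  have hn : 0 ≤ (δ⁻¹) ^ 4 * M j k ^ 2 := by positivity
  by_cases h1 : j = i0 <;> by_cases h2 : k = i0
  · simp [h1, h2]
  · simp only [h1, h2, if_true, if_false]; subst h1; linarith
  · simp only [h1, h2, if_true, if_false]; subst h2; rw [hM k j]; linarith
  · simp only [h1, h2, if_false]; rw [hM k j]; linarith

theorem E2 {δ : ℝ} (hδ : 0 < δ) {a : ℝ → Fin d → Fin d → ℝ} (h : Ell δ a) (i0 : Fin d)
    (T : ℝ) {φ : EE d → ℝ} (hφ : TF φ) (m : Fin d) (hm : m ≠ i0) :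
    ∫ p in HS d T, ∑ j, DD (some j) (DD (some m) φ) p ^ 2 ≤
      (δ⁻¹) ^ 6 * ∫ p in HS d T, Lop i0 a φ p ^ 2 := by
  have hb := h.BW_inv hδ i0
  have hbl := hb.LB i0
  have hc : ∀ j k, BW (fun s => a s j k * (a s i0 i0)⁻¹) := fun j k => (h.BW hδ j k).mul hb
  have hD : ∀ i, TF (DD i φ) := fun i => hφ.DD i
  have hD2 : ∀ i j, TF (DD i (DD j φ)) := fun i j => (hD j).DD i
  have hen := energy1 hδ h i0 T (hD (some m))
  have gen : ∀ (b : ℝ → ℝ), BW b → ∀ F : EE d → ℝ, TF F →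
      ∫ p in HS d T, b (p.2 i0) * (DD (some m) F p * DD (some m) φ p + F p * DD (some m) (DD (some m) φ) p) = 0 := by
    intro b hb F hF
    have := ibp_x i0 m hm hb T (hF.mul (hD (some m)).1)
    rwa [DD_mul hF.1 (hD (some m)).1] at this
  have hCI : ∀ (b : ℝ → ℝ), BW b → ∀ F : EE d → ℝ, TF F →
      CI (fun p : EE d => b (p.2 i0) * (DD (some m) F p * DD (some m) φ p + F p * DD (some m) (DD (some m) φ) p)) := by
    intro b hb F hF
    exact CI.mul' (hb.LB i0) (((hF.DD _).CI.mul (hD _).1.LB).add (hF.CI.mul (hD2 _ _).1.LB))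
  have hsum : ∫ p in HS d T, ((a (p.2 i0) i0 i0)⁻¹ * (Lop i0 a (DD (some m) φ) p * DD (some m) φ p) +
      (a (p.2 i0) i0 i0)⁻¹ * (Lop i0 a φ p * DD (some m) (DD (some m) φ) p)) = 0 := by
    have e : ∀ p : EE d, (a (p.2 i0) i0 i0)⁻¹ * (Lop i0 a (DD (some m) φ) p * DD (some m) φ p) +
      (a (p.2 i0) i0 i0)⁻¹ * (Lop i0 a φ p * DD (some m) (DD (some m) φ) p)
      = (a (p.2 i0) i0 i0)⁻¹ * (DD (some m) (DD none φ) p * DD (some m) φ p + (DD none φ) p * DD (some m) (DD (some m) φ) p)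
       + ∑ j, ∑ k, (a (p.2 i0) j k * (a (p.2 i0) i0 i0)⁻¹) * (DD (some m) (DD (some j) (DD (some k) φ)) p * DD (some m) φ p
         + (DD (some j) (DD (some k) φ)) p * DD (some m) (DD (some m) φ) p) := by
      intro p
      simp only [Lop]
      have e1 : ∀ j k, DD (some m) (DD (some j) (DD (some k) φ)) = DD (some j) (DD (some k) (DD (some m) φ)) := by
        intro j k
        rw [DD_comm (hD _).1, DD_comm hφ.1 (some m) (some k)]
      rw [DD_comm hφ.1 (some m) none]
      simp only [e1]
      set B := (a (p.2 i0) i0 i0)⁻¹ with hB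
      have e2 : ∑ j, ∑ k, (a (p.2 i0) j k * B) * (DD (some j) (DD (some k) (DD (some m) φ)) p * DD (some m) φ p
         + (DD (some j) (DD (some k) φ)) p * DD (some m) (DD (some m) φ) p)
         = B * ((∑ j, ∑ k, a (p.2 i0) j k * DD (some j) (DD (some k) (DD (some m) φ)) p) * DD (some m) φ p)
          + B * ((∑ j, ∑ k, a (p.2 i0) j k * DD (some j) (DD (some k) φ) p) * DD (some m) (DD (some m) φ) p) := by
        simp only [Finset.sum_mul, Finset.mul_sum]
        simp only [← Finset.sum_add_distrib]
        refine Finset.sum_congr rfl fun j _ => Finset.sum_congr rfl fun k _ => ?_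
        ring
      rw [e2]; ring
    simp_rw [e]
    have hI := hCI _ hb _ (hD none)
    have hJ := fun j k => hCI _ (hc j k) _ (hD2 (some j) (some k))
    rw [integral_add (hI.int' T) ((CI.sum _ fun j _ => CI.sum _ fun k _ => hJ j k).int' T)]
    rw [gen _ hb _ (hD none)]
    rw [integral_finsetSum _ (fun j _ => (CI.sum _ fun k _ => hJ j k).int' T)]
    simp_rw [integral_finsetSum _ (fun k _ => (hJ _ k).int' T)]
    have := fun j k => gen _ (hc j k) _ (hD2 (some j) (some k))
    simp [this]
  have hL := Lop_CI hδ h i0 hφ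
  have hLm := Lop_CI hδ h i0 (hD (some m))
  have c1 : CI (fun p => ∑ j, DD (some j) (DD (some m) φ) p ^ 2) := CI.sum _ fun j _ => (hD2 _ _).CI.sq
  have c2 : CI (fun p => (a (p.2 i0) i0 i0)⁻¹ * (Lop i0 a (DD (some m) φ) p * DD (some m) φ p)) :=
    CI.mul' hbl (hLm.mul (hD _).1.LB)
  have c3 : CI (fun p => (a (p.2 i0) i0 i0)⁻¹ * (Lop i0 a φ p * DD (some m) (DD (some m) φ) p)) :=
    CI.mul' hbl (hL.mul (hD2 _ _).1.LB)
  have c4 := hL.sq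
  rw [integral_add (c2.int' T) (c3.int' T)] at hsum
  have c5 := CI.mul' (LB.const (δ^2)) c1
  rw [integral_add (c5.int' T) (c2.int' T), integral_const_mul] at hen
  have hle : ∫ p in HS d T, (a (p.2 i0) i0 i0)⁻¹ * (Lop i0 a φ p * DD (some m) (DD (some m) φ) p)
      ≤ ∫ p in HS d T, (δ^2/2 * (∑ j, DD (some j) (DD (some m) φ) p ^ 2) + (δ⁻¹)^4/2 * Lop i0 a φ p ^ 2) := by
    refine integral_mono (c3.int' T) ((CI.add (CI.mul' (LB.const _) c1) (CI.mul' (LB.const _) c4)).int' T) ?_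
    intro p
    simp only
    have hbd := h.inv_bd hδ (p.2 i0) i0
    set B := (a (p.2 i0) i0 i0)⁻¹
    set x := DD (some m) (DD (some m) φ) p with hx
    set y := Lop i0 a φ p
    have h1 : x ^ 2 ≤ ∑ j, DD (some j) (DD (some m) φ) p ^ 2 :=
      Finset.single_le_sum (f := fun j => DD (some j) (DD (some m) φ) p ^ 2) (fun j _ => sq_nonneg _) (Finset.mem_univ m)
    have h2 : B * (y * x) ≤ δ^2/2 * x^2 + (δ⁻¹)^2/2 * (B*y)^2 := by
      have : 0 ≤ (δ * x - δ⁻¹ * (B * y))^2 := sq_nonneg _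
      have hdd : δ * δ⁻¹ = 1 := mul_inv_cancel₀ hδ.ne'
      have e : (δ * x - δ⁻¹ * (B * y))^2 = δ^2 * x^2 - 2 * (δ*δ⁻¹) * (B * (y*x)) + (δ⁻¹)^2 * (B*y)^2 := by ring
      rw [e, hdd] at this
      linarith
    have h3 : (B*y)^2 ≤ (δ⁻¹)^2 * y^2 := by
      rw [mul_pow]; gcongr
      · exact hδ.le.trans hbd.1
      · exact hbd.2
    have h4 : (δ⁻¹)^2/2 * (B*y)^2 ≤ (δ⁻¹)^2/2 * ((δ⁻¹)^2 * y^2) := by gcongr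
    have h5 : δ^2/2 * x^2 ≤ δ^2/2 * ∑ j, DD (some j) (DD (some m) φ) p ^ 2 := by gcongr
    have e6 : (δ⁻¹)^2/2 * ((δ⁻¹)^2 * y^2) = (δ⁻¹)^4/2 * y^2 := by ring
    linarith
  rw [integral_add ((CI.mul' (LB.const _) c1).int' T) ((CI.mul' (LB.const _) c4).int' T),
    integral_const_mul, integral_const_mul] at hle
  set I1 := ∫ p in HS d T, ∑ j, DD (some j) (DD (some m) φ) p ^ 2
  set I4 := ∫ p in HS d T, Lop i0 a φ p ^ 2
  have h7 : δ^2/2 * I1 ≤ (δ⁻¹)^4/2 * I4 := by linarith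
  have hdd : δ^2 * (δ⁻¹)^2 = 1 := by rw [← mul_pow, mul_inv_cancel₀ hδ.ne', one_pow]
  calc I1 = 2 * (δ⁻¹)^2 * (δ^2/2 * I1) := by linear_combination (-I1) * hdd
    _ ≤ 2 * (δ⁻¹)^2 * ((δ⁻¹)^4/2 * I4) := by gcongr
    _ = _ := by ring

theorem E3 (i0 : Fin d) (T : ℝ) {φ : EE d → ℝ} (hφ : TF φ) :
    0 ≤ ∫ p in HS d T, DD (some i0) (DD (some i0) φ) p * DD none φ p := by
  have hD : ∀ i, TF (DD i φ) := fun i => hφ.DD i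
  have hD2 : ∀ i j, TF (DD i (DD j φ)) := fun i j => (hD j).DD i
  have h1 := ibp_0 i0 T ((hD (some i0)).mul (hD none).1)
  rw [DD_mul (hD _).1 (hD _).1, DD_comm hφ.1 (some i0) none] at h1
  have h2 := ibp_t i0 BW.one (by simp) T ((hD (some i0)).mul (hD (some i0)).1) (fun p => mul_self_nonneg _)
  rw [DD_mul (hD _).1 (hD _).1] at h2
  have c1 : CI (fun p => DD (some i0) (DD (some i0) φ) p * DD none φ p) := (hD2 _ _).CI.mul (hD _).1.LB
  have c2 : CI (fun p => DD (some i0) φ p * DD none (DD (some i0) φ) p) := (hD _).CI.mul (hD2 _ _).1.LB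
  rw [integral_add (c1.int' T) (c2.int' T)] at h1
  have e : ∀ p : EE d, 1 * (DD none (DD (some i0) φ) p * DD (some i0) φ p + DD (some i0) φ p * DD none (DD (some i0) φ) p)
     = 2 * (DD (some i0) φ p * DD none (DD (some i0) φ) p) := by intro p; ring
  simp_rw [e] at h2
  rw [integral_const_mul] at h2
  linarith

theorem alg1 {δ e B x m y S G K F : ℝ} (hδ : 0 < δ) (he0 : 0 < e) (hde : δ * e = 1) (hbd1 : δ ≤ B) (hbd2 : B ≤ e)
    (hr : (B * S - m) ^ 2 ≤ K * G) (hf : F ≤ m ^ 2 + 2 * G) (hy : y = x + S) :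
    x ^ 2 + F ≤ ((1 + 3*e^2)*(2*e^4) + 3*e^2) * y ^ 2 + ((1 + 3*e^2)*(2*e^2*K) + 3*K + 2) * G
      - ((1 + 3*e^2)*(2*e)) * (m * x) := by
  have hB2 : B ^ 2 ≤ e ^ 2 := by
    have := hδ.le.trans hbd1
    gcongr
  have hBy : (B*y)^2 ≤ e^2*y^2 := by rw [mul_pow]; gcongr
  have hBx : (B*x)^2 ≤ e^2*x^2 := by rw [mul_pow]; gcongr
  obtain ⟨R, hR⟩ : ∃ R, R = B * S - m := ⟨_, rfl⟩
  rw [← hR] at hr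
  have i1 : x^2 ≤ e^2*(2*e^2*y^2 + 2*K*G) - 2*e*(m*x) := by
    have q1 : B * x^2 + m * x = x * (B*y - R) := by rw [hR, hy]; ring
    have q2 : δ * x^2 ≤ B * x^2 := by gcongr
    have q3 : 2 * e * (x * (B*y-R)) ≤ x^2 + e^2*(B*y-R)^2 := by nlinarith [sq_nonneg (x - e*(B*y-R))]
    have q4 : (B*y-R)^2 ≤ 2*(e^2*y^2) + 2*(K*G) := by
      have : (B*y-R)^2 = 2*(B*y)^2+2*R^2 - (B*y+R)^2 := by ring
      linarith [sq_nonneg (B*y+R)]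
    have q5 : e^2*(B*y-R)^2 ≤ e^2*(2*(e^2*y^2) + 2*(K*G)) := by gcongr
    have q6 : e * (δ * x^2) ≤ e * (B*x^2) := by gcongr
    have q7 : e * (δ * x^2) = x^2 := by linear_combination x^2 * hde
    have q8 : 2 * e * (B * x^2 + m*x) = 2 * e * (x * (B*y - R)) := by rw [q1]
    linarith
  have i2 : m^2 ≤ 3*(e^2*y^2+e^2*x^2+K*G) := by
    have q1 : m = B*y - B*x - R := by rw [hR, hy]; ring
    have q2 : m^2 ≤ 3*((B*y)^2+(B*x)^2+R^2) := by
      rw [q1]; nlinarith [sq_nonneg (B*y+B*x), sq_nonneg (B*y+R), sq_nonneg (B*x-R)]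
    linarith
  have i3 := mul_le_mul_of_nonneg_left i1 (by positivity : 0 ≤ 1 + 3*e^2)
  linarith

theorem apriori (d : ℕ) {δ : ℝ} (hδ : 0 < δ) : ∃ C : ℝ, 0 < C ∧
    ∀ (a : ℝ → Fin d → Fin d → ℝ) (_ : Ell δ a) (i0 : Fin d) (T : ℝ) (φ : EE d → ℝ) (_ : TF φ),
    ∫ p in HS d T, (DD none φ p ^ 2 + ∑ j, ∑ k, DD (some j) (DD (some k) φ) p ^ 2) ≤
      C * ∫ p in HS d T, Lop i0 a φ p ^ 2 := by
  set e := δ⁻¹ with he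
  have he0 : 0 < e := inv_pos.2 hδ
  set K : ℝ := 2 * d ^ 2 * e ^ 4 with hK
  have hK0 : 0 ≤ K := by positivity
  set C1 : ℝ := (1 + 3*e^2)*(2*e^4) + 3*e^2 with hC1
  set C2 : ℝ := (1 + 3*e^2)*(2*e^2*K) + 3*K + 2 with hC2
  set C3 : ℝ := (1 + 3*e^2)*(2*e) with hC3
  have h1p : 0 < C1 := by positivity
  have h2p : 0 < C2 := by positivity
  have h3p : 0 < C3 := by positivity
  refine ⟨C1 + C2 * (d * e ^ 6), by positivity, ?_⟩
  intro a h i0 T φ hφ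
  have hD : ∀ i, TF (DD i φ) := fun i => hφ.DD i
  have hD2 : ∀ i j, TF (DD i (DD j φ)) := fun i j => (hD j).DD i
  have hL := (Lop_CI hδ h i0 hφ).sq
  have hG1 : ∀ m, CI (fun p => if m = i0 then 0 else ∑ j, DD (some j) (DD (some m) φ) p ^ 2) := by
    intro m
    by_cases hm : m = i0
    · simp only [hm, if_true]; exact ⟨LB.const 0, 0, by simp⟩
    · simp only [hm, if_false]; exact CI.sum _ fun j _ => (hD2 _ _).CI.sq
  have hG : CI (fun p => Gd i0 (fun j k => DD (some j) (DD (some k) φ) p)) := CI.sum _ fun m _ => hG1 m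
  have hP : CI (fun p => DD (some i0) (DD (some i0) φ) p * DD none φ p) := (hD2 _ _).CI.mul (hD _).1.LB
  have hGle : ∫ p in HS d T, Gd i0 (fun j k => DD (some j) (DD (some k) φ) p) ≤ d * e ^ 6 * ∫ p in HS d T, Lop i0 a φ p ^ 2 := by
    unfold Gd
    rw [integral_finsetSum _ (fun m _ => (hG1 m).int' T)]
    have hn : 0 ≤ e ^ 6 * ∫ p in HS d T, Lop i0 a φ p ^ 2 :=
      mul_nonneg (by positivity) (integral_nonneg fun p => sq_nonneg _)
    calc _ ≤ ∑ _m : Fin d, e ^ 6 * ∫ p in HS d T, Lop i0 a φ p ^ 2 := by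
          refine Finset.sum_le_sum fun m _ => ?_
          by_cases hm : m = i0
          · simpa only [hm, if_true, integral_zero] using hn
          · simp only [hm, if_false]; exact E2 hδ h i0 T hφ m hm
      _ = _ := by simp; ring
  have hpt : ∀ p : EE d, DD none φ p ^ 2 + ∑ j, ∑ k, DD (some j) (DD (some k) φ) p ^ 2 ≤
     C1 * Lop i0 a φ p ^ 2 + C2 * Gd i0 (fun j k => DD (some j) (DD (some k) φ) p)
      - C3 * (DD (some i0) (DD (some i0) φ) p * DD none φ p) := by
    intro p
    have hsym : ∀ j k, DD (some j) (DD (some k) φ) p = DD (some k) (DD (some j) φ) p := fun j k => by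
      rw [DD_comm hφ.1]
    have hf := full_le i0 (M := fun j k => DD (some j) (DD (some k) φ) p) hsym
    have hr := rest_le hδ h i0 (p.2 i0) (M := fun j k => DD (some j) (DD (some k) φ) p) hsym
    have hbd := h.inv_bd hδ (p.2 i0) i0
    exact alg1 hδ he0 (mul_inv_cancel₀ hδ.ne') hbd.1 hbd.2 hr hf rfl
  have c1 := CI.mul' (LB.const C1) hL
  have c2 := CI.mul' (LB.const C2) hG
  have c3 := CI.mul' (LB.const C3) hP
  have hm := integral_mono (((hD none).CI.sq.add (CI.sum Finset.univ fun j _ => CI.sum Finset.univ fun k _ => (hD2 (some j) (some k)).CI.sq)).int' T)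
    (((c1.add c2).sub c3).int' T) hpt
  rw [integral_sub ((c1.add c2).int' T) (c3.int' T), integral_add (c1.int' T) (c2.int' T), integral_const_mul,
    integral_const_mul, integral_const_mul] at hm
  have := E3 i0 T hφ
  have h5 := mul_le_mul_of_nonneg_left hGle h2p.le
  have h6 := mul_nonneg h3p.le this
  refine hm.trans ?_
  rw [add_mul C1, mul_assoc C2]
  linarith only [h5, h6]

/-- smallness below the support: whole space version. -/
theorem HS_full {F : EE d → ℝ} (hF : CI F) : ∃ T0 : ℝ, ∀ T ≤ T0, ∫ p in HS d T, F p = ∫ p, F p := by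
  obtain ⟨R, hR⟩ := hF.2
  refine ⟨-R-1, fun T hT => setIntegral_eq_integral_of_forall_compl_eq_zero fun p hp => hR p ?_⟩
  simp only [HS, Set.mem_ofPred_eq, not_lt] at hp
  have h1 : |p.1| ≤ ‖p‖ := norm_fst_le p
  have := neg_abs_le p.1
  linarith

theorem apriori_full (d : ℕ) {δ : ℝ} (hδ : 0 < δ) : ∃ C : ℝ, 0 < C ∧
    ∀ (a : ℝ → Fin d → Fin d → ℝ) (_ : Ell δ a) (i0 : Fin d) (φ : EE d → ℝ) (_ : TF φ),
    ∫ p, (DD none φ p ^ 2 + ∑ j, ∑ k, DD (some j) (DD (some k) φ) p ^ 2) ≤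
      C * ∫ p, Lop i0 a φ p ^ 2 := by
  obtain ⟨C, hC, hh⟩ := apriori d hδ
  refine ⟨C, hC, fun a h i0 φ hφ => ?_⟩
  have hD : ∀ i, TF (DD i φ) := fun i => hφ.DD i
  have hD2 : ∀ i j, TF (DD i (DD j φ)) := fun i j => (hD j).DD i
  obtain ⟨T1, h1⟩ := HS_full ((hD none).CI.sq.add (CI.sum Finset.univ fun j _ => CI.sum Finset.univ fun k _ => (hD2 (some j) (some k)).CI.sq))
  obtain ⟨T2, h2⟩ := HS_full (Lop_CI hδ h i0 hφ).sq
  have := hh a h i0 (min T1 T2) φ hφ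
  rwa [h1 _ (min_le_left _ _), h2 _ (min_le_right _ _)] at this

end Apriori
end P4

section P5
section Local
open MeasureTheory

variable {d : ℕ}

theorem Qc_bdd (ρ : ℝ) : Bornology.IsBounded (Qc d ρ) := by
  refine (Metric.isBounded_closedBall (x := (0 : EE d)) (r := ρ ^ 2 + |ρ|)).subset ?_
  rintro p ⟨⟨h1, h2⟩, h3⟩
  simp only [ballE, Set.mem_ofPred_eq] at h3
  have hn : 0 ≤ |ρ| := abs_nonneg _
  simp only [Metric.mem_closedBall, dist_zero_right, Prod.norm_def, sup_le_iff]
  constructor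
  · rw [Real.norm_eq_abs, abs_of_pos h1]; linarith
  · rw [pi_norm_le_iff_of_nonneg (by positivity)]
    intro j
    have : p.2 j ^ 2 ≤ ∑ j, p.2 j ^ 2 := Finset.single_le_sum (f := fun j => p.2 j ^ 2) (fun j _ => sq_nonneg _) (Finset.mem_univ j)
    have h4 : |p.2 j| ≤ |ρ| := sq_le_sq.1 (by linarith)
    rw [Real.norm_eq_abs]; nlinarith [sq_nonneg ρ]

theorem ballE_open (ρ : ℝ) : IsOpen (ballE d ρ) := by
  unfold ballE
  exact isOpen_lt (by fun_prop) continuous_const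

theorem Qc_open (ρ : ℝ) : IsOpen (Qc d ρ) := isOpen_Ioo.prod (ballE_open ρ)

theorem Qc_meas (ρ : ℝ) : MeasurableSet (Qc d ρ) := (Qc_open ρ).measurableSet

theorem LB.iq {F : EE d → ℝ} (hF : LB F) (ρ : ℝ) : Integrable F (volume.restrict (Qc d ρ)) :=
  hF.integrableOn (Qc_bdd ρ)

theorem Qc_mono {ρ' ρ : ℝ} (h0 : 0 < ρ') (h : ρ' ≤ ρ) : Qc d ρ' ⊆ Qc d ρ := by
  have : ρ' ^ 2 ≤ ρ ^ 2 := by gcongr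
  rintro p ⟨⟨h1, h2⟩, h3⟩
  simp only [ballE, Set.mem_ofPred_eq] at h3
  exact ⟨⟨h1, by linarith⟩, by simp only [ballE, Set.mem_ofPred_eq]; linarith⟩

theorem int_Qc_mono {F : EE d → ℝ} (hF : LB F) (h0 : ∀ p, 0 ≤ F p) {ρ' ρ : ℝ} (hp : 0 < ρ') (h : ρ' ≤ ρ) :
    ∫ p in Qc d ρ', F p ≤ ∫ p in Qc d ρ, F p :=
  setIntegral_mono_set (hF.iq ρ) (Filter.Eventually.of_forall h0) (Qc_mono hp h).eventuallyLE

structure Cut (ρ' ρ : ℝ) (η : EE d → ℝ) : Prop where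
  tf : TF η
  nn : ∀ p, 0 ≤ η p
  le1 : ∀ p, η p ≤ 1
  one : ∀ p : EE d, -1 ≤ p.1 → p.1 ≤ ρ' ^ 2 → ∑ j, p.2 j ^ 2 ≤ ρ' ^ 2 → η p = 1
  supp : ∀ p ∈ tsupport η, p.1 < ρ ^ 2 ∧ p.2 ∈ ballE d ρ

theorem cut_exists (d : ℕ) {ρ' ρ : ℝ} (h0 : 0 < ρ') (h : ρ' < ρ) : ∃ η : EE d → ℝ, Cut ρ' ρ η := by
  obtain ⟨σ, hσ1, hσ2⟩ := exists_between h
  have hσp : 0 < σ := h0.trans hσ1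
  have hA : 0 < σ ^ 2 - ρ' ^ 2 := by nlinarith
  have hAA : σ ^ 2 < ρ ^ 2 := by nlinarith
  let s : ℝ → ℝ := fun y => Real.smoothTransition ((σ ^ 2 - y) / (σ ^ 2 - ρ' ^ 2))
  have s0 : ∀ y, σ ^ 2 ≤ y → s y = 0 := fun y hy =>
    Real.smoothTransition.zero_of_nonpos (div_nonpos_of_nonpos_of_nonneg (by linarith) hA.le)
  have s1 : ∀ y, y ≤ ρ' ^ 2 → s y = 1 := fun y hy =>
    Real.smoothTransition.one_of_one_le (by rw [le_div_iff₀ hA]; linarith)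
  have hsm : ContDiff ℝ (⊤ : ℕ∞) s := by
    refine Real.smoothTransition.contDiff.comp ?_
    fun_prop
  have sn : ∀ y, 0 ≤ s y := fun y => Real.smoothTransition.nonneg _
  have sl : ∀ y, s y ≤ 1 := fun y => Real.smoothTransition.le_one _
  let η : EE d → ℝ := fun p => s p.1 * s (∑ j, p.2 j ^ 2) * Real.smoothTransition (p.1 + 2)
  have hsub : tsupport η ⊆ {p : EE d | -2 ≤ p.1 ∧ p.1 ≤ σ ^ 2 ∧ ∑ j, p.2 j ^ 2 ≤ σ ^ 2} := by
    refine closure_minimal ?_ ?_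
    · intro p hp
      refine ⟨?_, ?_, ?_⟩
      · by_contra hc
        exact hp (by simp [η, Real.smoothTransition.zero_of_nonpos (by linarith : p.1 + 2 ≤ 0)])
      · by_contra hc
        exact hp (by simp [η, s0 p.1 (by linarith)])
      · by_contra hc
        exact hp (by simp [η, s0 (∑ j, p.2 j ^ 2) (by linarith)])
    · refine IsClosed.inter (isClosed_le continuous_const continuous_fst) (IsClosed.inter (isClosed_le continuous_fst continuous_const) (isClosed_le (f := fun p : EE d => ∑ j, p.2 j ^ 2) (by fun_prop) continuous_const))
  have hcs : HasCompactSupport η := by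
    refine HasCompactSupport.of_support_subset_isCompact (isCompact_closedBall (0 : EE d) (2 + σ^2 + σ)) ?_
    intro p hp
    obtain ⟨h1, h2, h3⟩ := hsub (subset_tsupport _ hp)
    simp only [Metric.mem_closedBall, dist_zero_right, Prod.norm_def, sup_le_iff]
    constructor
    · rw [Real.norm_eq_abs, abs_le]; constructor <;> nlinarith
    · rw [pi_norm_le_iff_of_nonneg (by positivity)]
      intro j
      have : p.2 j ^ 2 ≤ ∑ j, p.2 j ^ 2 := Finset.single_le_sum (f := fun j => p.2 j ^ 2) (fun j _ => sq_nonneg _) (Finset.mem_univ j)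
      have h4 : |p.2 j| ≤ σ := abs_le_of_sq_le_sq (by linarith) hσp.le
      rw [Real.norm_eq_abs]; nlinarith [sq_nonneg σ]
  refine ⟨η, ⟨?_, hcs⟩, ?_, ?_, ?_, ?_⟩
  · refine ContDiff.mul (ContDiff.mul (hsm.comp contDiff_fst) (hsm.comp ?_)) (Real.smoothTransition.contDiff.comp ?_)
    · fun_prop
    · fun_prop
  · intro p
    exact mul_nonneg (mul_nonneg (sn _) (sn _)) (Real.smoothTransition.nonneg _)
  · intro p
    exact mul_le_one₀ (mul_le_one₀ (sl _) (sn _) (sl _)) (Real.smoothTransition.nonneg _) (Real.smoothTransition.le_one _)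
  · intro p h1 h2 h3
    simp [η, s1 _ h2, s1 _ h3, Real.smoothTransition.one_of_one_le (by linarith : 1 ≤ p.1 + 2)]
  · intro p hp
    obtain ⟨h1, h2, h3⟩ := hsub hp
    refine ⟨by linarith, ?_⟩
    simp only [ballE, Set.mem_ofPred_eq]; linarith

theorem Cut.int {ρ' ρ : ℝ} {η : EE d → ℝ} (h : Cut ρ' ρ η) {F : EE d → ℝ} (hF : ∀ p, p ∉ tsupport η → F p = 0) :
    ∫ p in HS d 0, F p = ∫ p in Qc d ρ, F p := by
  rw [← integral_indicator (HS_meas 0), ← integral_indicator (Qc_meas ρ)]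
  congr 1
  funext p
  by_cases hp : p ∈ tsupport η
  · have := h.supp p hp
    by_cases h1 : p ∈ HS d 0
    · have h2 : p ∈ Qc d ρ := ⟨⟨h1, this.1⟩, this.2⟩
      simp [h1, h2]
    · have h2 : p ∉ Qc d ρ := fun h2 => h1 h2.1.1
      simp [h1, h2]
  · simp [Set.indicator, hF p hp]

theorem DD_off {η : EE d → ℝ} {p : EE d} (hp : p ∉ tsupport η) (i : Option (Fin d)) :
    p ∉ tsupport (DD i η) := by
  intro h
  exact hp (tsupport_fderiv_apply_subset ℝ (ev i) h)

theorem tsupp_mul {η H : EE d → ℝ} {p : EE d} (hp : p ∉ tsupport η) : p ∉ tsupport (fun q => η q * H q) := by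
  intro h
  exact hp (tsupport_mul_subset_left h)

theorem off_zero {η : EE d → ℝ} {p : EE d} (hp : p ∉ tsupport η) : η p = 0 :=
  image_eq_zero_of_notMem_tsupport hp

theorem Lop_off {a : ℝ → Fin d → Fin d → ℝ} {i0 : Fin d} {η : EE d → ℝ} {p : EE d} (hp : p ∉ tsupport η) :
    Lop i0 a η p = 0 := by
  simp [Lop, off_zero (DD_off hp _), off_zero (DD_off (DD_off hp _) _)]

theorem Lop_mul {a : ℝ → Fin d → Fin d → ℝ} (hs : ∀ s j k, a s j k = a s k j) (i0 : Fin d) {η H : EE d → ℝ}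
    (hη : Sm η) (hH : Sm H) (p : EE d) : Lop i0 a (fun q => η q * H q) p =
    η p * Lop i0 a H p + H p * Lop i0 a η p + 2 * ∑ j, ∑ k, a (p.2 i0) j k * (DD (some j) η p * DD (some k) H p) := by
  simp only [Lop]
  have e : ∀ j k, DD (some j) (DD (some k) (fun q => η q * H q)) p
      = DD (some j) (DD (some k) η) p * H p + DD (some k) η p * DD (some j) H p
       + (DD (some j) η p * DD (some k) H p + η p * DD (some j) (DD (some k) H) p) := by
    intro j k
    rw [DD_mul hη hH, DD_add ((hη.DD _).mul hH) (hη.mul (hH.DD _)), DD_mul (hη.DD _) hH, DD_mul hη (hH.DD _)]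
  have e2 : ∑ j, ∑ k, a (p.2 i0) j k * (DD (some k) η p * DD (some j) H p) =
      ∑ j, ∑ k, a (p.2 i0) j k * (DD (some j) η p * DD (some k) H p) := by
    rw [Finset.sum_comm]
    refine Finset.sum_congr rfl fun j _ => Finset.sum_congr rfl fun k _ => ?_
    rw [hs]
  simp only [e]
  rw [DD_mul hη hH, two_mul]
  nth_rw 2 [← e2]
  simp only [mul_add, Finset.mul_sum, Finset.sum_add_distrib]
  have e3 : ∀ (x y : ℝ) j k, x * (a (p.2 i0) j k * y) = a (p.2 i0) j k * (x * y) := by intros; ring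
  simp only [e3]
  have e4 : ∀ j k, DD (some j) (DD (some k) η) p * H p = H p * DD (some j) (DD (some k) η) p := by intros; ring
  simp only [e4]
  ring

theorem bd_sum {δ : ℝ} (hδ : 0 < δ) {a : ℝ → Fin d → Fin d → ℝ} (h : Ell δ a) (s : ℝ) {x : Fin d → Fin d → ℝ} {A : ℝ}
    (hx : ∀ j k, |x j k| ≤ A) : |∑ j, ∑ k, a s j k * x j k| ≤ d ^ 2 * δ⁻¹ * A := by
  have : ∀ j k, |a s j k * x j k| ≤ δ⁻¹ * A := by
    intro j k
    rw [abs_mul]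
    exact mul_le_mul (h.abs_le hδ s j k) (hx j k) (abs_nonneg _) (by positivity)
  calc |∑ j, ∑ k, a s j k * x j k| ≤ ∑ j, |∑ k, a s j k * x j k| := Finset.abs_sum_le_sum_abs _ _
    _ ≤ ∑ j : Fin d, ∑ k : Fin d, |a s j k * x j k| := Finset.sum_le_sum fun j _ => Finset.abs_sum_le_sum_abs _ _
    _ ≤ ∑ j : Fin d, ∑ k : Fin d, δ⁻¹ * A := Finset.sum_le_sum fun j _ => Finset.sum_le_sum fun k _ => this j k
    _ = _ := by simp; ring

theorem bd_sq {δ : ℝ} (hδ : 0 < δ) {a : ℝ → Fin d → Fin d → ℝ} (h : Ell δ a) (s : ℝ) {x y : Fin d → ℝ} {A : ℝ}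
    (hx : ∀ j, |x j| ≤ A) : (∑ j, ∑ k, a s j k * (x j * y k)) ^ 2 ≤ d ^ 3 * (δ⁻¹) ^ 2 * A ^ 2 * ∑ k, y k ^ 2 := by
  refine (sq_sum_sum_le _).trans ?_
  have : ∀ j k, (a s j k * (x j * y k)) ^ 2 ≤ (δ⁻¹) ^ 2 * A ^ 2 * y k ^ 2 := by
    intro j k
    rw [mul_pow, mul_pow, ← mul_assoc]
    have h1 : a s j k ^ 2 ≤ (δ⁻¹) ^ 2 := sq_le_sq' (by linarith [neg_abs_le (a s j k), h.abs_le hδ s j k]) ((le_abs_self _).trans (h.abs_le hδ s j k))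
    have h2 : x j ^ 2 ≤ A ^ 2 := sq_le_sq' (by linarith [neg_abs_le (x j), hx j]) ((le_abs_self _).trans (hx j))
    gcongr
  calc (d:ℝ)^2 * ∑ j, ∑ k, (a s j k * (x j * y k)) ^ 2 ≤ (d:ℝ)^2 * ∑ j : Fin d, ∑ k, (δ⁻¹) ^ 2 * A ^ 2 * y k ^ 2 := by
        gcongr with j _ k _; exact this j k
    _ = _ := by simp [← Finset.mul_sum]; ring

theorem TF.bd {F : EE d → ℝ} (h : TF F) : ∃ A, ∀ p, |F p| ≤ A := by
  obtain ⟨C, hC⟩ := h.1.cont.bounded_above_of_compact_support h.2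
  exact ⟨C, fun p => by simpa using hC p⟩

/-- uniform bounds of all derivatives up to order two -/
theorem tf_bd2 {F : EE d → ℝ} (h : TF F) : ∃ A, 0 < A ∧ (∀ p, |F p| ≤ A) ∧ (∀ i p, |DD i F p| ≤ A) ∧
    ∀ i j p, |DD i (DD j F) p| ≤ A := by
  obtain ⟨A0, h0⟩ := h.bd
  choose A1 h1 using fun i => (h.DD i).bd
  choose A2 h2 using fun i j => ((h.DD j).DD i).bd
  have p0 : 0 ≤ A0 := (abs_nonneg _).trans (h0 0)
  have p1 : ∀ i, 0 ≤ A1 i := fun i => (abs_nonneg _).trans (h1 i 0)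
  have p2 : ∀ i j, 0 ≤ A2 i j := fun i j => (abs_nonneg _).trans (h2 i j 0)
  have q1 : 0 ≤ ∑ i, A1 i := Finset.sum_nonneg fun i _ => p1 i
  have q2 : 0 ≤ ∑ i, ∑ j, A2 i j := Finset.sum_nonneg fun i _ => Finset.sum_nonneg fun j _ => p2 i j
  refine ⟨A0 + ∑ i, A1 i + ∑ i, ∑ j, A2 i j + 1, by positivity, ?_, ?_, ?_⟩
  · intro p; linarith [h0 p]
  · intro i p
    have := Finset.single_le_sum (f := A1) (fun i _ => p1 i) (Finset.mem_univ i)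
    linarith [h1 i p]
  · intro i j p
    have t1 := Finset.single_le_sum (f := fun j => A2 i j) (fun j _ => p2 i j) (Finset.mem_univ j)
    have t2 := Finset.single_le_sum (f := fun i => ∑ j, A2 i j) (fun i _ => Finset.sum_nonneg fun j _ => p2 i j) (Finset.mem_univ i)
    linarith [h2 i j p]

end Local
end P5

section P6
section Local2
open MeasureTheory

variable {d : ℕ}

theorem alg2 {e B η l H Lη Z S A1 A2 M F ε : ℝ} (hB0 : 0 ≤ B) (hBe : B ≤ e) (hη0 : 0 ≤ η) (hη1 : η ≤ 1)
    (h1 : |Lη| ≤ A1) (h2 : |Z| ≤ A2) (hS : S ^ 2 ≤ M * F) (hε : 0 < ε) :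
    -(B * (η^2 * (H * l) + η * H^2 * Lη + 2 * (H * S) - 2 * H^2 * Z)) ≤
      ε * M * F + (e/2 + e*A1 + 2*e*A2 + e^2 * ε⁻¹) * (H^2 + l^2) := by
  have he : 0 ≤ e := hB0.trans hBe
  have hA1 : 0 ≤ A1 := (abs_nonneg _).trans h1
  have hA2 : 0 ≤ A2 := (abs_nonneg _).trans h2
  have i1 : -(B * η^2 * (H * l)) ≤ e/2 * (H^2+l^2) := by
    have : B * η^2 ≤ e * 1 := mul_le_mul hBe (pow_le_one₀ hη0 hη1) (by positivity) he
    have h3 : -(H*l) ≤ (H^2+l^2)/2 := by nlinarith [sq_nonneg (H+l)]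
    calc -(B * η^2 * (H * l)) = (B*η^2) * (-(H*l)) := by ring
      _ ≤ (B*η^2) * ((H^2+l^2)/2) := by gcongr
      _ ≤ (e*1) * ((H^2+l^2)/2) := by gcongr
      _ = _ := by ring
  have i2 : -(B * η * H^2 * Lη) ≤ e * A1 * H^2 := by
    have : B * η ≤ e * 1 := mul_le_mul hBe hη1 (by positivity) he
    have h3 : -Lη ≤ A1 := (neg_le_abs _).trans h1
    calc -(B * η * H^2 * Lη) = (B*η*H^2) * (-Lη) := by ring
      _ ≤ (B*η*H^2) * A1 := by gcongr
      _ ≤ (e*1*H^2) * A1 := by gcongr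
      _ = _ := by ring
  have i3 : 2 * B * H^2 * Z ≤ 2 * e * A2 * H^2 := by
    have h3 : Z ≤ A2 := (le_abs_self _).trans h2
    calc 2 * B * H^2 * Z ≤ 2 * B * H^2 * A2 := by gcongr
      _ ≤ 2 * e * H^2 * A2 := by gcongr
      _ = _ := by ring
  have i4 : -(2 * B * (H * S)) ≤ ε * S^2 + e^2 * ε⁻¹ * H^2 := by
    have q : 0 ≤ ε * (S + ε⁻¹ * (B * H))^2 := by positivity
    have hh : ε * ε⁻¹ = 1 := mul_inv_cancel₀ hε.ne'
    have e1 : ε * (S + ε⁻¹ * (B * H))^2 = ε * S^2 + 2 * (ε*ε⁻¹) * (B * (H * S)) + (ε * ε⁻¹) * ε⁻¹ * (B*H)^2 := by ring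
    rw [e1, hh] at q
    have : (B*H)^2 ≤ e^2*H^2 := by rw [mul_pow]; gcongr
    have h5 : ε⁻¹ * (B*H)^2 ≤ ε⁻¹ * (e^2*H^2) := by gcongr
    linarith
  have i5 : ε * S^2 ≤ ε * (M * F) := by gcongr
  have n1 : 0 ≤ (e*A1 + 2*e*A2 + e^2 * ε⁻¹) * l^2 := by positivity
  linarith

theorem on_one {ρ' ρ : ℝ} {η : EE d → ℝ} (h : Cut ρ' ρ η) (H : EE d → ℝ) {p : EE d} (hp : p ∈ Qc d ρ') :
    (fun q => η q * H q) =ᶠ[nhds p] H := by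
  filter_upwards [(Qc_open ρ').mem_nhds hp] with q hq
  have : η q = 1 := h.one q (by linarith [hq.1.1]) hq.1.2.le (le_of_lt hq.2)
  simp [this]

theorem cacc (d : ℕ) {δ : ℝ} (hδ : 0 < δ) {ρ' ρ : ℝ} (h0 : 0 < ρ') (hρ : ρ' < ρ) : ∃ C : ℝ, 0 < C ∧
    ∀ (a : ℝ → Fin d → Fin d → ℝ) (_ : Ell δ a) (i0 : Fin d) (H : EE d → ℝ) (_ : Sm H),
    ∫ p in Qc d ρ', ∑ j, DD (some j) H p ^ 2 ≤ C * ∫ p in Qc d ρ, (H p ^ 2 + Lop i0 a H p ^ 2) := by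
  obtain ⟨η, hη⟩ := cut_exists d h0 hρ
  obtain ⟨A, hA, b0, b1, b2⟩ := tf_bd2 hη.tf
  set e := δ⁻¹ with he
  have he0 : 0 < e := inv_pos.2 hδ
  set M : ℝ := d ^ 3 * e ^ 2 * A ^ 2 + 1 with hM
  have hMp : 0 < M := by positivity
  set ε : ℝ := δ ^ 2 / 2 / M with hεd
  have hε : 0 < ε := by positivity
  set A1 : ℝ := A + d ^ 2 * e * A with hA1
  set A2 : ℝ := d ^ 2 * e * (A * A) with hA2
  set C0 := (e/2 + e*A1 + 2*e*A2 + e^2 * ε⁻¹) with hC0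
  have hC0p : 0 < C0 := by positivity
  refine ⟨2 * e ^ 2 * C0, by positivity, fun a h i0 H hH => ?_⟩
  set φ : EE d → ℝ := fun q => η q * H q with hφd
  have hφ : TF φ := hη.tf.mul hH
  have hen := energy1 hδ h i0 0 hφ
  have hoff : ∀ p, p ∉ tsupport η → p ∉ tsupport φ := fun p hp => tsupp_mul hp
  rw [hη.int (by
    intro p hp
    simp [off_zero (hoff p hp), off_zero (DD_off (hoff p hp) _)])] at hen
  have cS : LB (fun p => ∑ j, DD (some j) φ p ^ 2) := LB.sum _ fun j _ => (hφ.DD _).1.LB.sq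
  have cL := Lop_LB hδ h i0 hH
  have cLφ := Lop_LB hδ h i0 hφ.1
  have c1 : LB (fun p => (a (p.2 i0) i0 i0)⁻¹ * (Lop i0 a φ p * φ p)) :=
    ((h.BW_inv hδ i0).LB i0).mul (cLφ.mul hφ.1.LB)
  have c2 : LB (fun p => H p ^ 2 + Lop i0 a H p ^ 2) := hH.LB.sq.add cL.sq
  rw [integral_add (((LB.const (δ^2)).mul cS).iq ρ) (c1.iq ρ), integral_const_mul] at hen
  have hpt : ∀ p, -((a (p.2 i0) i0 i0)⁻¹ * (Lop i0 a φ p * φ p)) ≤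
      δ ^ 2 / 2 * (∑ j, DD (some j) φ p ^ 2) + C0 * (H p ^ 2 + Lop i0 a H p ^ 2) := by
    intro p
    have hbd := h.inv_bd hδ (p.2 i0) i0
    have hZ : |∑ j, ∑ k, a (p.2 i0) j k * (DD (some j) η p * DD (some k) η p)| ≤ A2 := by
      refine bd_sum hδ h (p.2 i0) fun j k => ?_
      rw [abs_mul]; exact mul_le_mul (b1 _ _) (b1 _ _) (abs_nonneg _) hA.le
    have hLη : |Lop i0 a η p| ≤ A1 := by
      refine (abs_add_le _ _).trans (add_le_add (b1 _ _) ?_)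
      exact bd_sum hδ h (p.2 i0) fun j k => b2 _ _ _
    have hS : (∑ j, ∑ k, a (p.2 i0) j k * (DD (some j) η p * DD (some k) φ p))^2 ≤ M * ∑ j, DD (some j) φ p ^ 2 := by
      refine (bd_sq hδ h (p.2 i0) (fun j => b1 (some j) p)).trans ?_
      have : 0 ≤ ∑ j, DD (some j) φ p ^ 2 := Finset.sum_nonneg fun j _ => sq_nonneg _
      gcongr
      rw [hM]; linarith
    have key := alg2 (l := Lop i0 a H p) (H := H p) (hδ.le.trans hbd.1) hbd.2 (hη.nn p) (hη.le1 p) hLη hZ hS hε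
    have hεM : ε * M = δ ^ 2 / 2 := by rw [hεd]; field_simp
    rw [hεM] at key
    refine le_trans (le_of_eq ?_) key
    rw [hφd, Lop_mul h.symm i0 hη.tf.1 hH p]
    have e1 : ∀ k, DD (some k) (fun q => η q * H q) p = DD (some k) η p * H p + η p * DD (some k) H p := by
      intro k; rw [DD_mul hη.tf.1 hH]
    simp only [e1]
    have e2 : ∑ j, ∑ k, a (p.2 i0) j k * (DD (some j) η p * (DD (some k) η p * H p + η p * DD (some k) H p))
       = H p * (∑ j, ∑ k, a (p.2 i0) j k * (DD (some j) η p * DD (some k) η p)) +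
         η p * ∑ j, ∑ k, a (p.2 i0) j k * (DD (some j) η p * DD (some k) H p) := by
      simp only [Finset.mul_sum]
      simp only [← Finset.sum_add_distrib]
      refine Finset.sum_congr rfl fun j _ => Finset.sum_congr rfl fun k _ => ?_
      ring
    rw [e2]; ring
  have hm := integral_mono (c1.neg.iq ρ) ((((LB.const (δ^2/2)).mul cS).add ((LB.const C0).mul c2)).iq ρ) hpt
  rw [integral_neg, integral_add (((LB.const (δ^2/2)).mul cS).iq ρ) (((LB.const C0).mul c2).iq ρ), integral_const_mul,
    integral_const_mul] at hm
  have hmono : ∫ p in Qc d ρ', ∑ j, DD (some j) H p ^ 2 ≤ ∫ p in Qc d ρ, ∑ j, DD (some j) φ p ^ 2 := by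
    refine le_trans (le_of_eq ?_) (int_Qc_mono cS (fun p => Finset.sum_nonneg fun j _ => sq_nonneg _) h0 hρ.le)
    refine setIntegral_congr_fun (Qc_meas ρ') fun p hp => ?_
    refine Finset.sum_congr rfl fun j _ => ?_
    rw [(DD_congr (on_one hη H hp) (some j)).eq_of_nhds]
  set I1 := ∫ p in Qc d ρ, ∑ j, DD (some j) φ p ^ 2
  set I2 := ∫ p in Qc d ρ, (H p ^ 2 + Lop i0 a H p ^ 2)
  refine hmono.trans ?_
  have h7 : δ^2/2 * I1 ≤ C0 * I2 := by linarith
  have hdd : δ^2 * e^2 = 1 := by rw [← mul_pow, mul_inv_cancel₀ hδ.ne', one_pow]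
  calc I1 = 2 * e^2 * (δ^2/2 * I1) := by linear_combination (-I1) * hdd
    _ ≤ 2 * e^2 * (C0 * I2) := by gcongr
    _ = _ := by ring

theorem LocI (d : ℕ) {δ : ℝ} (hδ : 0 < δ) {ρ' ρ : ℝ} (h0 : 0 < ρ') (hρ : ρ' < ρ) : ∃ C : ℝ, 0 < C ∧
    ∀ (a : ℝ → Fin d → Fin d → ℝ) (_ : Ell δ a) (i0 : Fin d) (H : EE d → ℝ) (_ : Sm H),
    ∫ p in Qc d ρ', (DD none H p ^ 2 + (∑ j, DD (some j) H p ^ 2) + ∑ j, ∑ k, DD (some j) (DD (some k) H) p ^ 2)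
      ≤ C * ∫ p in Qc d ρ, (H p ^ 2 + Lop i0 a H p ^ 2) := by
  obtain ⟨σ, hσ1, hσ2⟩ := exists_between hρ
  have hσ0 := h0.trans hσ1
  obtain ⟨η, hη⟩ := cut_exists d h0 hσ1
  obtain ⟨A, hA, b0, b1, b2⟩ := tf_bd2 hη.tf
  obtain ⟨C1, hC1, hc⟩ := cacc d hδ hσ0 hσ2
  obtain ⟨C2, hC2, hap⟩ := apriori d hδ
  set e := δ⁻¹ with he
  have he0 : 0 < e := inv_pos.2 hδ
  set M : ℝ := d ^ 3 * e ^ 2 * A ^ 2 with hM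
  have hMp : 0 ≤ M := by positivity
  set A1 : ℝ := A + d ^ 2 * e * A with hA1
  have hA1p : 0 < A1 := by positivity
  set K : ℝ := 3 * (1 + A1^2) with hK
  refine ⟨C2 * (K + 12 * M * C1) + C1, by positivity, fun a h i0 H hH => ?_⟩
  set φ : EE d → ℝ := fun q => η q * H q with hφd
  have hφ : TF φ := hη.tf.mul hH
  have hoff : ∀ p, p ∉ tsupport η → p ∉ tsupport φ := fun p hp => tsupp_mul hp
  have h1 := hap a h i0 0 φ hφ
  rw [hη.int (by
    intro p hp
    simp [off_zero (DD_off (DD_off (hoff p hp) _) _), off_zero (DD_off (hoff p hp) _)]),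
    hη.int (by
    intro p hp
    simp [Lop_off (hoff p hp)])] at h1
  have cL := Lop_LB hδ h i0 hH
  have cLφ := Lop_LB hδ h i0 hφ.1
  have c2 : LB (fun p => H p ^ 2 + Lop i0 a H p ^ 2) := hH.LB.sq.add cL.sq
  have cG : LB (fun p => ∑ j, DD (some j) H p ^ 2) := LB.sum _ fun j _ => (hH.DD _).LB.sq
  have hpt : ∀ p, Lop i0 a φ p ^ 2 ≤ K * (H p ^ 2 + Lop i0 a H p ^ 2) + 12 * M * ∑ j, DD (some j) H p ^ 2 := by
    intro p
    have hLη : |Lop i0 a η p| ≤ A1 := by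
      refine (abs_add_le _ _).trans (add_le_add (b1 _ _) ?_)
      exact bd_sum hδ h (p.2 i0) fun j k => b2 _ _ _
    have hS : (∑ j, ∑ k, a (p.2 i0) j k * (DD (some j) η p * DD (some k) H p))^2 ≤ M * ∑ j, DD (some j) H p ^ 2 :=
      bd_sq hδ h (p.2 i0) (fun j => b1 (some j) p)
    rw [hφd, Lop_mul h.symm i0 hη.tf.1 hH p]
    set S := (∑ j, ∑ k, a (p.2 i0) j k * (DD (some j) η p * DD (some k) H p))
    set l := Lop i0 a H p
    set m := Lop i0 a η p
    have q1 : (η p * l)^2 ≤ l^2 := by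
      rw [mul_pow]
      have := pow_le_one₀ (n := 2) (hη.nn p) (hη.le1 p)
      nlinarith [sq_nonneg l]
    have q2 : (H p * m)^2 ≤ A1^2 * H p^2 := by
      have : m^2 ≤ A1^2 := by rw [← sq_abs]; gcongr
      rw [mul_pow]; nlinarith [sq_nonneg (H p)]
    have q3 : (η p * l + H p * m + 2 * S)^2 ≤ 3 * ((η p * l)^2 + (H p * m)^2 + (2*S)^2) := by
      nlinarith [sq_nonneg (η p * l - H p * m), sq_nonneg (η p * l - 2*S), sq_nonneg (H p * m - 2*S)]
    have q4 : 0 ≤ A1^2 * l^2 := by positivity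
    have q5 := sq_nonneg (H p)
    rw [hK]
    linarith
  have hm := integral_mono (cLφ.sq.iq σ) ((((LB.const K).mul c2).add ((LB.const (12*M)).mul cG)).iq σ) hpt
  rw [integral_add (((LB.const K).mul c2).iq σ) (((LB.const (12*M)).mul cG).iq σ), integral_const_mul, integral_const_mul] at hm
  have hcc := hc a h i0 H hH
  have hmon := int_Qc_mono c2 (fun p => by positivity) hσ0 hσ2.le
  have cF : LB (fun p => DD none φ p ^ 2 + ∑ j, ∑ k, DD (some j) (DD (some k) φ) p ^ 2) :=
    (hφ.DD _).1.LB.sq.add (LB.sum _ fun j _ => LB.sum _ fun k _ => ((hφ.DD _).DD _).1.LB.sq)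
  have cF' : LB (fun p => DD none H p ^ 2 + ∑ j, ∑ k, DD (some j) (DD (some k) H) p ^ 2) :=
    (hH.DD _).LB.sq.add (LB.sum _ fun j _ => LB.sum _ fun k _ => ((hH.DD _).DD _).LB.sq)
  have h2 : ∫ p in Qc d ρ', (DD none H p ^ 2 + ∑ j, ∑ k, DD (some j) (DD (some k) H) p ^ 2) ≤
      ∫ p in Qc d σ, (DD none φ p ^ 2 + ∑ j, ∑ k, DD (some j) (DD (some k) φ) p ^ 2) := by
    refine le_trans (le_of_eq ?_) (int_Qc_mono cF (fun p => ?_) h0 hσ1.le)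
    · refine setIntegral_congr_fun (Qc_meas ρ') fun p hp => ?_
      have hq := on_one hη H hp
      congr 1
      · rw [(DD_congr hq none).eq_of_nhds]
      · refine Finset.sum_congr rfl fun j _ => Finset.sum_congr rfl fun k _ => ?_
        rw [(DD_congr (DD_congr hq (some k)) (some j)).eq_of_nhds]
    · exact add_nonneg (sq_nonneg _) (Finset.sum_nonneg fun j _ => Finset.sum_nonneg fun k _ => sq_nonneg _)
  have h3 : ∫ p in Qc d ρ', ∑ j, DD (some j) H p ^ 2 ≤ ∫ p in Qc d σ, ∑ j, DD (some j) H p ^ 2 :=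
    int_Qc_mono cG (fun p => Finset.sum_nonneg fun j _ => sq_nonneg _) h0 hσ1.le
  have e1 : ∫ p in Qc d ρ', (DD none H p ^ 2 + (∑ j, DD (some j) H p ^ 2) + ∑ j, ∑ k, DD (some j) (DD (some k) H) p ^ 2)
    = (∫ p in Qc d ρ', (DD none H p ^ 2 + ∑ j, ∑ k, DD (some j) (DD (some k) H) p ^ 2)) + ∫ p in Qc d ρ', ∑ j, DD (some j) H p ^ 2 := by
    rw [← integral_add (cF'.iq ρ') (cG.iq ρ')]
    congr 1; funext p; ring
  rw [e1]
  set J := ∫ p in Qc d ρ, (H p ^ 2 + Lop i0 a H p ^ 2)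
  have g1 := mul_le_mul_of_nonneg_left hm hC2.le
  have g2 := mul_le_mul_of_nonneg_left hcc (by positivity : 0 ≤ C2 * (12 * M))
  have g3 := mul_le_mul_of_nonneg_left hmon (by positivity : 0 ≤ C2 * K)
  linarith

end Local2
end P6

section P7
section Iter
open MeasureTheory

variable {d : ℕ}

/-- Iterated partial derivatives along a list of directions. -/
noncomputable def DL : List (Option (Fin d)) → (EE d → ℝ) → (EE d → ℝ)
  | [], u => u
  | i :: l, u => DL l (DD i u)

theorem Sm.DL {u : EE d → ℝ} (h : Sm u) (l : List (Option (Fin d))) : Sm (DL l u) := by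
  induction l generalizing u with
  | nil => exact h
  | cons i l ih => exact ih (h.DD i)

theorem TF.DL {u : EE d → ℝ} (h : TF u) (l : List (Option (Fin d))) : TF (DL l u) := by
  induction l generalizing u with
  | nil => exact h
  | cons i l ih => exact ih (h.DD i)

theorem DL_DD {u : EE d → ℝ} (h : Sm u) (l : List (Option (Fin d))) (i : Option (Fin d)) :
    DL l (DD i u) = DD i (DL l u) := by
  induction l generalizing u with
  | nil => rfl
  | cons j l ih =>
    show DL l (DD j (DD i u)) = DD i (DL l (DD j u))
    rw [DD_comm h, ih (h.DD j)]

theorem DL_cons {u : EE d → ℝ} (h : Sm u) (l : List (Option (Fin d))) (i : Option (Fin d)) :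
    DL (i :: l) u = DD i (DL l u) := DL_DD h l i

theorem DL_perm {l l' : List (Option (Fin d))} (hp : l.Perm l') {u : EE d → ℝ} (h : Sm u) : DL l u = DL l' u := by
  induction hp generalizing u with
  | nil => rfl
  | cons x _ ih => exact ih (h.DD x)
  | swap x y l => show DL l (DD x (DD y u)) = DL l (DD y (DD x u)); rw [DD_comm h]
  | trans _ _ ih1 ih2 => rw [ih1 h, ih2 h]

theorem DL_off {η : EE d → ℝ} {p : EE d} (hp : p ∉ tsupport η) (l : List (Option (Fin d))) :
    p ∉ tsupport (DL l η) := by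
  induction l generalizing η with
  | nil => exact hp
  | cons i l ih => exact ih (DD_off hp i)

theorem DL_add {u v : EE d → ℝ} (h : Sm u) (h2 : Sm v) (l : List (Option (Fin d))) :
    DL l (fun p => u p + v p) = fun p => DL l u p + DL l v p := by
  induction l generalizing u v with
  | nil => rfl
  | cons i l ih =>
    show DL l (DD i (fun p => u p + v p)) = _
    rw [DD_add h h2, ih (h.DD i) (h2.DD i)]; rfl

theorem DL_sub {u v : EE d → ℝ} (h : Sm u) (h2 : Sm v) (l : List (Option (Fin d))) :
    DL l (fun p => u p - v p) = fun p => DL l u p - DL l v p := by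
  induction l generalizing u v with
  | nil => rfl
  | cons i l ih =>
    show DL l (DD i (fun p => u p - v p)) = _
    rw [DD_sub h h2, ih (h.DD i) (h2.DD i)]; rfl

def Good (i0 : Fin d) (l : List (Option (Fin d))) : Prop := ∀ i ∈ l, i ≠ some i0

noncomputable def NN (V : EE d → ℝ) : EE d → ℝ := fun p =>
  V p ^ 2 + (DD none V p ^ 2 + (∑ j, DD (some j) V p ^ 2) + ∑ j, ∑ k, DD (some j) (DD (some k) V) p ^ 2)

theorem NN_LB {V : EE d → ℝ} (h : Sm V) : LB (NN V) :=
  h.LB.sq.add (((h.DD _).LB.sq.add (LB.sum _ fun j _ => (h.DD _).LB.sq)).add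
    (LB.sum _ fun j _ => LB.sum _ fun k _ => ((h.DD _).DD _).LB.sq))

theorem NN_parts (V : EE d → ℝ) (p : EE d) : 0 ≤ NN V p ∧ V p ^ 2 ≤ NN V p ∧ (∀ i, DD i V p ^ 2 ≤ NN V p) ∧
    ∀ j k, DD (some j) (DD (some k) V) p ^ 2 ≤ NN V p := by
  have h1 : 0 ≤ ∑ j, DD (some j) V p ^ 2 := Finset.sum_nonneg fun j _ => sq_nonneg _
  have h2 : 0 ≤ ∑ j, ∑ k, DD (some j) (DD (some k) V) p ^ 2 := Finset.sum_nonneg fun j _ => Finset.sum_nonneg fun k _ => sq_nonneg _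
  have h3 := sq_nonneg (V p)
  have h4 := sq_nonneg (DD none V p)
  unfold NN
  refine ⟨by linarith, by linarith, ?_, ?_⟩
  · intro i
    match i with
    | none => linarith
    | some j =>
      have := Finset.single_le_sum (f := fun j => DD (some j) V p ^ 2) (fun j _ => sq_nonneg _) (Finset.mem_univ j)
      linarith
  · intro j k
    have t1 := Finset.single_le_sum (f := fun k => DD (some j) (DD (some k) V) p ^ 2) (fun j _ => sq_nonneg _) (Finset.mem_univ k)
    have t2 := Finset.single_le_sum (f := fun j => ∑ k, DD (some j) (DD (some k) V) p ^ 2) (fun j _ => Finset.sum_nonneg fun k _ => sq_nonneg _) (Finset.mem_univ j)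
    linarith

theorem NN_loc (d : ℕ) {δ : ℝ} (hδ : 0 < δ) {ρ' ρ : ℝ} (h0 : 0 < ρ') (hρ : ρ' < ρ) : ∃ C : ℝ, 0 < C ∧
    ∀ (a : ℝ → Fin d → Fin d → ℝ) (_ : Ell δ a) (i0 : Fin d) (H : EE d → ℝ) (_ : Sm H),
    ∫ p in Qc d ρ', NN H p ≤ C * ((∫ p in Qc d ρ, H p ^ 2) + ∫ p in Qc d ρ, Lop i0 a H p ^ 2) := by
  obtain ⟨C, hC, hh⟩ := LocI d hδ h0 hρ
  refine ⟨C + 1, by positivity, fun a h i0 H hH => ?_⟩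
  have h1 := hh a h i0 H hH
  have cL := (Lop_LB hδ h i0 hH).sq
  rw [integral_add (hH.LB.sq.iq ρ) (cL.iq ρ)] at h1
  unfold NN
  rw [integral_add (hH.LB.sq.iq ρ') ((((hH.DD _).LB.sq.add (LB.sum _ fun j _ => (hH.DD _).LB.sq)).add
    (LB.sum _ fun j _ => LB.sum _ fun k _ => ((hH.DD _).DD _).LB.sq)).iq ρ')]
  have h2 := int_Qc_mono hH.LB.sq (fun p => sq_nonneg _) h0 hρ.le
  have h3 : 0 ≤ ∫ p in Qc d ρ, Lop i0 a H p ^ 2 := integral_nonneg fun p => sq_nonneg _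
  linarith

theorem iter (d : ℕ) {δ : ℝ} (hδ : 0 < δ) (n : ℕ) : ∀ {ρ' ρ : ℝ} (_ : 0 < ρ') (_ : ρ' < ρ), ∃ C : ℝ, 0 < C ∧
    ∀ (a : ℝ → Fin d → Fin d → ℝ) (_ : Ell δ a) (i0 : Fin d) (H : EE d → ℝ) (_ : Sm H) (E : ℝ),
    (∀ γ, Good i0 γ → γ.length ≤ n → ∫ p in Qc d ρ, Lop i0 a (DL γ H) p ^ 2 ≤ E) →
    ∀ γ, Good i0 γ → γ.length ≤ n → ∫ p in Qc d ρ', NN (DL γ H) p ≤ C * ((∫ p in Qc d ρ, H p ^ 2) + E) := by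
  induction n with
  | zero =>
    intro ρ' ρ h0 hρ
    obtain ⟨C, hC, hh⟩ := NN_loc d hδ h0 hρ
    refine ⟨C, hC, fun a h i0 H hH E hE γ hγ hl => ?_⟩
    have : γ = [] := by simpa using hl
    subst this
    have h1 := hE [] hγ (by simp)
    refine (hh a h i0 H hH).trans ?_
    simp only [DL] at h1
    gcongr
  | succ n ih =>
    intro ρ' ρ h0 hρ
    obtain ⟨σ, hσ1, hσ2⟩ := exists_between hρ
    have hσ0 := h0.trans hσ1
    obtain ⟨C1, hC1, hh1⟩ := ih hσ0 hσ2
    obtain ⟨C, hC, hh⟩ := NN_loc d hδ h0 hσ1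
    refine ⟨C1 + C * (C1 + 1), by positivity, fun a h i0 H hH E hE γ hγ hl => ?_⟩
    have hE0 : 0 ≤ E := (integral_nonneg fun p => sq_nonneg _).trans (hE [] (by simp [Good]) (by simp))
    have hI0 : 0 ≤ ∫ p in Qc d ρ, H p ^ 2 := integral_nonneg fun p => sq_nonneg _
    have hi := hh1 a h i0 H hH E (fun γ hγ hl => hE γ hγ (by omega))
    match γ, hγ, hl with
    | [], hγ, hl =>
      have := hi [] hγ (by simp)
      have h2 := int_Qc_mono (NN_LB (hH.DL [])) (fun p => (NN_parts _ p).1) h0 hσ1.le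
      have : 0 ≤ C * (C1+1) * ((∫ p in Qc d ρ, H p ^ 2) + E) := by positivity
      linarith
    | i :: γ', hγ, hl =>
      have hg' : Good i0 γ' := fun j hj => hγ j (by simp [hj])
      have h1 := hi γ' hg' (by simpa using hl)
      have hS := hH.DL γ'
      have h2 := hh a h i0 (DL (i :: γ') H) (hH.DL _)
      have h3 : ∫ p in Qc d σ, DL (i :: γ') H p ^ 2 ≤ ∫ p in Qc d σ, NN (DL γ' H) p := by
        refine integral_mono ((hH.DL _).LB.sq.iq σ) ((NN_LB hS).iq σ) fun p => ?_
        rw [DL_cons hH]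
        exact (NN_parts _ p).2.2.1 i
      have h4 := hE (i :: γ') hγ hl
      have h5 := int_Qc_mono (Lop_LB hδ h i0 (hH.DL (i :: γ'))).sq (fun p => sq_nonneg _) hσ0 hσ2.le
      refine h2.trans ?_
      set I := ∫ p in Qc d ρ, H p ^ 2
      have h6 : (∫ p in Qc d σ, DL (i :: γ') H p ^ 2) + ∫ p in Qc d σ, Lop i0 a (DL (i :: γ') H) p ^ 2 ≤ (C1 + 1) * (I + E) := by
        linarith
      have h7 := mul_le_mul_of_nonneg_left h6 hC.le
      have h8 : 0 ≤ C1 * (I + E) := by positivity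
      linarith

theorem leib (ρ : ℝ) (l : List (Option (Fin d))) : ∀ (η : EE d → ℝ), TF η → ∃ C : ℝ, 0 ≤ C ∧
    ∀ V, Sm V → ∀ M, (∀ l', l'.Sublist l → ∫ p in Qc d ρ, DL l' V p ^ 2 ≤ M) →
      ∫ p in Qc d ρ, DL l (fun q => η q * V q) p ^ 2 ≤ C * M := by
  induction l with
  | nil =>
    intro η hη
    obtain ⟨A, hA⟩ := hη.bd
    refine ⟨A ^ 2, by positivity, fun V hV M hM => ?_⟩
    have h1 := hM [] (by simp)
    simp only [DL] at h1 ⊢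
    calc ∫ p in Qc d ρ, (η p * V p) ^ 2 ≤ ∫ p in Qc d ρ, A ^ 2 * V p ^ 2 := by
          refine integral_mono ((hη.1.mul hV).LB.sq.iq ρ) (((LB.const _).mul hV.LB.sq).iq ρ) fun p => ?_
          simp only [mul_pow]
          have : η p ^ 2 ≤ A ^ 2 := by rw [← sq_abs]; gcongr; exact hA p
          gcongr
      _ = A ^ 2 * ∫ p in Qc d ρ, V p ^ 2 := integral_const_mul _ _
      _ ≤ _ := by gcongr
  | cons i l ih =>
    intro η hη
    obtain ⟨C1, hC1, h1⟩ := ih η hη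
    obtain ⟨C2, hC2, h2⟩ := ih (DD i η) (hη.DD i)
    refine ⟨2 * C2 + 2 * C1, by positivity, fun V hV M hM => ?_⟩
    have g1 := h1 (DD i V) (hV.DD i) M (fun l' hl' => hM (i :: l') (by simpa using hl'))
    have g2 := h2 V hV M (fun l' hl' => hM l' (hl'.trans (by simp)))
    have s1 : Sm (DL l fun q => η q * DD i V q) := (hη.1.mul (hV.DD i)).DL l
    have s2 : Sm (DL l fun q => DD i η q * V q) := ((hη.DD i).1.mul hV).DL l
    calc ∫ p in Qc d ρ, DL (i :: l) (fun q => η q * V q) p ^ 2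
        ≤ ∫ p in Qc d ρ, (2 * DL l (fun q => DD i η q * V q) p ^ 2 + 2 * DL l (fun q => η q * DD i V q) p ^ 2) := by
          refine integral_mono (((hη.1.mul hV).DL _).LB.sq.iq ρ) ((((LB.const 2).mul s2.LB.sq).add ((LB.const 2).mul s1.LB.sq)).iq ρ) fun p => ?_
          show DL l (DD i (fun q => η q * V q)) p ^ 2 ≤ _
          rw [DD_mul hη.1 hV, DL_add ((hη.DD i).1.mul hV) (hη.1.mul (hV.DD i))]
          simp only
          nlinarith [sq_nonneg (DL l (fun q => DD i η q * V q) p - DL l (fun q => η q * DD i V q) p)]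
      _ = 2 * (∫ p in Qc d ρ, DL l (fun q => DD i η q * V q) p ^ 2) + 2 * ∫ p in Qc d ρ, DL l (fun q => η q * DD i V q) p ^ 2 := by
          rw [integral_add (((LB.const 2).mul s2.LB.sq).iq ρ) (((LB.const 2).mul s1.LB.sq).iq ρ), integral_const_mul, integral_const_mul]
      _ ≤ _ := by linarith

end Iter
end P7

section P8
section Sup
open MeasureTheory

variable {d : ℕ}

theorem line1d {g g' : ℝ → ℝ} (hd : ∀ s, HasDerivAt g (g' s) s) (hc : Continuous g') (R : ℝ)
    (h0 : ∀ s, R < |s| → g s = 0) (h0' : ∀ s, R < |s| → g' s = 0) (b : ℝ) :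
    ‖g b‖ₑ ≤ ∫⁻ s in Set.Ioi b, ‖g' s‖ₑ := by
  have hcs : HasCompactSupport g' := by
    refine HasCompactSupport.intro (isCompact_Icc (a := -R) (b := R)) fun s hs => h0' s ?_
    by_contra hc
    exact hs (abs_le.1 (not_lt.1 hc))
  have h1 := integral_Ioi_of_hasDerivAt_of_tendsto (a := b) (f := g) (f' := g') (m := 0)
    (hd b).continuousAt.continuousWithinAt (fun t _ => hd t)
    (hc.integrable_of_hasCompactSupport hcs).integrableOn
    (by
      refine tendsto_const_nhds.congr' ?_
      filter_upwards [Filter.eventually_gt_atTop R] with s hs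
      rw [h0 s (hs.trans_le (le_abs_self s))])
  have h2 := enorm_integral_le_lintegral_enorm (μ := volume.restrict (Set.Ioi b)) g'
  rw [h1] at h2
  simpa using h2

theorem line_t {φ : EE d → ℝ} (h : TF φ) (t : ℝ) (x : Fin d → ℝ) :
    ‖φ (t, x)‖ₑ ≤ ∫⁻ s in Set.Ioi t, ‖DD none φ (s, x)‖ₑ := by
  obtain ⟨R1, h1⟩ := h.CI.2
  obtain ⟨R2, h2⟩ := (h.DD none).CI.2
  have hn : ∀ s : ℝ, |s| ≤ ‖((s, x) : EE d)‖ := fun s => norm_fst_le ((s, x) : EE d)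
  refine line1d (g := fun s => φ (s, x)) (g' := fun s => DD none φ (s, x)) ?_ ?_ (max R1 R2) ?_ ?_ t
  · intro t
    have h1 : HasDerivAt (fun s : ℝ => ((s, x) : EE d)) (1, 0) t :=
      (hasDerivAt_id t).prodMk (hasDerivAt_const t x)
    exact (h.1.diff (t, x)).hasFDerivAt.comp_hasDerivAt t h1
  · exact (h.DD none).1.cont.comp (by fun_prop)
  · intro s hs
    exact h1 _ (((le_max_left _ _).trans_lt hs).trans_le (hn s))
  · intro s hs
    exact h2 _ (((le_max_right _ _).trans_lt hs).trans_le (hn s))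

theorem hasDerivAt_update_line {φ : EE d → ℝ} (h : Sm φ) (t : ℝ) (x : Fin d → ℝ) (i : Fin d) (s : ℝ) :
    HasDerivAt (fun s => φ (t, Function.update x i s)) (DD (some i) φ (t, Function.update x i s)) s := by
  have h1 : HasDerivAt (fun s : ℝ => ((t, Function.update x i s) : EE d)) (0, Pi.single i 1) s :=
    (hasDerivAt_const s t).prodMk (hasDerivAt_update x i s)
  exact (h.diff _).hasFDerivAt.comp_hasDerivAt s h1

theorem line_x {φ : EE d → ℝ} (h : TF φ) (t : ℝ) (x : Fin d → ℝ) (i : Fin d) :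
    ‖φ (t, x)‖ₑ ≤ ∫⁻ s, ‖DD (some i) φ (t, Function.update x i s)‖ₑ := by
  obtain ⟨R1, h1⟩ := h.CI.2
  obtain ⟨R2, h2⟩ := (h.DD (some i)).CI.2
  have hn : ∀ s : ℝ, |s| ≤ ‖((t, Function.update x i s) : EE d)‖ := by
    intro s
    have q1 := norm_snd_le ((t, Function.update x i s) : EE d)
    have q2 := norm_le_pi_norm (Function.update x i s) i
    simp only [Function.update_self, Real.norm_eq_abs] at q2
    exact q2.trans q1
  have := line1d (g := fun s => φ (t, Function.update x i s)) (g' := fun s => DD (some i) φ (t, Function.update x i s))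
    (hasDerivAt_update_line h.1 t x i) ((h.DD (some i)).1.cont.comp (by fun_prop)) (max R1 R2)
    (fun s hs => h1 _ (((le_max_left _ _).trans_lt hs).trans_le (hn s)))
    (fun s hs => h2 _ (((le_max_right _ _).trans_lt hs).trans_le (hn s))) (x i)
  simp only [Function.update_eq_self] at this
  exact this.trans (setLIntegral_le_lintegral _ _)

theorem sup_x (l : List (Fin d)) (hl : l.Nodup) : ∀ {φ : EE d → ℝ} (_ : TF φ) (t : ℝ) (x : Fin d → ℝ),
    ‖φ (t, x)‖ₑ ≤ (∫⋯∫⁻_l.toFinset, (fun y => ‖DL (l.map some) φ (t, y)‖ₑ) ∂(fun _ => (volume : Measure ℝ))) x := by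
  induction l with
  | nil => intro φ h t x; simp [DL]
  | cons i l ih =>
    intro φ h t x
    have hl' := List.nodup_cons.1 hl
    rw [List.toFinset_cons, lmarginal_insert]
    · refine (line_x h t x i).trans (lintegral_mono fun s => ?_)
      exact ih hl'.2 (h.DD (some i)) t (Function.update x i s)
    · exact ((h.DL _).1.cont.comp (by fun_prop)).measurable.enorm
    · simpa using hl'.1

theorem sup_full {φ : EE d → ℝ} (h : TF φ) (p : EE d) :
    ‖φ p‖ₑ ≤ ∫⁻ q in HS d p.1, ‖DL (none :: (List.finRange d).map some) φ q‖ₑ := by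
  have hset : HS d p.1 = Set.Ioi p.1 ×ˢ (Set.univ : Set (Fin d → ℝ)) := by
    ext q; simp [HS]
  have hm : Measurable fun q : EE d => ‖DL (none :: (List.finRange d).map some) φ q‖ₑ :=
    (h.DL _).1.cont.measurable.enorm
  rw [hset, Measure.volume_eq_prod, ← Measure.prod_restrict, lintegral_prod _ hm.aemeasurable, Measure.restrict_univ]
  refine (line_t h p.1 p.2).trans (lintegral_mono fun s => ?_)
  have := sup_x (List.finRange d) (List.nodup_finRange d) (h.DD none) s p.2
  rw [List.toFinset_finRange, lmarginal_univ] at this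
  exact this

theorem cs_Qc {F : EE d → ℝ} (hF : LB F) (ρ : ℝ) :
    (∫ p in Qc d ρ, |F p|) ^ 2 ≤ ((volume (Qc d ρ)).toReal + 1) * ∫ p in Qc d ρ, F p ^ 2 := by
  set V := (volume (Qc d ρ)).toReal with hV
  have hV0 : 0 ≤ V := ENNReal.toReal_nonneg
  set I := ∫ p in Qc d ρ, |F p| with hI
  set c := I / (V + 1) with hc
  have h1 : 0 ≤ ∫ p in Qc d ρ, (|F p| - c) ^ 2 := integral_nonneg fun p => sq_nonneg _
  have e : ∀ p, (|F p| - c) ^ 2 = F p ^ 2 + ((-2 * c) * |F p| + c ^ 2) := by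
    intro p; rw [sub_sq, sq_abs]; ring
  simp_rw [e] at h1
  rw [integral_add (hF.sq.iq ρ) ((((LB.const (-2*c)).mul hF.abs).add (LB.const (c^2))).iq ρ),
    integral_add (((LB.const (-2*c)).mul hF.abs).iq ρ) ((LB.const (c^2)).iq ρ), integral_const_mul, ← hI] at h1
  have h2 : ∫ p in Qc d ρ, c ^ 2 = V * c ^ 2 := by simp [hV, Measure.real]
  rw [h2] at h1
  have hI' : I = c * (V + 1) := by rw [hc]; field_simp
  have h3 : 0 ≤ (V+1) * c^2 := by positivity
  rw [hI'] at h1 ⊢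
  have e9 : -2 * c * (c * (V + 1)) + V * c ^ 2 = -((V + 1) * c ^ 2) - c ^ 2 := by ring
  have h4 : (V + 1) * c ^ 2 ≤ ∫ p in Qc d ρ, F p ^ 2 := by linarith [sq_nonneg c]
  calc (c * (V + 1)) ^ 2 = (V + 1) * ((V + 1) * c ^ 2) := by ring
    _ ≤ _ := mul_le_mul_of_nonneg_left h4 (by positivity)

/-- pointwise bound of a cut-off function. -/
theorem sup_Qc {ρ' ρ : ℝ} {η V : EE d → ℝ} (hη : Cut ρ' ρ η) (hV : Sm V) {p : EE d} (h0 : 0 ≤ p.1) (h1 : p.1 ≤ ρ' ^ 2)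
    (h2 : ∑ j, p.2 j ^ 2 ≤ ρ' ^ 2) :
    V p ^ 2 ≤ ((volume (Qc d ρ)).toReal + 1) *
      ∫ q in Qc d ρ, DL (none :: (List.finRange d).map some) (fun q => η q * V q) q ^ 2 := by
  have hφ : TF (fun q => η q * V q) := hη.tf.mul hV
  have hs := sup_full hφ p
  have hone : η p = 1 := hη.one p (by linarith) h1 h2
  simp only [hone, one_mul] at hs
  set D := DL (none :: (List.finRange d).map some) (fun q => η q * V q) with hD
  have hDT : TF D := hφ.DL _
  have h3 : ∫⁻ q in HS d p.1, ‖D q‖ₑ ≤ ∫⁻ q in HS d 0, ‖D q‖ₑ :=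
    lintegral_mono_set fun q hq => lt_of_le_of_lt h0 hq
  have h4 : |V p| ≤ ∫ q in HS d 0, |D q| := by
    have h5 := hs.trans h3
    rw [← ofReal_integral_norm_eq_lintegral_enorm (hDT.CI.int' 0), ← ofReal_norm] at h5
    exact (ENNReal.ofReal_le_ofReal_iff (integral_nonneg fun q => norm_nonneg _)).1 h5
  rw [hη.int (by
    intro q hq
    simp only [hD]
    rw [off_zero (DL_off (tsupp_mul hq) _), abs_zero])] at h4
  have := cs_Qc hDT.1.LB ρ
  refine le_trans ?_ this
  rw [← sq_abs (V p)]
  gcongr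

/-- Interior estimate of first derivatives. -/
theorem SupII (d : ℕ) {δ : ℝ} (hδ : 0 < δ) {ρ : ℝ} (hρ : 1/4 < ρ) : ∃ C : ℝ, 0 < C ∧
    ∀ (a : ℝ → Fin d → Fin d → ℝ) (_ : Ell δ a) (i0 : Fin d) (H : EE d → ℝ) (_ : Sm H) (E : ℝ),
    (∀ γ, Good i0 γ → γ.length ≤ d + 2 → ∫ p in Qc d ρ, Lop i0 a (DL γ H) p ^ 2 ≤ E) →
    ∀ e (p : EE d), 0 ≤ p.1 → p.1 ≤ (1/4)^2 → ∑ j, p.2 j ^ 2 ≤ (1/4)^2 →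
      DD e H p ^ 2 ≤ C * ((∫ p in Qc d ρ, H p ^ 2) + E) := by
  obtain ⟨η, hη⟩ := cut_exists d (ρ' := 1/4) (ρ := (1/4+ρ)/2) (by norm_num) (by linarith)
  obtain ⟨C1, hC1, h1⟩ := iter d hδ (d+2) (ρ' := (1/4+ρ)/2) (ρ := ρ) (by linarith) (by linarith)
  obtain ⟨C2, hC2, h2⟩ := leib ((1/4+ρ)/2) (none :: (List.finRange d).map some) η hη.tf
  refine ⟨((volume (Qc d ((1/4+ρ)/2))).toReal + 1) * (C2 * C1) + 1, by positivity, fun a h i0 H hH E hE e p hp0 hp1 hp2 => ?_⟩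
  have hE0 : 0 ≤ E := (integral_nonneg fun p => sq_nonneg _).trans (hE [] (by simp [Good]) (by simp))
  have hI0 : 0 ≤ ∫ p in Qc d ρ, H p ^ 2 := integral_nonneg fun p => sq_nonneg _
  have hi := h1 a h i0 H hH E hE
  set I := (∫ p in Qc d ρ, H p ^ 2) + E with hI
  have hs := sup_Qc hη (hH.DD e) hp0 hp1 hp2
  have hnd : (none :: (List.finRange d).map some).Nodup := by
    rw [List.nodup_cons]
    refine ⟨by simp, (List.nodup_finRange d).map (Option.some_injective _)⟩
  have hle := h2 (DD e H) (hH.DD e) (C1 * I) (by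
    intro l' hl'
    have hlen : l'.length ≤ d + 1 := by simpa using hl'.length_le
    have hnd' := hnd.sublist hl'
    by_cases hm : some i0 ∈ l'
    · have hperm := List.perm_cons_erase hm
      have hg : Good i0 (l'.erase (some i0)) := by
        intro j hj hc
        rw [hc] at hj
        exact (hnd'.not_mem_erase) hj
      have hlen2 : (l'.erase (some i0)).length ≤ d := by
        rw [List.length_erase_of_mem hm]; omega
      set γ := l'.erase (some i0) with hγ
      rw [DL_perm hperm (hH.DD e), DL_cons (hH.DD e), DL_DD hH]
      match e with
      | none =>
        refine le_trans ?_ (hi (none :: γ) (by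
          intro j hj; rcases List.mem_cons.1 hj with h | h
          · simp [h]
          · exact hg j h) (by simp; omega))
        refine integral_mono ((((hH.DL _).DD _).DD _).LB.sq.iq _) ((NN_LB (hH.DL _)).iq _) fun q => ?_
        rw [DL_cons hH]
        exact (NN_parts _ q).2.2.1 (some i0)
      | some j =>
        refine le_trans ?_ (hi γ hg (by omega))
        refine integral_mono ((((hH.DL _).DD _).DD _).LB.sq.iq _) ((NN_LB (hH.DL _)).iq _) fun q => ?_
        exact (NN_parts _ q).2.2.2 i0 j
    · refine le_trans ?_ (hi l' (fun j hj hc => hm (hc ▸ hj)) (by omega))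
      rw [DL_DD hH]
      refine integral_mono (((hH.DL _).DD _).LB.sq.iq _) ((NN_LB (hH.DL _)).iq _) fun q => ?_
      exact (NN_parts _ q).2.2.1 e)
  have h5 := mul_le_mul_of_nonneg_left hle (by positivity : 0 ≤ (volume (Qc d ((1/4+ρ)/2))).toReal + 1)
  have h6 : 0 ≤ I := by positivity
  linarith

end Sup
end P8

section P9
section Osc
open MeasureTheory

variable {d : ℕ}

theorem cs1 {g g' : ℝ → ℝ} (hd : ∀ s, HasDerivAt g (g' s) s) (hc : Continuous g') {b : ℝ} (hb : 0 ≤ b) :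
    (g b - g 0) ^ 2 ≤ b * ∫ s in Set.Ioc 0 b, g' s ^ 2 := by
  rcases hb.eq_or_lt with rfl | hb
  · simp
  rw [← intervalIntegral.integral_of_le hb.le]
  have e1 := intervalIntegral.integral_eq_sub_of_hasDerivAt (a := 0) (b := b) (fun s _ => hd s) (hc.intervalIntegrable _ _)
  set m := (g b - g 0) / b with hm
  have h0 : 0 ≤ ∫ s in (0:ℝ)..b, (g' s - m) ^ 2 :=
    intervalIntegral.integral_nonneg hb.le fun s _ => sq_nonneg _
  have e : ∀ s, (g' s - m) ^ 2 = g' s ^ 2 - (2 * m) * g' s + m ^ 2 := fun s => by ring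
  simp_rw [e] at h0
  rw [intervalIntegral.integral_add (by apply Continuous.intervalIntegrable; fun_prop) (by simp),
    intervalIntegral.integral_sub (by apply Continuous.intervalIntegrable; fun_prop) (by apply Continuous.intervalIntegrable; fun_prop),
    intervalIntegral.integral_const_mul, e1] at h0
  simp only [intervalIntegral.integral_const, sub_zero, smul_eq_mul] at h0
  have e2 : g b - g 0 = m * b := by rw [hm]; field_simp
  rw [e2] at h0 ⊢
  nlinarith

theorem cs1e {g g' : ℝ → ℝ} (hd : ∀ s, HasDerivAt g (g' s) s) (hc : Continuous g') {b r : ℝ} (hb : 0 ≤ b) (hbr : b ≤ r) :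
    ENNReal.ofReal ((g b - g 0) ^ 2) ≤ ENNReal.ofReal r * ∫⁻ s in Set.Ioc 0 b, ENNReal.ofReal (g' s ^ 2) := by
  have hi : IntegrableOn (fun s => g' s ^ 2) (Set.Ioc 0 b) :=
    ((hc.pow 2).integrableOn_Icc).mono_set Set.Ioc_subset_Icc_self
  rw [← ofReal_integral_eq_lintegral_ofReal hi (Filter.Eventually.of_forall fun s => sq_nonneg _),
    ← ENNReal.ofReal_mul (hb.trans hbr)]
  refine ENNReal.ofReal_le_ofReal ((cs1 hd hc hb).trans ?_)
  exact mul_le_mul_of_nonneg_right hbr (integral_nonneg fun s => sq_nonneg _)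

theorem cs2 {g g' : ℝ → ℝ} (hd : ∀ s, HasDerivAt g (g' s) s) (hc : Continuous g') {b r : ℝ} (hbr : |b| ≤ r) :
    ENNReal.ofReal ((g b - g 0) ^ 2) ≤ ENNReal.ofReal r * ∫⁻ s in Set.Icc (-|b|) |b|, ENNReal.ofReal (g' s ^ 2) := by
  rcases le_total 0 b with hb | hb
  · rw [abs_of_nonneg hb] at hbr ⊢
    refine (cs1e hd hc hb hbr).trans ?_
    gcongr
    intro s hs; exact ⟨by linarith [hs.1], hs.2⟩
  · rw [abs_of_nonpos hb] at hbr ⊢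
    have := cs1e (g := fun s => g (-s)) (g' := fun s => - g' (-s)) (fun s => by
      have := (hd (-s)).comp s (hasDerivAt_neg s)
      rwa [mul_neg_one] at this) (by fun_prop) (neg_nonneg.2 hb) hbr
    simp only [neg_neg, neg_zero, neg_sq] at this
    refine this.trans (mul_le_mul_right ?_ _)
    rw [← lintegral_indicator measurableSet_Ioc, ← lintegral_indicator measurableSet_Icc, 
      ← lintegral_neg_eq_self _ ]
    refine lintegral_mono fun s => ?_
    simp only [Set.indicator]
    split_ifs with h1 h2
    · simp
    · exfalso; apply h2; constructor <;> linarith [h1.1, h1.2]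
    · simp
    · simp

theorem fub (i0 : Fin d) {r : ℝ} (g : (Fin d → ℝ) → ENNReal) (hg : Measurable g) :
    ∫⁻ x, Set.indicator {x : Fin d → ℝ | |x i0| < r} (fun x => ∫⁻ s, g (Function.update x i0 s)) x
      = ENNReal.ofReal (2 * r) * ∫⁻ x, g x := by
  have hG : Measurable fun x : Fin d → ℝ => ∫⁻ s, g (Function.update x i0 s) := by
    have : Measurable fun q : (Fin d → ℝ) × ℝ => g (Function.update q.1 i0 q.2) := by
      refine hg.comp ?_
      exact Continuous.measurable (by fun_prop)
    exact this.lintegral_prod_right'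
  have hS : MeasurableSet {x : Fin d → ℝ | |x i0| < r} :=
    (isOpen_lt (by fun_prop) continuous_const).measurableSet
  rw [volume_pi, lintegral_eq_lmarginal_univ (0 : Fin d → ℝ), lintegral_eq_lmarginal_univ (0 : Fin d → ℝ),
    lmarginal_erase' _ (hG.indicator hS) (Finset.mem_univ i0), lmarginal_erase' _ hg (Finset.mem_univ i0)]
  have e : (fun x : Fin d → ℝ => ∫⁻ s, Set.indicator {x : Fin d → ℝ | |x i0| < r} (fun x => ∫⁻ s, g (Function.update x i0 s)) (Function.update x i0 s))
     = fun x => ENNReal.ofReal (2 * r) * ∫⁻ s, g (Function.update x i0 s) := by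
    funext x
    have : ∀ s, Set.indicator {x : Fin d → ℝ | |x i0| < r} (fun x => ∫⁻ s, g (Function.update x i0 s)) (Function.update x i0 s)
      = Set.indicator (Set.Ioo (-r) r) (fun _ => ∫⁻ s, g (Function.update x i0 s)) s := by
      intro s
      simp [Set.indicator, abs_lt]
    simp_rw [this]
    rw [lintegral_indicator measurableSet_Ioo]
    simp [mul_comm]
    congr 2; ring
  rw [e]
  unfold lmarginal
  rw [lintegral_const_mul]
  refine hG.comp ?_
  exact measurable_updateFinset

theorem mono_abs {x : Fin d → ℝ} (i0 : Fin d) {s : ℝ} (h : |s| ≤ |x i0|) :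
    ∑ j, (Function.update x i0 s j) ^ 2 ≤ ∑ j, x j ^ 2 := by
  refine Finset.sum_le_sum fun j _ => ?_
  by_cases hj : j = i0
  · subst hj; simpa using sq_le_sq.2 h
  · simp [hj]

theorem abs_lt_of_ball {x : Fin d → ℝ} {r : ℝ} (hr : 0 < r) (h : x ∈ ballE d r) (i : Fin d) : |x i| < r := by
  have h1 : x i ^ 2 ≤ ∑ j, x j ^ 2 := Finset.single_le_sum (f := fun j => x j ^ 2) (fun j _ => sq_nonneg _) (Finset.mem_univ i)
  exact abs_lt_of_sq_lt_sq (h1.trans_lt h) hr.le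

theorem osc1 (i0 : Fin d) {w g : EE d → ℝ} (hw : Sm w) (hg : LB g) {r : ℝ} (hr : 0 < r) 
    (hd : ∀ p ∈ Qc d r, DD (some i0) w p ^ 2 ≤ g p) :
    ∫ p in Qc d r, (w p - w (p.1, Function.update p.2 i0 0)) ^ 2 ≤ 2 * r ^ 2 * ∫ p in Qc d r, g p := by
  have hg0 : ∀ p ∈ Qc d r, 0 ≤ g p := fun p hp => (sq_nonneg _).trans (hd p hp)
  have hb : MeasurableSet (ballE d r) := (ballE_open r).measurableSet
  have hwh : Continuous fun p : EE d => (w p - w (p.1, Function.update p.2 i0 0)) ^ 2 := by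
    have := hw.cont
    fun_prop
  have hae : ∀ᵐ p ∂(volume.restrict (Qc d r)), 0 ≤ g p :=
    (ae_restrict_iff' (Qc_meas r)).2 (Filter.Eventually.of_forall hg0)
  have hgm : Measurable fun p => ENNReal.ofReal (g p) := hg.1.ennreal_ofReal
  rw [← ENNReal.ofReal_le_ofReal_iff (by
    have := integral_nonneg_of_ae hae
    positivity), ENNReal.ofReal_mul (by positivity),
    ofReal_integral_eq_lintegral_ofReal ((LB.of_cont hwh).iq r) (Filter.Eventually.of_forall fun _ => sq_nonneg _),
    ofReal_integral_eq_lintegral_ofReal (hg.iq r) hae]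
  unfold Qc
  rw [Measure.volume_eq_prod, ← Measure.prod_restrict, lintegral_prod _ hwh.measurable.ennreal_ofReal.aemeasurable,
    lintegral_prod _ hgm.aemeasurable, ← lintegral_const_mul _ (by exact hgm.lintegral_prod_right')]
  refine lintegral_mono_ae ((ae_restrict_iff' measurableSet_Ioo).2 (Filter.Eventually.of_forall fun t ht => ?_))
  set gt : (Fin d → ℝ) → ENNReal := (ballE d r).indicator fun y => ENNReal.ofReal (g (t, y)) with hgt
  have hgtm : Measurable gt := (hgm.comp measurable_prodMk_left).indicator hb
  have hf := fub i0 (r := r) gt hgtm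
  have e1 : ∫⁻ y in ballE d r, ENNReal.ofReal (g (t, y)) = ∫⁻ y, gt y := by
    rw [hgt, lintegral_indicator hb]
  have e2 : ENNReal.ofReal (2 * r ^ 2) = ENNReal.ofReal r * ENNReal.ofReal (2 * r) := by
    rw [← ENNReal.ofReal_mul hr.le]; congr 1; ring
  rw [e1, e2, mul_assoc, ← hf, ← lintegral_indicator hb, ← lintegral_const_mul' _ _ ENNReal.ofReal_ne_top]
  refine lintegral_mono fun x => ?_
  by_cases hx : x ∈ ballE d r
  · have hx0 := abs_lt_of_ball hr hx i0
    rw [Set.indicator_of_mem hx, Set.indicator_of_mem (by exact hx0)]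
    have := cs2 (hasDerivAt_update_line hw t x i0) ((hw.DD (some i0)).cont.comp (by fun_prop)) hx0.le
    simp only [Function.update_eq_self] at this
    refine this.trans (mul_le_mul_right ?_ _)
    rw [← lintegral_indicator measurableSet_Icc]
    refine lintegral_mono fun s => ?_
    by_cases hs : s ∈ Set.Icc (-|x i0|) |x i0|
    · have hmem : Function.update x i0 s ∈ ballE d r := (mono_abs i0 (abs_le.2 hs)).trans_lt hx
      rw [Set.indicator_of_mem hs, hgt, Set.indicator_of_mem hmem]
      exact ENNReal.ofReal_le_ofReal (hd (t, _) ⟨ht, hmem⟩)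
    · rw [Set.indicator_of_notMem hs]; exact zero_le
  · rw [Set.indicator_of_notMem hx]; exact zero_le

theorem fd_apply (w : EE d → ℝ) (p q : EE d) :
    fderiv ℝ w p q = q.1 * DD none w p + ∑ j, q.2 j * DD (some j) w p := by
  have : q = q.1 • ev none + ∑ j, q.2 j • ev (some j) := by
    ext i
    · simp [ev, Prod.fst_sum]
    · simp [ev, Prod.snd_sum, Finset.sum_apply, Pi.single_apply]
  conv_lhs => rw [this]
  simp [DD]

theorem osc2 (i0 : Fin d) {w : EE d → ℝ} (hw : Sm w) {r M : ℝ} (hr : 0 < r) (hr1 : r ≤ 1)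
    (hd : ∀ e, e ≠ some i0 → ∀ p : EE d, 0 ≤ p.1 → p.1 ≤ r ^ 2 → ∑ j, p.2 j ^ 2 ≤ r ^ 2 → DD e w p ^ 2 ≤ M)
    (q : EE d) (h0 : 0 ≤ q.1) (h1 : q.1 ≤ r ^ 2) (h2 : ∑ j, q.2 j ^ 2 ≤ r ^ 2) (h3 : q.2 i0 = 0) :
    (w q - w 0) ^ 2 ≤ (d + 1) * 2 * r ^ 2 * M := by
  have hm : ∃ c ∈ Set.Ioo (0:ℝ) 1, fderiv ℝ w (c • q) q = (w ((1:ℝ) • q) - w ((0:ℝ) • q)) / (1 - 0) := by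
    have hder : ∀ c : ℝ, HasDerivAt (fun c : ℝ => w (c • q)) (fderiv ℝ w (c • q) q) c := by
      intro c
      have := (hasDerivAt_id c).smul_const q
      simp only [one_smul] at this
      exact (hw.diff _).hasFDerivAt.comp_hasDerivAt c this
    exact exists_hasDerivAt_eq_slope (fun c : ℝ => w (c • q)) (fun c => fderiv ℝ w (c • q) q) one_pos
      (fun c _ => (hder c).continuousAt.continuousWithinAt) (fun c _ => hder c)
  obtain ⟨c, hc, he⟩ := hm
  simp only [one_smul, zero_smul, sub_zero, div_one] at he
  rw [← he, fd_apply]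
  have hp : ∀ e, e ≠ some i0 → DD e w (c • q) ^ 2 ≤ M := by
    intro e he
    refine hd e he (c • q) ?_ ?_ ?_
    · exact mul_nonneg hc.1.le h0
    · exact (mul_le_of_le_one_left h0 hc.2.le).trans h1
    · refine le_trans (Finset.sum_le_sum fun j _ => ?_) h2
      simp only [Prod.smul_snd, Pi.smul_apply, smul_eq_mul, mul_pow]
      refine mul_le_of_le_one_left (sq_nonneg _) ?_
      exact pow_le_one₀ hc.1.le hc.2.le
  have hM : 0 ≤ M := (sq_nonneg _).trans (hp none (by simp))
  have hcs := Finset.sum_mul_sq_le_sq_mul_sq (Finset.univ : Finset (Option (Fin d)))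
    (fun e => e.elim q.1 q.2) (fun e => if e = some i0 then 0 else DD e w (c • q))
  have e1 : ∑ e : Option (Fin d), e.elim q.1 q.2 * (if e = some i0 then 0 else DD e w (c • q))
     = q.1 * DD none w (c • q) + ∑ j, q.2 j * DD (some j) w (c • q) := by
    rw [Fintype.sum_option]
    simp only [Option.elim, reduceCtorEq, if_false, Option.some.injEq]
    congr 1
    refine Finset.sum_congr rfl fun j _ => ?_
    split_ifs with h
    · subst h; simp [h3]
    · rfl
  rw [e1] at hcs
  refine hcs.trans ?_
  have e2 : ∑ e : Option (Fin d), (e.elim q.1 q.2) ^ 2 ≤ 2 * r ^ 2 := by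
    rw [Fintype.sum_option]
    simp only [Option.elim]
    have : q.1 ^ 2 ≤ r ^ 2 := by
      have : q.1 ≤ r := h1.trans (by nlinarith)
      gcongr
    linarith
  have e3 : ∑ e : Option (Fin d), (if e = some i0 then 0 else DD e w (c • q)) ^ 2 ≤ (d + 1) * M := by
    refine (Finset.sum_le_card_nsmul _ _ M fun e _ => ?_).trans ?_
    · split_ifs with h
      · simpa using hM
      · exact hp e h
    · simp
  calc _ ≤ (2 * r ^ 2) * ((d + 1) * M) := mul_le_mul e2 e3 (Finset.sum_nonneg fun _ _ => sq_nonneg _) (by positivity)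
    _ = _ := by ring

theorem osc3 (i0 : Fin d) {w g : EE d → ℝ} (hw : Sm w) (hg : LB g) {r M : ℝ} (hr : 0 < r) (hr1 : r ≤ 1)
    (hd : ∀ e, e ≠ some i0 → ∀ p : EE d, 0 ≤ p.1 → p.1 ≤ r ^ 2 → ∑ j, p.2 j ^ 2 ≤ r ^ 2 → DD e w p ^ 2 ≤ M)
    (hd0 : ∀ p ∈ Qc d r, DD (some i0) w p ^ 2 ≤ g p) :
    ∫ p in Qc d r, (w p - w 0) ^ 2 ≤ (4 * (d + 1)) * r ^ 2 * (M * (volume (Qc d r)).toReal + ∫ p in Qc d r, g p) := by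
  have h1 := osc1 i0 hw hg hr hd0
  have hwh : Continuous fun p : EE d => (w p - w (p.1, Function.update p.2 i0 0)) ^ 2 := by
    have := hw.cont
    fun_prop
  have hI0 : 0 ≤ ∫ p in Qc d r, g p := by
    refine setIntegral_nonneg (Qc_meas r) fun p hp => (sq_nonneg _).trans (hd0 p hp)
  have h2 : ∫ p in Qc d r, (w p - w 0) ^ 2 ≤ ∫ p in Qc d r, (2 * (w p - w (p.1, Function.update p.2 i0 0)) ^ 2 + 2 * ((d + 1) * 2 * r ^ 2 * M)) := by
    refine setIntegral_mono_on ((hw.LB.sub (LB.const _)).sq.iq r) ((((LB.const 2).mul (LB.of_cont hwh)).add (LB.const _)).iq r) (Qc_meas r) ?_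
    intro p hp
    have h3 := osc2 i0 hw hr hr1 hd (p.1, Function.update p.2 i0 0) hp.1.1.le hp.1.2.le
      ((mono_abs i0 (by simp)).trans (le_of_lt hp.2)) (by simp)
    have : w p - w 0 = (w p - w (p.1, Function.update p.2 i0 0)) + (w (p.1, Function.update p.2 i0 0) - w 0) := by ring
    rw [this]
    nlinarith [add_sq_le (a := w p - w (p.1, Function.update p.2 i0 0)) (b := w (p.1, Function.update p.2 i0 0) - w 0)]
  rw [integral_add (((LB.const 2).mul (LB.of_cont hwh)).iq r) ((LB.const _).iq r), integral_const_mul] at h2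
  have h4 : ∫ p in Qc d r, 2 * ((d + 1) * 2 * r ^ 2 * M) = (volume (Qc d r)).toReal * (2 * ((d + 1) * 2 * r ^ 2 * M)) := by
    simp [Measure.real]
  rw [h4] at h2
  have h5 : 0 ≤ (d:ℝ) * r ^ 2 * ∫ p in Qc d r, g p := by positivity
  nlinarith

end Osc
end P9

section P10
section OscF
open MeasureTheory

variable {d : ℕ}

noncomputable def HX (f : EE d → ℝ) : EE d → ℝ := fun p => ∑ j, ∑ k, DD (some j) (DD (some k) f) p ^ 2

theorem HX_LB {f : EE d → ℝ} (hf : Sm f) : LB (HX f) :=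
  LB.sum _ fun j _ => LB.sum _ fun k _ => ((hf.DD _).DD _).LB.sq

theorem HX_nonneg (f : EE d → ℝ) (p : EE d) : 0 ≤ HX f p :=
  Finset.sum_nonneg fun j _ => Finset.sum_nonneg fun k _ => sq_nonneg _

theorem HX_le (f : EE d → ℝ) (p : EE d) (j k : Fin d) : DD (some j) (DD (some k) f) p ^ 2 ≤ HX f p := by
  refine le_trans ?_ (Finset.single_le_sum (f := fun j => ∑ k, DD (some j) (DD (some k) f) p ^ 2) (fun j _ => Finset.sum_nonneg fun k _ => sq_nonneg _) (Finset.mem_univ j))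
  exact Finset.single_le_sum (f := fun k => DD (some j) (DD (some k) f) p ^ 2) (fun j _ => sq_nonneg _) (Finset.mem_univ k)

theorem dt_le {δ : ℝ} (hδ : 0 < δ) {a : ℝ → Fin d → Fin d → ℝ} (h : Ell δ a) (i0 : Fin d) (f : EE d → ℝ) (p : EE d) :
    DD none f p ^ 2 ≤ 2 * Lop i0 a f p ^ 2 + 2 * ((d:ℝ) ^ 2 * (δ⁻¹) ^ 2) * HX f p := by
  have h1 := sq_sum_sum_le (fun j k => a (p.2 i0) j k * DD (some j) (DD (some k) f) p)
  have h2 : ∑ j, ∑ k, (a (p.2 i0) j k * DD (some j) (DD (some k) f) p) ^ 2 ≤ (δ⁻¹) ^ 2 * HX f p := by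
    unfold HX
    rw [Finset.mul_sum]
    refine Finset.sum_le_sum fun j _ => ?_
    rw [Finset.mul_sum]
    refine Finset.sum_le_sum fun k _ => ?_
    rw [mul_pow]
    refine mul_le_mul_of_nonneg_right ?_ (sq_nonneg _)
    rw [← sq_abs]
    have := h.abs_le hδ (p.2 i0) j k
    gcongr
  have e : DD none f p = Lop i0 a f p - ∑ j, ∑ k, a (p.2 i0) j k * DD (some j) (DD (some k) f) p := by
    unfold Lop; ring
  rw [e]
  set S := ∑ j, ∑ k, a (p.2 i0) j k * DD (some j) (DD (some k) f) p
  have h3 : S ^ 2 ≤ (d:ℝ) ^ 2 * ((δ⁻¹) ^ 2 * HX f p) := h1.trans (by gcongr)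
  nlinarith [sq_nonneg (Lop i0 a f p + S)]

theorem supBounds (d : ℕ) {δ : ℝ} (hδ : 0 < δ) : ∃ C : ℝ, 0 < C ∧
    ∀ (a : ℝ → Fin d → Fin d → ℝ) (_ : Ell δ a) (i0 : Fin d) (f : EE d → ℝ) (_ : Sm f) (E : ℝ),
    (∀ γ, Good i0 γ → γ.length ≤ d + 4 → ∫ p in Qc d (1/2), Lop i0 a (DL γ f) p ^ 2 ≤ E) →
    ∀ (p : EE d), 0 ≤ p.1 → p.1 ≤ (1/4)^2 → ∑ j, p.2 j ^ 2 ≤ (1/4)^2 → ∀ e,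
      DD e (DD none f) p ^ 2 ≤ C * ((∫ p in Qc d (1/2), HX f p) + E) ∧
      (∀ i k, i ≠ i0 → k ≠ i0 → DD e (DD (some i) (DD (some k) f)) p ^ 2 ≤ C * ((∫ p in Qc d (1/2), HX f p) + E)) ∧
      (∀ k, k ≠ i0 → DD e (DD (some k) (DD none f)) p ^ 2 ≤ C * ((∫ p in Qc d (1/2), HX f p) + E)) := by
  obtain ⟨C1, hC1, h1⟩ := SupII d hδ (ρ := 1/2) (by norm_num)
  obtain ⟨C2, hC2, h2⟩ := SupII d hδ (ρ := 3/8) (by norm_num)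
  obtain ⟨C3, hC3, h3⟩ := NN_loc d hδ (ρ' := 3/8) (ρ := 1/2) (by norm_num) (by norm_num)
  set K := 2 + 2 * ((d:ℝ) ^ 2 * (δ⁻¹) ^ 2) with hK
  have hK2 : 2 ≤ K := by have : 0 ≤ 2 * ((d:ℝ) ^ 2 * (δ⁻¹) ^ 2) := by positivity
                         linarith
  refine ⟨C1 * (K + 1) + C2 * (C3 * (K + 1) + 1), by positivity, fun a h i0 f hf E hE p hp0 hp1 hp2 e => ?_⟩
  have hE0 : 0 ≤ E := (integral_nonneg fun p => sq_nonneg _).trans (hE [] (by simp [Good]) (by simp))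
  set X := ∫ p in Qc d (1/2), HX f p with hX
  have hX0 : 0 ≤ X := integral_nonneg fun p => HX_nonneg f p
  have ht : ∫ p in Qc d (1/2), DD none f p ^ 2 ≤ K * (X + E) := by
    have : ∫ p in Qc d (1/2), DD none f p ^ 2 ≤ ∫ p in Qc d (1/2), (2 * Lop i0 a f p ^ 2 + 2 * ((d:ℝ) ^ 2 * (δ⁻¹) ^ 2) * HX f p) :=
      integral_mono ((hf.DD _).LB.sq.iq _) ((((LB.const 2).mul (Lop_LB hδ h i0 hf).sq).add ((LB.const _).mul (HX_LB hf))).iq _)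
        fun p => dt_le hδ h i0 f p
    rw [integral_add (((LB.const 2).mul (Lop_LB hδ h i0 hf).sq).iq _) (((LB.const _).mul (HX_LB hf)).iq _),
      integral_const_mul, integral_const_mul, ← hX] at this
    have hE1 := hE [] (by simp [Good]) (by simp)
    simp only [DL] at hE1
    have : 0 ≤ 2 * ((d:ℝ) ^ 2 * (δ⁻¹) ^ 2) * E := by positivity
    rw [hK]; nlinarith
  have b1 : ∀ I J, I ≤ K * (X + E) → J ≤ E → C1 * (I + J) ≤ C1 * (K + 1) * (X + E) := by
    intro I J hI hJ
    have : I + J ≤ (K + 1) * (X + E) := by nlinarith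
    calc _ ≤ C1 * ((K + 1) * (X + E)) := by gcongr
      _ = _ := by ring
  have b0 : 0 ≤ C1 * (K + 1) * (X + E) := by positivity
  have b0' : 0 ≤ C2 * (C3 * (K + 1) + 1) * (X + E) := by positivity
  have g1 : ∀ {γ : List (Option (Fin d))}, Good i0 γ → Good i0 (none :: γ) := by
    intro γ hγ i hi
    rcases List.mem_cons.1 hi with h | h
    · simp [h]
    · exact hγ i h
  have g2 : ∀ {γ : List (Option (Fin d))} {k}, k ≠ i0 → Good i0 γ → Good i0 (some k :: γ) := by
    intro γ k hk hγ i hi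
    rcases List.mem_cons.1 hi with h | h
    · simp [h, hk]
    · exact hγ i h
  refine ⟨?_, fun i k hi hk => ?_, fun k hk => ?_⟩
  · have := h1 a h i0 (DD none f) (hf.DD _) E (fun γ hγ hl => hE (none :: γ) (g1 hγ) (by simp; omega)) e p hp0 hp1 hp2
    have := b1 _ _ ht le_rfl
    linarith
  · have q1 := h1 a h i0 (DD (some i) (DD (some k) f)) ((hf.DD _).DD _) E
      (fun γ hγ hl => hE (some k :: some i :: γ) (g2 hk (g2 hi hγ)) (by simp; omega)) e p hp0 hp1 hp2
    have q2 : ∫ p in Qc d (1/2), DD (some i) (DD (some k) f) p ^ 2 ≤ X :=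
      integral_mono (((hf.DD _).DD _).LB.sq.iq _) ((HX_LB hf).iq _) fun p => HX_le f p i k
    have := b1 _ _ (q2.trans (by nlinarith)) le_rfl
    linarith
  · have q1 := h2 a h i0 (DD (some k) (DD none f)) ((hf.DD _).DD _) E
      (fun γ hγ hl => (int_Qc_mono (Lop_LB hδ h i0 (((hf.DD _).DD _).DL _)).sq (fun _ => sq_nonneg _) (by norm_num) (by norm_num)).trans
        (hE (none :: some k :: γ) (g1 (g2 hk hγ)) (by simp; omega))) e p hp0 hp1 hp2
    have q3 := h3 a h i0 (DD none f) (hf.DD _)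
    have q4 := hE [none] (g1 (by simp [Good])) (by simp)
    simp only [DL] at q4
    have q2 : ∫ p in Qc d (3/8), DD (some k) (DD none f) p ^ 2 ≤ ∫ p in Qc d (3/8), NN (DD none f) p :=
      integral_mono (((hf.DD _).DD _).LB.sq.iq _) ((NN_LB (hf.DD _)).iq _) fun p => (NN_parts _ p).2.2.1 _
    have q5 : C3 * ((∫ p in Qc d (1/2), DD none f p ^ 2) + ∫ p in Qc d (1/2), Lop i0 a (DD none f) p ^ 2) ≤ C3 * ((K + 1) * (X + E)) := by
      gcongr; nlinarith
    have q6 : C2 * ((∫ p in Qc d (3/8), DD (some k) (DD none f) p ^ 2) + E) ≤ C2 * ((C3 * (K + 1) + 1) * (X + E)) := by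
      gcongr; nlinarith
    linarith

theorem oscF (d : ℕ) {δ : ℝ} (hδ : 0 < δ) : ∃ C : ℝ, 0 < C ∧
    ∀ (a : ℝ → Fin d → Fin d → ℝ) (_ : Ell δ a) (i0 : Fin d) (f : EE d → ℝ) (_ : Sm f) (E : ℝ),
    (∀ γ, Good i0 γ → γ.length ≤ d + 4 → ∫ p in Qc d (1/2), Lop i0 a (DL γ f) p ^ 2 ≤ E) →
    ∀ r, 0 < r → r ≤ 1/4 → ∀ w : EE d → ℝ, (w = DD none f ∨ ∃ j k, k ≠ i0 ∧ w = DD (some j) (DD (some k) f)) →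
     ∫ p in Qc d r, (w p - w 0) ^ 2 ≤ C * r ^ 2 * (((∫ p in Qc d (1/2), HX f p) + E) * (volume (Qc d r)).toReal + E) := by
  obtain ⟨C1, hC1, h1⟩ := supBounds d hδ
  set B := 4 * (d ^ 2 * (δ⁻¹) ^ 4 * d ^ 2) + 4 * (δ⁻¹) ^ 2 with hB
  have hB0 : 0 ≤ B := by positivity
  refine ⟨4 * (d + 1) * ((2 + B) * C1 + B), by positivity, fun a h i0 f hf E hE r hr hr4 w hw => ?_⟩
  have hE0 : 0 ≤ E := (integral_nonneg fun p => sq_nonneg _).trans (hE [] (by simp [Good]) (by simp))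
  set X := ∫ p in Qc d (1/2), HX f p with hX
  have hX0 : 0 ≤ X := integral_nonneg fun p => HX_nonneg f p
  set M := C1 * (X + E) with hM
  have hM0 : 0 ≤ M := by positivity
  set V := (volume (Qc d r)).toReal with hV
  have hV0 : 0 ≤ V := ENNReal.toReal_nonneg
  have hrr : r ^ 2 ≤ (1/4) ^ 2 := by gcongr
  have hs := h1 a h i0 f hf E hE
  have hint : ∀ c : ℝ, ∫ p in Qc d r, c = c * V := by intro c; simp [hV, Measure.real, mul_comm]
  have done : ∀ {I J : ℝ}, I ≤ 4 * (d + 1) * r ^ 2 * (M * V + J) → J ≤ (1 + B) * M * V + B * E →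
     I ≤ 4 * (d + 1) * ((2 + B) * C1 + B) * r ^ 2 * ((X + E) * V + E) := by
    intro I J hI hJ
    refine hI.trans ?_
    have h3 : M * V + J ≤ ((2 + B) * C1 + B) * ((X + E) * V + E) := by
      have : 0 ≤ B * ((X + E) * V) := by positivity
      have : 0 ≤ (2 + B) * C1 * E := by positivity
      rw [hM] at hJ ⊢
      nlinarith
    calc _ ≤ 4 * (d + 1) * r ^ 2 * (((2 + B) * C1 + B) * ((X + E) * V + E)) := by gcongr
      _ = _ := by ring
  have direct : ∀ w : EE d → ℝ, Sm w → (∀ (p : EE d), 0 ≤ p.1 → p.1 ≤ (1/4)^2 → ∑ j, p.2 j ^ 2 ≤ (1/4)^2 → ∀ e, DD e w p ^ 2 ≤ M) →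
      ∫ p in Qc d r, (w p - w 0) ^ 2 ≤ 4 * (d + 1) * ((2 + B) * C1 + B) * r ^ 2 * ((X + E) * V + E) := by
    intro w hw hb
    have := osc3 i0 hw (LB.const M) hr (by linarith) (M := M) (fun e _ p q0 q1 q2 => hb p q0 (q1.trans hrr) (q2.trans hrr) e)
      (fun p hp => hb p hp.1.1.le (hp.1.2.le.trans hrr) ((le_of_lt hp.2).trans hrr) _)
    refine done this ?_
    rw [hint]
    have : 0 ≤ B * M * V := by positivity
    have : 0 ≤ B * E := by positivity
    nlinarith
  rcases hw with rfl | ⟨j, k, hk, rfl⟩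
  · exact direct _ (hf.DD _) fun p q0 q1 q2 e => (hs p q0 q1 q2 e).1
  by_cases hj : j = i0
  swap
  · exact direct _ ((hf.DD _).DD _) fun p q0 q1 q2 e => (hs p q0 q1 q2 e).2.1 j k hj hk
  subst hj
  set fk := DD (some k) f with hfk
  have hfkS : Sm fk := hf.DD _
  have hcon : LB fun p => B * M + B * Lop j a fk p ^ 2 :=
    (LB.const (B * M)).add ((LB.const B).mul (Lop_LB hδ h j hfkS).sq)
  have key := osc3 j (w := DD (some j) fk) (hfkS.DD _) hcon hr (by linarith) (M := M) (by
    intro e he p q0 q1 q2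
    have q1 := q1.trans hrr
    have q2 := q2.trans hrr
    match e with
    | none =>
      rw [DD_comm hfkS, hfk, DD_comm hf none]
      exact (hs p q0 q1 q2 (some j)).2.2 k hk
    | some i =>
      rw [DD_comm hfkS]
      exact (hs p q0 q1 q2 (some j)).2.1 i k (by simpa using he) hk) (by
    intro p hp
    have q0 := hp.1.1.le
    have q1 := hp.1.2.le.trans hrr
    have q2 := (le_of_lt hp.2).trans hrr
    have r1 := rest_le hδ h j (p.2 j) (M := fun l m => DD (some l) (DD (some m) fk) p)
      (fun l m => congrFun (DD_comm hfkS _ _) p)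
    have r2 : Gd j (fun l m => DD (some l) (DD (some m) fk) p) ≤ d ^ 2 * M := by
      rw [Gd_eq]
      have : ∀ l m : Fin d, (if m = j then 0 else DD (some l) (DD (some m) fk) p ^ 2) ≤ M := by
        intro l m
        split_ifs with hm
        · exact hM0
        · exact (hs p q0 q1 q2 (some l)).2.1 m k hm hk
      calc _ ≤ ∑ l : Fin d, ∑ m : Fin d, M := Finset.sum_le_sum fun l _ => Finset.sum_le_sum fun m _ => this l m
        _ = _ := by simp; ring
    have r3 : DD none fk p ^ 2 ≤ M := by
      rw [hfk, DD_comm hf]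
      exact (hs p q0 q1 q2 (some k)).1
    have r4 : ∑ l, ∑ m, a (p.2 j) l m * DD (some l) (DD (some m) fk) p = Lop j a fk p - DD none fk p := by
      unfold Lop; ring
    rw [r4] at r1
    obtain ⟨i1, i2⟩ := h.inv_bd hδ (p.2 j) j
    set b := (a (p.2 j) j j)⁻¹
    set Lf := Lop j a fk p
    set ft := DD none fk p
    set f0 := DD (some j) (DD (some j) fk) p
    have r5 : b ^ 2 ≤ (δ⁻¹) ^ 2 := by have := hδ.le.trans i1; gcongr
    have r6 : (b * (Lf - ft) - f0) ^ 2 ≤ 2 * (d:ℝ) ^ 2 * (δ⁻¹) ^ 4 * (d ^ 2 * M) := r1.trans (by gcongr)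
    have r7 : (b * (Lf - ft)) ^ 2 ≤ (δ⁻¹) ^ 2 * (2 * Lf ^ 2 + 2 * M) := by
      rw [mul_pow]
      refine mul_le_mul r5 ?_ (sq_nonneg _) (sq_nonneg _)
      nlinarith [sq_nonneg (Lf + ft)]
    have r8 : f0 ^ 2 ≤ 2 * (b * (Lf - ft)) ^ 2 + 2 * (b * (Lf - ft) - f0) ^ 2 := by
      nlinarith [sq_nonneg (2 * (b * (Lf - ft)) - f0)]
    have r9 : 0 ≤ (4 * (d ^ 2 * (δ⁻¹) ^ 4 * d ^ 2)) * Lf ^ 2 := by positivity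
    have r10 : B * M + B * Lf ^ 2 = 2 * ((δ⁻¹) ^ 2 * (2 * Lf ^ 2 + 2 * M)) + 2 * (2 * (d:ℝ) ^ 2 * (δ⁻¹) ^ 4 * (d ^ 2 * M)) + (4 * (d ^ 2 * (δ⁻¹) ^ 4 * d ^ 2)) * Lf ^ 2 := by
      rw [hB]; ring
    linarith)
  refine done key ?_
  rw [integral_add ((LB.const (B * M)).iq r) (((LB.const B).mul (Lop_LB hδ h j hfkS).sq).iq r), hint, integral_const_mul]
  have s1 : ∫ p in Qc d r, Lop j a fk p ^ 2 ≤ E := by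
    refine (int_Qc_mono (Lop_LB hδ h j hfkS).sq (fun _ => sq_nonneg _) hr (ρ := 1/2) (by linarith)).trans ?_
    exact hE [some k] (by simpa [Good] using hk) (by simp)
  have s2 := mul_le_mul_of_nonneg_left s1 hB0
  have : 0 ≤ M * V := by positivity
  nlinarith

end OscF
end P10

section P11
section TmS
open MeasureTheory

variable {d : ℕ}

noncomputable def Tm (k : EE d → ℝ) (τ : EE d → EE d) (f : EE d → ℝ) : EE d → ℝ := fun p => ∫ q, k q * f (p + τ q)

theorem clm_eq (A : EE d →L[ℝ] ℝ) : A = A (ev none) • ContinuousLinearMap.fst ℝ ℝ (Fin d → ℝ) +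
    ∑ j, A (ev (some j)) • ((ContinuousLinearMap.proj (R := ℝ) (φ := fun _ : Fin d => ℝ) j).comp (ContinuousLinearMap.snd ℝ ℝ (Fin d → ℝ))) := by
  refine ContinuousLinearMap.ext fun q => ?_
  have : q = q.1 • ev none + ∑ j, q.2 j • ev (some j) := by
    ext i
    · simp [ev, Prod.fst_sum]
    · simp [ev, Prod.snd_sum, Finset.sum_apply, Pi.single_apply]
  conv_lhs => rw [this]
  simp [ContinuousLinearMap.sum_apply, mul_comm]

theorem sm_of {S : (EE d → ℝ) → Prop} (hS : ∀ f, S f → Differentiable ℝ f ∧ ∀ i, S (DD i f)) {f : EE d → ℝ} (hf : S f) : Sm f := by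
  have : ∀ n : ℕ, ∀ f, S f → ContDiff ℝ n f := by
    intro n
    induction n with
    | zero => intro f hf; exact contDiff_zero.2 (hS f hf).1.continuous
    | succ n ih =>
      intro f hf
      push_cast
      rw [contDiff_succ_iff_fderiv]
      refine ⟨(hS f hf).1, by simp, ?_⟩
      have e : fderiv ℝ f = fun p => DD none f p • ContinuousLinearMap.fst ℝ ℝ (Fin d → ℝ) +
        ∑ j, DD (some j) f p • ((ContinuousLinearMap.proj (R := ℝ) (φ := fun _ : Fin d => ℝ) j).comp (ContinuousLinearMap.snd ℝ ℝ (Fin d → ℝ))) := by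
        funext p; exact clm_eq _
      rw [e]
      exact ((ih _ ((hS f hf).2 none)).smul contDiff_const).add
        (ContDiff.sum fun j _ => (ih _ ((hS f hf).2 (some j))).smul contDiff_const)
  exact contDiff_infty.2 fun n => this n f hf

/-- admissible kernels -/
def Ker (k : EE d → ℝ) (τ : EE d → EE d) : Prop := Measurable τ ∧ AEStronglyMeasurable k volume ∧ ∀ R : ℝ, IntegrableOn k {q | ‖τ q‖ ≤ R}

theorem Ker.int {k : EE d → ℝ} {τ : EE d → EE d} (h : Ker k τ) {F : EE d → ℝ} (hF : CI F) (p : EE d) :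
    Integrable fun q => k q * F (p + τ q) := by
  obtain ⟨⟨hm, hb⟩, R, hR⟩ := hF
  obtain ⟨C, hC⟩ := hb R
  have hC' : ∀ q, |F q| ≤ max C 0 := by
    intro q
    by_cases hq : ‖q‖ ≤ R
    · exact (hC q hq).trans (le_max_left _ _)
    · rw [hR q (not_le.1 hq)]; simp
  have hmem : MeasurableSet {q : EE d | ‖τ q‖ ≤ R + ‖p‖} := measurableSet_le h.1.norm measurable_const
  have hi := ((integrable_indicator_iff hmem).2 (h.2.2 (R + ‖p‖))).norm.mul_const (max C 0)
  refine hi.mono' (h.2.1.mul (hm.comp (measurable_const.add h.1)).aestronglyMeasurable) (Filter.Eventually.of_forall fun q => ?_)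
  by_cases hq : ‖τ q‖ ≤ R + ‖p‖
  · rw [Set.indicator_of_mem (by exact hq), norm_mul]
    exact mul_le_mul_of_nonneg_left (hC' _) (norm_nonneg _)
  · have : R < ‖p + τ q‖ := by
      have h1 : ‖τ q‖ ≤ ‖p + τ q‖ + ‖p‖ := by
        calc ‖τ q‖ = ‖(p + τ q) - p‖ := by simp
          _ ≤ _ := norm_sub_le _ _
      linarith [not_le.1 hq]
    rw [hR _ this]; simp; positivity

theorem Tm_hasFDerivAt {k : EE d → ℝ} {τ : EE d → EE d} (h : Ker k τ) {f : EE d → ℝ} (hf : TF f) (p : EE d) :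
    HasFDerivAt (Tm k τ f) (∫ q, k q • fderiv ℝ f (p + τ q)) p := by
  obtain ⟨R, hR⟩ := hf.CI.2
  have hfd : Continuous (fderiv ℝ f) := by
    have : ContDiff ℝ (⊤ : ℕ∞) (fderiv ℝ f) := ContDiff.fderiv_right hf.1 (by simp)
    exact this.continuous
  obtain ⟨C, hC⟩ := hfd.bounded_above_of_compact_support (hf.2.fderiv ℝ)
  have hR' : ∀ q : EE d, R < ‖q‖ → fderiv ℝ f q = 0 := by
    intro q hq
    have : f =ᶠ[nhds q] fun _ => 0 := by
      filter_upwards [(isOpen_lt continuous_const continuous_norm).mem_nhds hq] with z hz using hR z hz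
    rw [this.fderiv_eq]; simp
  have hC0 : 0 ≤ C := (norm_nonneg _).trans (hC 0)
  have hmem : MeasurableSet {q : EE d | ‖τ q‖ ≤ R + ‖p‖ + 1} := measurableSet_le h.1.norm measurable_const
  refine hasFDerivAt_integral_of_dominated_of_fderiv_le (s := Metric.ball p 1)
    (F' := fun x q => k q • fderiv ℝ f (x + τ q))
    (bound := fun q => ‖Set.indicator {q : EE d | ‖τ q‖ ≤ R + ‖p‖ + 1} k q‖ * C) (Metric.ball_mem_nhds _ one_pos) ?_ (h.int hf.CI p) ?_ ?_ ?_ ?_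
  · exact Filter.Eventually.of_forall fun x => (h.int hf.CI x).aestronglyMeasurable
  · exact h.2.1.smul (hfd.measurable.comp (measurable_const.add h.1)).aestronglyMeasurable
  · refine Filter.Eventually.of_forall fun q x hx => ?_
    by_cases hq : ‖τ q‖ ≤ R + ‖p‖ + 1
    · rw [Set.indicator_of_mem (by exact hq), norm_smul]
      exact mul_le_mul_of_nonneg_left (hC _) (norm_nonneg _)
    · have : R < ‖x + τ q‖ := by
        have h1 : ‖τ q‖ ≤ ‖x + τ q‖ + ‖x‖ := by
          calc ‖τ q‖ = ‖(x + τ q) - x‖ := by simp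
            _ ≤ _ := norm_sub_le _ _
        have h2 : ‖x‖ ≤ ‖p‖ + 1 := by
          have : ‖x - p‖ < 1 := by simpa [dist_eq_norm] using hx
          have := norm_sub_norm_le x p
          linarith
        linarith [not_le.1 hq]
      rw [hR' _ this]; simp; positivity
  · exact ((integrable_indicator_iff hmem).2 (h.2.2 (R + ‖p‖ + 1))).norm.mul_const C
  · refine Filter.Eventually.of_forall fun q x hx => ?_
    have h1 : HasFDerivAt (fun x => f (x + τ q)) (fderiv ℝ f (x + τ q)) x := by
      have := (hf.1.diff (x + τ q)).hasFDerivAt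
      have h9 := this.comp x ((hasFDerivAt_id x).add_const (τ q))
      rw [ContinuousLinearMap.comp_id] at h9
      exact h9
    exact h1.const_mul (k q)

theorem Tm_DD {k : EE d → ℝ} {τ : EE d → EE d} (h : Ker k τ) {f : EE d → ℝ} (hf : TF f) (i : Option (Fin d)) :
    DD i (Tm k τ f) = Tm k τ (DD i f) := by
  funext p
  unfold DD Tm
  have := (Tm_hasFDerivAt h hf p).fderiv
  unfold Tm at this
  rw [this]
  by_cases hi : Integrable fun q => k q • fderiv ℝ f (p + τ q)
  · rw [ContinuousLinearMap.integral_apply hi]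
    rfl
  · exfalso
    apply hi
    obtain ⟨R, hR⟩ := hf.CI.2
    have hfd : Continuous (fderiv ℝ f) := by
      have : ContDiff ℝ (⊤ : ℕ∞) (fderiv ℝ f) := ContDiff.fderiv_right hf.1 (by simp)
      exact this.continuous
    obtain ⟨C, hC⟩ := hfd.bounded_above_of_compact_support (hf.2.fderiv ℝ)
    have hR' : ∀ q : EE d, R < ‖q‖ → fderiv ℝ f q = 0 := by
      intro q hq
      have : f =ᶠ[nhds q] fun _ => 0 := by
        filter_upwards [(isOpen_lt continuous_const continuous_norm).mem_nhds hq] with z hz using hR z hz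
      rw [this.fderiv_eq]; simp
    have hC0 : 0 ≤ C := (norm_nonneg _).trans (hC 0)
    have hmem : MeasurableSet {q : EE d | ‖τ q‖ ≤ R + ‖p‖ + 1} := measurableSet_le h.1.norm measurable_const
    refine (((integrable_indicator_iff hmem).2 (h.2.2 (R + ‖p‖ + 1))).norm.mul_const C).mono'
      (h.2.1.smul (hfd.measurable.comp (measurable_const.add h.1)).aestronglyMeasurable) (Filter.Eventually.of_forall fun q => ?_)
    by_cases hq : ‖τ q‖ ≤ R + ‖p‖ + 1
    · rw [Set.indicator_of_mem (by exact hq), norm_smul]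
      exact mul_le_mul_of_nonneg_left (hC _) (norm_nonneg _)
    · have : R < ‖p + τ q‖ := by
        have h1 : ‖τ q‖ ≤ ‖p + τ q‖ + ‖p‖ := by
          calc ‖τ q‖ = ‖(p + τ q) - p‖ := by simp
            _ ≤ _ := norm_sub_le _ _
        linarith [not_le.1 hq]
      rw [hR' _ this]; simp; positivity

theorem Tm_Sm {k : EE d → ℝ} {τ : EE d → EE d} (h : Ker k τ) {f : EE d → ℝ} (hf : TF f) : Sm (Tm k τ f) := by
  refine sm_of (S := fun g => ∃ f, TF f ∧ g = Tm k τ f) ?_ ⟨f, hf, rfl⟩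
  rintro g ⟨f, hf, rfl⟩
  exact ⟨fun p => (Tm_hasFDerivAt h hf p).differentiableAt, fun i => ⟨DD i f, hf.DD i, Tm_DD h hf i⟩⟩

theorem Tm_DL {k : EE d → ℝ} {τ : EE d → EE d} (h : Ker k τ) {f : EE d → ℝ} (hf : TF f) (l : List (Option (Fin d))) :
    DL l (Tm k τ f) = Tm k τ (DL l f) := by
  induction l generalizing f with
  | nil => rfl
  | cons i l ih => simp only [DL]; rw [Tm_DD h hf, ih (hf.DD i)]

/-- commutation with the operator when the coefficients are invariant -/
theorem Tm_Lop {k : EE d → ℝ} {τ : EE d → EE d} (h : Ker k τ) {a : ℝ → Fin d → Fin d → ℝ} (i0 : Fin d)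
    (ha : ∀ p q : EE d, ∀ j k, a ((p + τ q).2 i0) j k = a (p.2 i0) j k) {f : EE d → ℝ} (hf : TF f) :
    Lop i0 a (Tm k τ f) = Tm k τ (Lop i0 a f) := by
  funext p
  unfold Lop
  simp only [Tm_DD h hf, Tm_DD h (hf.DD _)]
  unfold Tm
  simp only [ha, mul_add, Finset.mul_sum]
  have i1 : ∀ j k', Integrable fun q => k q * (a (p.2 i0) j k' * DD (some j) (DD (some k') f) (p + τ q)) := by
    intro j k'
    have := (h.int ((hf.DD (some k')).DD (some j)).CI p).const_mul (a (p.2 i0) j k')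
    refine this.congr (Filter.Eventually.of_forall fun q => ?_)
    simp only; ring
  rw [integral_add (h.int (hf.DD none).CI p) (integrable_finset_sum _ fun j _ => integrable_finset_sum _ fun k' _ => i1 j k'),
    integral_finset_sum _ (fun j _ => integrable_finset_sum _ fun k' _ => i1 j k')]
  congr 1
  refine Finset.sum_congr rfl fun j _ => ?_
  rw [integral_finset_sum _ (fun k' _ => i1 j k')]
  refine Finset.sum_congr rfl fun k' _ => ?_
  rw [← integral_const_mul]
  congr 1; funext q; ring

theorem cs_len {α : Type*} [MeasurableSpace α] {μ : Measure α} {Ψ G : α → ENNReal} (h1 : AEMeasurable Ψ μ) (h2 : AEMeasurable G μ) :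
    (∫⁻ q, Ψ q * G q ∂μ) ^ 2 ≤ (∫⁻ q, Ψ q ∂μ) * ∫⁻ q, Ψ q * G q ^ 2 ∂μ := by
  have h := ENNReal.lintegral_mul_le_Lp_mul_Lq μ (p := 2) (q := 2) (by constructor <;> norm_num)
    (f := fun q => Ψ q ^ (1/2:ℝ)) (g := fun q => Ψ q ^ (1/2:ℝ) * G q) (h1.pow_const _) ((h1.pow_const _).mul h2)
  have e0 : ∀ x : ENNReal, x ^ (1/2:ℝ) * x ^ (1/2:ℝ) = x := by
    intro x; rw [← ENNReal.rpow_add_of_nonneg _ _ (by norm_num) (by norm_num)]; norm_num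
  have e2 : ∀ x : ENNReal, (x ^ (1/2:ℝ)) ^ (2:ℝ) = x := by
    intro x; rw [← ENNReal.rpow_mul]; norm_num
  have e3 : ∀ q, ((fun q => Ψ q ^ (1/2:ℝ)) * fun q => Ψ q ^ (1/2:ℝ) * G q) q = Ψ q * G q := by
    intro q; simp only [Pi.mul_apply]; rw [← mul_assoc, e0]
  simp only [e3, e2, ENNReal.mul_rpow_of_nonneg _ _ (by norm_num : (0:ℝ) ≤ 2)] at h
  calc _ ≤ ((∫⁻ q, Ψ q ∂μ) ^ (1/2:ℝ) * (∫⁻ q, Ψ q * G q ^ (2:ℝ) ∂μ) ^ (1/2:ℝ)) ^ 2 := by gcongr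
    _ = _ := by
      rw [mul_pow]
      simp only [pow_two, e0]
      congr 1
      refine lintegral_congr fun q => ?_
      rw [show (2:ℝ) = ((2:ℕ):ℝ) by norm_num, ENNReal.rpow_natCast, pow_two]

theorem young_len {Ψ F : EE d → ℝ} {τ : EE d → EE d} (hΨ : Measurable Ψ) (hτ : Measurable τ) (hF : Measurable F) :
    ∫⁻ p, ‖Tm Ψ τ F p‖ₑ ^ 2 ≤ (∫⁻ q, ‖Ψ q‖ₑ) ^ 2 * ∫⁻ p, ‖F p‖ₑ ^ 2 := by
  have h1 : ∀ p, ‖Tm Ψ τ F p‖ₑ ^ 2 ≤ (∫⁻ q, ‖Ψ q‖ₑ) * ∫⁻ q, ‖Ψ q‖ₑ * ‖F (p + τ q)‖ₑ ^ 2 := by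
    intro p
    refine le_trans ?_ (cs_len hΨ.enorm.aemeasurable (hF.comp (measurable_const.add hτ)).enorm.aemeasurable)
    gcongr
    refine (enorm_integral_le_lintegral_enorm _).trans (le_of_eq ?_)
    simp only [enorm_mul]
  have hm : Measurable fun z : EE d × EE d => ‖Ψ z.2‖ₑ * ‖F (z.1 + τ z.2)‖ₑ ^ 2 :=
    (hΨ.comp measurable_snd).enorm.mul ((hF.comp (measurable_fst.add (hτ.comp measurable_snd))).enorm.pow_const 2)
  refine (lintegral_mono h1).trans (le_of_eq ?_)
  rw [lintegral_const_mul _ hm.lintegral_prod_right', lintegral_lintegral_swap hm.aemeasurable]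
  have e : ∀ q, ∫⁻ p, ‖Ψ q‖ₑ * ‖F (p + τ q)‖ₑ ^ 2 = ‖Ψ q‖ₑ * ∫⁻ p, ‖F p‖ₑ ^ 2 := by
    intro q
    have hm2 : Measurable fun p => ‖F (p + τ q)‖ₑ ^ 2 := (hF.comp (measurable_id.add_const _)).enorm.pow_const 2
    rw [lintegral_const_mul _ hm2,
      lintegral_add_right_eq_self (fun p => ‖F p‖ₑ ^ 2) (τ q)]
  simp only [e]
  rw [lintegral_mul_const _ hΨ.enorm, pow_two, mul_assoc]

end TmS
end P11

section P12
section Dens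
open MeasureTheory

variable {d : ℕ}

theorem tf_add {u v : EE d → ℝ} (h : TF u) (h2 : TF v) : TF (fun p => u p + v p) := ⟨h.1.add h2.1, h.2.add h2.2⟩
theorem tf_sub {u v : EE d → ℝ} (h : TF u) (h2 : TF v) : TF (fun p => u p - v p) := by
  refine ⟨h.1.sub h2.1, ?_⟩
  have h3 : HasCompactSupport fun p => - v p := h2.2.comp_left (g := fun y : ℝ => -y) (by simp)
  have h4 := h.2.add h3
  have e : (fun p => u p - v p) = u + fun p => - v p := by funext p; simp [sub_eq_add_neg]
  rw [e]; exact h4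
theorem int2 {X : Type*} [MeasurableSpace X] {μ : Measure X} {f g k : X → ℝ} (hf : Integrable f μ) (hg : Integrable g μ) (hk : Integrable k μ) (α β : ℝ)
    (h : ∀ p, f p ≤ α * g p + β * k p) : ∫ p, f p ∂μ ≤ α * ∫ p, g p ∂μ + β * ∫ p, k p ∂μ := by
  rw [← integral_const_mul, ← integral_const_mul, ← integral_add (hg.const_mul _) (hk.const_mul _)]
  exact integral_mono hf ((hg.const_mul _).add (hk.const_mul _)) h
theorem tf_zero : TF (fun _ : EE d => (0:ℝ)) := ⟨contDiff_const, HasCompactSupport.zero⟩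

theorem Lop_add (i0 : Fin d) (a : ℝ → Fin d → Fin d → ℝ) {u v : EE d → ℝ} (h : Sm u) (h2 : Sm v) :
    Lop i0 a (fun p => u p + v p) = fun p => Lop i0 a u p + Lop i0 a v p := by
  funext p
  simp only [Lop, DD_add h h2, DD_add (h.DD _) (h2.DD _), mul_add, Finset.sum_add_distrib]
  ring

theorem Lop_sub (i0 : Fin d) (a : ℝ → Fin d → Fin d → ℝ) {u v : EE d → ℝ} (h : Sm u) (h2 : Sm v) :
    Lop i0 a (fun p => u p - v p) = fun p => Lop i0 a u p - Lop i0 a v p := by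
  funext p
  simp only [Lop, DD_sub h h2, DD_sub (h.DD _) (h2.DD _), mul_sub, Finset.sum_sub_distrib]
  ring

theorem Lop_zero (i0 : Fin d) (a : ℝ → Fin d → Fin d → ℝ) (p : EE d) : Lop i0 a (fun _ => (0:ℝ)) p = 0 := by
  apply Lop_off
  rw [show (fun _ : EE d => (0:ℝ)) = 0 from rfl]; simp [tsupport]

def Dns (i0 : Fin d) (a : ℝ → Fin d → Fin d → ℝ) : Prop :=
  ∀ F : EE d → ℝ, CI F → ∀ ε > 0, ∃ φ, TF φ ∧ ∫ p, (Lop i0 a φ p - F p) ^ 2 ≤ ε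

theorem step {δ : ℝ} (hδ : 0 < δ) {C : ℝ} (hC : 0 < C)
    (hA : ∀ (a : ℝ → Fin d → Fin d → ℝ) (_ : Ell δ a) (i0 : Fin d) (φ : EE d → ℝ) (_ : TF φ),
    ∫ p, (DD none φ p ^ 2 + ∑ j, ∑ k, DD (some j) (DD (some k) φ) p ^ 2) ≤
      C * ∫ p, Lop i0 a φ p ^ 2) (i0 : Fin d) {a a' : ℝ → Fin d → Fin d → ℝ} (h : Ell δ a) (h' : Ell δ a')
    {η : ℝ} (h0 : 0 ≤ η) (hd : ∀ s j k, |a' s j k - a s j k| ≤ η) (hη : η ^ 2 * (d:ℝ) ^ 2 * C ≤ 1/16)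
    (hD : Dns i0 a) {F : EE d → ℝ} (hF : CI F) : ∃ φ, TF φ ∧ ∫ p, (Lop i0 a' φ p - F p) ^ 2 ≤ (∫ p, F p ^ 2) / 2 := by
  set A := ∫ p, F p ^ 2 with hAd
  have A0 : 0 ≤ A := integral_nonneg fun p => sq_nonneg _
  rcases A0.eq_or_lt with hz | hpos
  · refine ⟨fun _ => 0, tf_zero, ?_⟩
    simp only [Lop_zero]
    simp only [zero_sub, neg_sq]
    rw [← hAd]; linarith
  obtain ⟨φ, hφ, hb⟩ := hD F hF (A/12) (by positivity)
  refine ⟨φ, hφ, ?_⟩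
  have c1 := Lop_CI hδ h i0 hφ
  have c2 := Lop_CI hδ h' i0 hφ
  have hH : CI (HX φ) := CI.sum _ fun j _ => CI.sum _ fun k _ => ((hφ.DD _).DD _).CI.sq
  have e1 : ∀ p, (Lop i0 a' φ p - F p) ^ 2 ≤ 2 * (Lop i0 a φ p - F p) ^ 2 + 2 * (d ^ 2 * η ^ 2) * HX φ p := by
    intro p
    have : (Lop i0 a' φ p - Lop i0 a φ p) ^ 2 ≤ d ^ 2 * η ^ 2 * HX φ p := by
      have e : Lop i0 a' φ p - Lop i0 a φ p = ∑ j, ∑ k, (a' (p.2 i0) j k - a (p.2 i0) j k) * DD (some j) (DD (some k) φ) p := by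
        simp only [Lop, sub_mul, Finset.sum_sub_distrib]; ring
      rw [e]
      refine (sq_sum_sum_le _).trans ?_
      rw [mul_assoc]
      refine mul_le_mul_of_nonneg_left ?_ (by positivity)
      rw [HX, Finset.mul_sum]
      refine Finset.sum_le_sum fun j _ => ?_
      rw [Finset.mul_sum]
      refine Finset.sum_le_sum fun k _ => ?_
      rw [mul_pow]
      exact mul_le_mul_of_nonneg_right (sq_le_sq.2 (by rw [abs_of_nonneg h0]; exact hd _ _ _)) (sq_nonneg _)
    nlinarith [sq_nonneg ((Lop i0 a φ p - F p) - (Lop i0 a' φ p - Lop i0 a φ p))]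
  have e2 : ∀ p, Lop i0 a φ p ^ 2 ≤ 2 * (Lop i0 a φ p - F p) ^ 2 + 2 * F p ^ 2 := by
    intro p; nlinarith [sq_nonneg ((Lop i0 a φ p - F p) - F p)]
  have i1 := int2 (c2.sub hF).sq.int (c1.sub hF).sq.int hH.int _ _ e1
  have i2 := int2 c1.sq.int (c1.sub hF).sq.int hF.sq.int _ _ e2
  have i3 : ∫ p, HX φ p ≤ C * ∫ p, Lop i0 a φ p ^ 2 := by
    refine le_trans (integral_mono hH.int ((hφ.DD none).CI.sq.add hH).int fun p => ?_) (hA a h i0 φ hφ)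
    simp only [HX]; linarith [sq_nonneg (DD none φ p)]
  set L := ∫ p, Lop i0 a φ p ^ 2
  have L0 : 0 ≤ L := integral_nonneg fun p => sq_nonneg _
  have i4 : 2 * (d ^ 2 * η ^ 2) * ∫ p, HX φ p ≤ 2 * (1/16) * L := by
    calc 2 * (d ^ 2 * η ^ 2) * ∫ p, HX φ p ≤ 2 * (d ^ 2 * η ^ 2) * (C * L) := mul_le_mul_of_nonneg_left i3 (by positivity)
      _ = 2 * (η ^ 2 * (d:ℝ) ^ 2 * C) * L := by ring
      _ ≤ _ := by gcongr
  rw [← hAd] at i2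
  linarith

theorem transfer {δ : ℝ} (hδ : 0 < δ) {C : ℝ} (hC : 0 < C)
    (hA : ∀ (a : ℝ → Fin d → Fin d → ℝ) (_ : Ell δ a) (i0 : Fin d) (φ : EE d → ℝ) (_ : TF φ),
    ∫ p, (DD none φ p ^ 2 + ∑ j, ∑ k, DD (some j) (DD (some k) φ) p ^ 2) ≤
      C * ∫ p, Lop i0 a φ p ^ 2) (i0 : Fin d) {a a' : ℝ → Fin d → Fin d → ℝ} (h : Ell δ a) (h' : Ell δ a')
    {η : ℝ} (h0 : 0 ≤ η) (hd : ∀ s j k, |a' s j k - a s j k| ≤ η) (hη : η ^ 2 * (d:ℝ) ^ 2 * C ≤ 1/16)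
    (hD : Dns i0 a) : Dns i0 a' := by
  intro F hF ε hε
  have key : ∀ n : ℕ, ∃ φ, TF φ ∧ ∫ p, (Lop i0 a' φ p - F p) ^ 2 ≤ (∫ p, F p ^ 2) * (1/2) ^ n := by
    intro n
    induction n with
    | zero =>
      refine ⟨fun _ => 0, tf_zero, ?_⟩
      simp [Lop_zero]
    | succ n ih =>
      obtain ⟨φ, hφ, hb⟩ := ih
      obtain ⟨φ1, hφ1, hb1⟩ := step hδ hC hA i0 h h' h0 hd hη hD (hF.sub (Lop_CI hδ h' i0 hφ))
      refine ⟨fun p => φ p + φ1 p, tf_add hφ hφ1, ?_⟩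
      rw [Lop_add i0 a' hφ.1 hφ1.1]
      have e1 : ∀ p, (Lop i0 a' φ p + Lop i0 a' φ1 p - F p) ^ 2 = (Lop i0 a' φ1 p - (F p - Lop i0 a' φ p)) ^ 2 := by intro p; ring
      have e2 : ∀ p, (F p - Lop i0 a' φ p) ^ 2 = (Lop i0 a' φ p - F p) ^ 2 := by intro p; ring
      simp only [e1]
      simp only [e2] at hb1
      rw [pow_succ]
      linarith
  obtain ⟨n, hn⟩ := ((tendsto_pow_atTop_nhds_zero_of_lt_one (by norm_num : (0:ℝ) ≤ 1/2) (by norm_num)).const_mul (∫ p, F p ^ 2)).eventually_lt_const (by simpa using hε) |>.exists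
  obtain ⟨φ, hφ, hb⟩ := key n
  exact ⟨φ, hφ, hb.trans hn.le⟩

def Idm : ℝ → Fin d → Fin d → ℝ := fun _ j k => if j = k then 1 else 0

theorem Idm_quad (s : ℝ) (θ : Fin d → ℝ) : ∑ j, ∑ k, Idm s j k * θ j * θ k = ∑ j, θ j ^ 2 := by
  simp [Idm, pow_two]

theorem mix_ell {δ : ℝ} (hδ : δ ∈ Set.Ioo (0:ℝ) 1) {a : ℝ → Fin d → Fin d → ℝ} (h : Ell δ a) {s : ℝ} (h0 : 0 ≤ s) (h1 : s ≤ 1) :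
    Ell δ (fun y j k => (1 - s) * Idm y j k + s * a y j k) := by
  have e : ∀ y (θ : Fin d → ℝ), ∑ j, ∑ k, ((1 - s) * Idm y j k + s * a y j k) * θ j * θ k =
      (1 - s) * ∑ j, θ j ^ 2 + s * ∑ j, ∑ k, a y j k * θ j * θ k := by
    intro y θ
    rw [← Idm_quad y θ]
    simp only [Finset.mul_sum, ← Finset.sum_add_distrib]
    refine Finset.sum_congr rfl fun j _ => Finset.sum_congr rfl fun k _ => by ring
  have hi : 1 ≤ δ⁻¹ := (one_le_inv₀ hδ.1).2 hδ.2.le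
  refine ⟨fun j k => ?_, fun y j k => ?_, fun y θ => ?_, fun y θ => ?_⟩
  · exact (measurable_const.mul measurable_const).add (measurable_const.mul (h.meas j k))
  · simp only [h.symm y j k, Idm, eq_comm]
  · rw [e]
    have := h.low y θ
    have hq : 0 ≤ ∑ j, θ j ^ 2 := Finset.sum_nonneg fun _ _ => sq_nonneg _
    have h3 : s * (δ * ∑ j, θ j ^ 2) ≤ s * ∑ j, ∑ k, a y j k * θ j * θ k := mul_le_mul_of_nonneg_left this h0
    have h4 : (1 - s) * (δ * ∑ j, θ j ^ 2) ≤ (1 - s) * ∑ j, θ j ^ 2 := mul_le_mul_of_nonneg_left (by nlinarith [hδ.2]) (by linarith)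
    linarith
  · rw [e]
    have := h.up y θ
    have hq : 0 ≤ ∑ j, θ j ^ 2 := Finset.sum_nonneg fun _ _ => sq_nonneg _
    have h3 : s * ∑ j, ∑ k, a y j k * θ j * θ k ≤ s * (δ⁻¹ * ∑ j, θ j ^ 2) := mul_le_mul_of_nonneg_left this h0
    have h4 : (1 - s) * ∑ j, θ j ^ 2 ≤ (1 - s) * (δ⁻¹ * ∑ j, θ j ^ 2) := mul_le_mul_of_nonneg_left (by nlinarith [hδ.2]) (by linarith)
    linarith

theorem dns_of_base {δ : ℝ} (hδ : δ ∈ Set.Ioo (0:ℝ) 1) (i0 : Fin d) (hB : Dns i0 (Idm (d := d))) {a : ℝ → Fin d → Fin d → ℝ} (h : Ell δ a) :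
    Dns i0 a := by
  obtain ⟨C, hC, hA⟩ := apriori_full d hδ.1
  set B := 1 + δ⁻¹ with hBd
  have hi : 0 < δ⁻¹ := inv_pos.2 hδ.1
  have B0 : 0 < B := by positivity
  obtain ⟨n, hn⟩ := exists_nat_gt (16 * B ^ 2 * d ^ 2 * C + 1)
  have n1 : (1:ℝ) < n := by
    have : 0 ≤ 16 * B ^ 2 * d ^ 2 * C := by positivity
    linarith
  have n0 : (0:ℝ) < n := by linarith
  have key : ∀ m : ℕ, m ≤ n → Dns i0 (fun y j k => (1 - (m:ℝ)/n) * Idm y j k + (m:ℝ)/n * a y j k) := by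
    intro m
    induction m with
    | zero => intro _; simpa using hB
    | succ m ih =>
      intro hm
      have hm' : ((m + 1 : ℕ) : ℝ) ≤ n := by exact_mod_cast hm
      refine transfer hδ.1 hC hA i0 (mix_ell hδ h (s := (m:ℝ)/n) (by positivity) ?_) (mix_ell hδ h (by positivity) ?_) (η := B / n) (by positivity) ?_ ?_ (ih (by omega))
      · rw [div_le_one n0]; push_cast at hm'; linarith
      · rw [div_le_one n0]; exact hm'
      · intro s j k
        have e : (1 - ((m + 1 : ℕ) : ℝ) / n) * Idm s j k + ((m + 1 : ℕ) : ℝ) / n * a s j k - ((1 - (m:ℝ)/n) * Idm s j k + (m:ℝ)/n * a s j k) = (a s j k - Idm s j k) / n := by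
          push_cast; field_simp; ring
        rw [e, abs_div, abs_of_pos n0]
        gcongr
        refine (abs_sub _ _).trans ?_
        have h1 := h.abs_le hδ.1 s j k
        have h2 : |Idm s j k| ≤ 1 := by unfold Idm; split_ifs <;> simp
        linarith
      · rw [div_pow, div_mul_eq_mul_div, div_mul_eq_mul_div, div_le_iff₀ (by positivity)]
        nlinarith
  have := key n le_rfl
  simpa [div_self n0.ne'] using this

end Dens
end P12

section P13
section Base
open MeasureTheory

variable {d : ℕ}

theorem DD_affine (A : EE d →L[ℝ] EE d) (p : EE d) (i : Option (Fin d)) {c : ℝ} (hA : A (ev i) = c • ev i) {ρ : EE d → ℝ} (hρ : Sm ρ) :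
    DD i (fun q => ρ (p + A q)) = fun q => c * DD i ρ (p + A q) := by
  funext q
  have h1 : HasFDerivAt (fun q => p + A q) A q := by
    have := (A.hasFDerivAt (x := q)).const_add p
    exact this
  have h2 := (hρ.diff (p + A q)).hasFDerivAt.comp q h1
  have h3 : fderiv ℝ (fun q => ρ (p + A q)) q = (fderiv ℝ ρ (p + A q)).comp A := h2.fderiv
  simp only [DD]
  rw [h3, ContinuousLinearMap.comp_apply, hA, map_smul, smul_eq_mul]

theorem DD_cmul (c : ℝ) {ρ : EE d → ℝ} (hρ : Sm ρ) (i : Option (Fin d)) :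
    DD i (fun q => c * ρ q) = fun q => c * DD i ρ q := by
  funext q
  simp only [DD]
  rw [fderiv_const_mul (hρ.diff q)]; rfl

theorem Sm.cmul (c : ℝ) {ρ : EE d → ℝ} (hρ : Sm ρ) : Sm (fun q => c * ρ q) := contDiff_const.mul hρ
theorem TF.cmul (c : ℝ) {ρ : EE d → ℝ} (hρ : TF ρ) : TF (fun q => c * ρ q) := ⟨hρ.1.cmul c, hρ.2.mul_left⟩
theorem Sm.aff (A : EE d →L[ℝ] EE d) (p : EE d) {ρ : EE d → ℝ} (hρ : Sm ρ) : Sm (fun q => ρ (p + A q)) :=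
  ContDiff.comp hρ (contDiff_const.add A.contDiff)

theorem Lop_cmul (i0 : Fin d) (a : ℝ → Fin d → Fin d → ℝ) (c : ℝ) {u : EE d → ℝ} (h : Sm u) :
    Lop i0 a (fun p => c * u p) = fun p => c * Lop i0 a u p := by
  funext p
  simp only [Lop, DD_cmul c h, DD_cmul c (h.DD _), mul_add, Finset.mul_sum]
  congr 1
  refine Finset.sum_congr rfl fun j _ => Finset.sum_congr rfl fun k _ => by ring

/-- reflection -/
noncomputable def tau : EE d →L[ℝ] EE d :=
  (ContinuousLinearMap.fst ℝ ℝ (Fin d → ℝ)).prod (-(ContinuousLinearMap.snd ℝ ℝ (Fin d → ℝ)))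

theorem tau_apply (q : EE d) : tau q = (q.1, -q.2) := rfl
theorem tau_tau (q : EE d) : tau (tau q) = q := by simp [tau_apply]
theorem tau_norm (q : EE d) : ‖tau q‖ = ‖q‖ := by simp [tau_apply, Prod.norm_def]
theorem tau_mp : MeasurePreserving (fun q : EE d => tau q) volume volume :=
  (MeasurePreserving.id volume).prod (Measure.measurePreserving_neg volume)
theorem tau_none : tau (ev (d := d) none) = (1:ℝ) • ev none := by simp [tau_apply, ev]
theorem tau_some (j : Fin d) : tau (ev (some j)) = (-1:ℝ) • ev (some j) := by simp [tau_apply, ev]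

theorem TF.tau (p : EE d) {ρ : EE d → ℝ} (hρ : TF ρ) : TF (fun q => ρ (p + tau q)) := by
  refine ⟨hρ.1.aff _ p, ?_⟩
  obtain ⟨R, hR⟩ := hρ.CI.2
  refine HasCompactSupport.of_support_subset_isCompact (isCompact_closedBall (0 : EE d) (R + ‖p‖)) fun q hq => ?_
  by_contra hn
  simp only [Metric.mem_closedBall, dist_zero_right, not_le] at hn
  apply hq
  apply hR
  have h1 : ‖_root_.tau q‖ ≤ ‖p + _root_.tau q‖ + ‖p‖ := by
    calc ‖_root_.tau q‖ = ‖(p + _root_.tau q) - p‖ := by simp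
      _ ≤ _ := norm_sub_le _ _
  rw [tau_norm] at h1
  linarith

theorem Lop_tau (i0 : Fin d) (p : EE d) {ρ : EE d → ℝ} (hρ : TF ρ) (q : EE d) :
    Lop i0 Idm (fun q => ρ (p + tau q)) q = Lop i0 Idm ρ (p + tau q) := by
  simp only [Lop, DD_affine tau p none tau_none hρ.1, DD_affine tau p (some _) (tau_some _) hρ.1]
  have e : ∀ j k : Fin d, DD (some j) (fun q => -1 * DD (some k) ρ (p + tau q)) q = DD (some j) (DD (some k) ρ) (p + tau q) := by
    intro j k
    rw [DD_cmul (-1) ((hρ.DD _).1.aff tau p), DD_affine tau p (some j) (tau_some j) (hρ.DD _).1]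
    ring
  simp only [e]
  simp [Idm]

theorem tau_ker {y : EE d → ℝ} (hy : Measurable y) (h2 : MemLp y 2 volume) : Ker y (fun q => tau q) := by
  refine ⟨tau.continuous.measurable, hy.aestronglyMeasurable, fun R => ?_⟩
  have := (h2.locallyIntegrable (by norm_num)).integrableOn_isCompact (isCompact_closedBall (0 : EE d) R)
  refine this.mono_set fun q hq => ?_
  simpa [tau_norm] using hq

theorem tau_young {y ρ : EE d → ℝ} (hy : Measurable y) (hρ : Measurable ρ) :
    ∫⁻ p, ‖Tm y (fun q => tau q) ρ p‖ₑ ^ 2 ≤ (∫⁻ q, ‖ρ q‖ₑ) ^ 2 * ∫⁻ p, ‖y p‖ₑ ^ 2 := by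
  have htm : Measurable fun q : EE d => tau q := tau.continuous.measurable
  have c1 : ∀ p, ∫⁻ q, ‖ρ (p + tau q)‖ₑ = ∫⁻ q, ‖ρ q‖ₑ := by
    intro p
    have hm : Measurable fun z => ‖ρ (p + z)‖ₑ := (hρ.comp (measurable_const.add measurable_id)).enorm
    rw [tau_mp.lintegral_comp hm, lintegral_add_left_eq_self (fun z => ‖ρ z‖ₑ) p]
  have h1 : ∀ p, ‖Tm y (fun q => tau q) ρ p‖ₑ ^ 2 ≤ (∫⁻ q, ‖ρ q‖ₑ) * ∫⁻ q, ‖ρ (p + tau q)‖ₑ * ‖y q‖ₑ ^ 2 := by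
    intro p
    rw [← c1 p]
    refine le_trans ?_ (cs_len (hρ.comp (measurable_const.add htm)).enorm.aemeasurable hy.enorm.aemeasurable)
    gcongr
    refine (enorm_integral_le_lintegral_enorm _).trans (le_of_eq ?_)
    simp only [enorm_mul, mul_comm]
  have hm : Measurable fun z : EE d × EE d => ‖ρ (z.1 + tau z.2)‖ₑ * ‖y z.2‖ₑ ^ 2 :=
    (hρ.comp (measurable_fst.add (htm.comp measurable_snd))).enorm.mul ((hy.comp measurable_snd).enorm.pow_const 2)
  refine (lintegral_mono h1).trans (le_of_eq ?_)
  rw [lintegral_const_mul _ hm.lintegral_prod_right', lintegral_lintegral_swap hm.aemeasurable]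
  have e : ∀ q, ∫⁻ p, ‖ρ (p + tau q)‖ₑ * ‖y q‖ₑ ^ 2 = (∫⁻ p, ‖ρ p‖ₑ) * ‖y q‖ₑ ^ 2 := by
    intro q
    have hm2 : Measurable fun p => ‖ρ (p + tau q)‖ₑ := (hρ.comp (measurable_id.add_const _)).enorm
    rw [lintegral_mul_const _ hm2, lintegral_add_right_eq_self (fun p => ‖ρ p‖ₑ) (tau q)]
  simp only [e]
  rw [lintegral_const_mul _ (hy.enorm.pow_const 2), pow_two, mul_assoc]

theorem tau_sq {y ρ : EE d → ℝ} (hy : Measurable y) (h2 : MemLp y 2 volume) (hρ : TF ρ) :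
    Integrable fun p => Tm y (fun q => tau q) ρ p ^ 2 := by
  have hc : Continuous (Tm y (fun q => tau q) ρ) := (Tm_Sm (tau_ker hy h2) hρ).cont
  refine ⟨(hc.pow 2).aestronglyMeasurable, ?_⟩
  unfold HasFiniteIntegral
  have h3 : ∫⁻ p, ‖y p‖ₑ ^ 2 < ⊤ := by
    have := h2.2
    rw [eLpNorm_lt_top_iff_lintegral_rpow_enorm_lt_top (by norm_num) (by norm_num)] at this
    simpa using this
  have h4 : ∫⁻ q, ‖ρ q‖ₑ < ⊤ := hρ.CI.int.2
  refine lt_of_le_of_lt ?_ (lt_of_le_of_lt (tau_young hy hρ.1.cont.measurable) (ENNReal.mul_lt_top (ENNReal.pow_lt_top h4) h3))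
  simp only [enorm_pow]
  exact le_rfl

end Base
end P13

section P14
section Liou
open MeasureTheory

variable {d : ℕ}

theorem Idm_ell : Ell (d := d) 1 Idm := by
  refine ⟨fun j k => measurable_const, fun s j k => by simp [Idm, eq_comm], fun s θ => ?_, fun s θ => ?_⟩ <;> rw [Idm_quad] <;> simp

theorem chi_exists (d : ℕ) : ∃ A : ℝ, 0 < A ∧ ∀ n : ℕ, 1 ≤ n → ∃ χ : EE d → ℝ, TF χ ∧ (∀ p, ‖p‖ < n → χ p = 1) ∧
    (∀ i p, |DD i χ p| ≤ A / n) ∧ ∀ i j p, |DD i (DD j χ) p| ≤ A / n := by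
  let f : ContDiffBump (0 : EE d) := ⟨1, 2, by norm_num, by norm_num⟩
  have hf : TF (fun p => f p) := ⟨f.contDiff, f.hasCompactSupport⟩
  obtain ⟨A, hA, -, h1, h2⟩ := tf_bd2 hf
  refine ⟨A, hA, fun n hn => ?_⟩
  have n1 : (1:ℝ) ≤ n := by exact_mod_cast hn
  have n0 : (0:ℝ) < n := by linarith
  set M : EE d →L[ℝ] EE d := ((n:ℝ)⁻¹) • ContinuousLinearMap.id ℝ (EE d) with hM
  have hMa : ∀ q, M q = (n:ℝ)⁻¹ • q := fun q => rfl
  have e1 : ∀ i, DD i (fun q => f (0 + M q)) = fun q => (n:ℝ)⁻¹ * DD i (fun p => f p) (0 + M q) := fun i => DD_affine M 0 i (hMa _) hf.1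
  refine ⟨fun q => f (0 + M q), ⟨hf.1.aff M 0, ?_⟩, ?_, ?_, ?_⟩
  · obtain ⟨R, hR⟩ := hf.CI.2
    refine HasCompactSupport.of_support_subset_isCompact (isCompact_closedBall (0 : EE d) (n * R)) fun q hq => ?_
    by_contra hn
    simp only [Metric.mem_closedBall, dist_zero_right, not_le] at hn
    apply hq
    apply hR
    rw [zero_add, hMa, norm_smul, Real.norm_of_nonneg (by positivity), inv_mul_eq_div, lt_div_iff₀ n0]
    linarith
  · intro p hp
    apply f.one_of_mem_closedBall
    simp only [Metric.mem_closedBall, dist_zero_right, zero_add]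
    rw [hMa, norm_smul, Real.norm_of_nonneg (by positivity), inv_mul_eq_div, div_le_one n0]
    exact hp.le
  · intro i p
    rw [e1]
    simp only [abs_mul]
    rw [abs_of_pos (by positivity), inv_mul_eq_div]
    gcongr
    exact h1 _ _
  · intro i j p
    rw [e1, DD_cmul _ ((hf.DD j).1.aff M 0), DD_affine M 0 i (hMa _) (hf.DD j).1]
    simp only [abs_mul]
    rw [abs_of_pos (by positivity), inv_mul_eq_div]
    gcongr
    have hi : (n:ℝ)⁻¹ ≤ 1 := inv_le_one_of_one_le₀ n1
    calc _ ≤ 1 * A := mul_le_mul hi (h2 _ _ _) (abs_nonneg _) (by norm_num)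
      _ = A := one_mul _

theorem liou_t (i0 : Fin d) {Y : EE d → ℝ} (hY : Sm Y) (hL : ∀ p, Lop i0 Idm Y p = 0) (h0 : Integrable fun p => Y p ^ 2)
    (h1 : ∀ j : Fin d, Integrable fun p => DD (some j) Y p ^ 2) (p : EE d) : DD none Y p = 0 := by
  obtain ⟨A, hA, hχ⟩ := chi_exists d
  obtain ⟨C, hC, hap⟩ := apriori_full d one_pos
  have hS : Integrable fun p => ∑ k, DD (some k) Y p ^ 2 := integrable_finset_sum _ fun k _ => h1 k
  set B1 := 2 * (A + d ^ 2 * (1:ℝ)⁻¹ * A) ^ 2 with hB1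
  set B2 := 8 * (d ^ 3 * ((1:ℝ)⁻¹) ^ 2 * A ^ 2) with hB2
  set M := B1 * (∫ p, Y p ^ 2) + B2 * ∫ p, ∑ k, DD (some k) Y p ^ 2 with hM
  have key : ∀ n : ℕ, 1 ≤ n → ∀ K : ℝ, K ≤ n → ∫ p in Metric.ball (0:EE d) K, DD none Y p ^ 2 ≤ C * M * (1 / (n:ℝ) ^ 2) := by
    intro n hn K hK
    have n1 : (1:ℝ) ≤ n := by exact_mod_cast hn
    have n0 : (0:ℝ) < n := by linarith
    obtain ⟨χ, ht, c1, cd, cdd⟩ := hχ n hn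
    have hT : TF fun q => χ q * Y q := ht.mul hY
    have b : ∀ p, Lop i0 Idm (fun q => χ q * Y q) p ^ 2 ≤ (B1 * (1/(n:ℝ)^2)) * Y p ^ 2 + (B2 * (1/(n:ℝ)^2)) * ∑ k, DD (some k) Y p ^ 2 := by
      intro p
      rw [Lop_mul Idm_ell.symm i0 ht.1 hY, hL]
      have q1 := bd_sq one_pos Idm_ell (p.2 i0) (x := fun j => DD (some j) χ p) (y := fun j => DD (some j) Y p) (fun j => cd _ p)
      have q2 : |Lop i0 Idm χ p| ≤ (A + d ^ 2 * (1:ℝ)⁻¹ * A) / n := by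
        have := bd_sum one_pos Idm_ell (p.2 i0) (x := fun j k => DD (some j) (DD (some k) χ) p) (fun j k => cdd _ _ p)
        rw [add_div, mul_div_assoc]
        exact (abs_add_le _ _).trans (add_le_add (cd _ _) this)
      have q3 : Lop i0 Idm χ p ^ 2 ≤ (A + d ^ 2 * (1:ℝ)⁻¹ * A) ^ 2 / (n:ℝ) ^ 2 := by
        rw [← div_pow]; exact sq_le_sq.2 (q2.trans (le_abs_self _))
      set X := ∑ j, ∑ k, Idm (p.2 i0) j k * (DD (some j) χ p * DD (some k) Y p)
      set S := ∑ k, DD (some k) Y p ^ 2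
      rw [div_pow] at q1
      have q4 := mul_le_mul_of_nonneg_right q3 (sq_nonneg (Y p))
      calc _ ≤ 2 * (Lop i0 Idm χ p ^ 2 * Y p ^ 2) + 8 * X ^ 2 := by nlinarith [sq_nonneg (Y p * Lop i0 Idm χ p - 2 * X)]
        _ ≤ 2 * ((A + d ^ 2 * (1:ℝ)⁻¹ * A) ^ 2 / (n:ℝ) ^ 2 * Y p ^ 2) + 8 * (d ^ 3 * ((1:ℝ)⁻¹) ^ 2 * (A ^ 2 / (n:ℝ) ^ 2) * S) := by linarith
        _ = _ := by rw [hB1, hB2]; ring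
    have b2 := int2 (Lop_CI one_pos Idm_ell i0 hT).sq.int h0 hS _ _ b
    have b3 := hap Idm Idm_ell i0 _ hT
    have hc : CI (fun p => DD none (fun q => χ q * Y q) p ^ 2 + ∑ j, ∑ k, DD (some j) (DD (some k) (fun q => χ q * Y q)) p ^ 2) :=
      (hT.DD none).CI.sq.add (CI.sum _ fun j _ => CI.sum _ fun k _ => ((hT.DD _).DD _).CI.sq)
    calc ∫ p in Metric.ball (0:EE d) K, DD none Y p ^ 2 = ∫ p in Metric.ball (0:EE d) K, DD none (fun q => χ q * Y q) p ^ 2 := by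
          refine setIntegral_congr_fun measurableSet_ball fun p hp => ?_
          have hp' : ‖p‖ < n := by
            have : ‖p‖ < K := by simpa using hp
            linarith
          have : Y =ᶠ[nhds p] fun q => χ q * Y q := by
            filter_upwards [(isOpen_lt continuous_norm continuous_const).mem_nhds hp'] with z hz
            rw [c1 z hz, one_mul]
          simp only [(DD_congr this none).eq_of_nhds]
      _ ≤ ∫ p, DD none (fun q => χ q * Y q) p ^ 2 := setIntegral_le_integral (hT.DD none).CI.sq.int (Filter.Eventually.of_forall fun p => sq_nonneg _)
      _ ≤ ∫ p, (DD none (fun q => χ q * Y q) p ^ 2 + ∑ j, ∑ k, DD (some j) (DD (some k) (fun q => χ q * Y q)) p ^ 2) := by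
          refine integral_mono (hT.DD none).CI.sq.int hc.int fun p => ?_
          have : 0 ≤ ∑ j, ∑ k, DD (some j) (DD (some k) (fun q => χ q * Y q)) p ^ 2 :=
            Finset.sum_nonneg fun j _ => Finset.sum_nonneg fun k _ => sq_nonneg _
          simp only; linarith
      _ ≤ _ := b3
      _ ≤ C * ((B1 * (1/(n:ℝ)^2)) * (∫ p, Y p ^ 2) + (B2 * (1/(n:ℝ)^2)) * ∫ p, ∑ k, DD (some k) Y p ^ 2) := mul_le_mul_of_nonneg_left b2 hC.le
      _ = _ := by rw [hM]; ring
  have hz : ∫ p in Metric.ball (0:EE d) (‖p‖ + 1), DD none Y p ^ 2 ≤ 0 := by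
    have lim : Filter.Tendsto (fun n : ℕ => C * M * (1 / (n:ℝ) ^ 2)) Filter.atTop (nhds 0) := by
      have h9 : Filter.Tendsto (fun n : ℕ => (1 / (n:ℝ) ^ 2)) Filter.atTop (nhds 0) :=
        tendsto_const_nhds.div_atTop ((Filter.tendsto_pow_atTop (by norm_num)).comp tendsto_natCast_atTop_atTop)
      simpa using h9.const_mul (C * M)
    obtain ⟨m, hm⟩ := exists_nat_gt (‖p‖ + 1)
    refine ge_of_tendsto lim ?_
    filter_upwards [Filter.eventually_ge_atTop (max m 1)] with n hn
    refine key n (le_of_max_le_right hn) _ ?_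
    have : (m:ℝ) ≤ n := by exact_mod_cast le_of_max_le_left hn
    linarith
  have hc : Continuous fun p => DD none Y p ^ 2 := (hY.DD none).cont.pow 2
  have hz2 : ∫ p in Metric.ball (0:EE d) (‖p‖ + 1), DD none Y p ^ 2 = 0 := le_antisymm hz (integral_nonneg fun p => sq_nonneg _)
  rw [integral_eq_zero_iff_of_nonneg (fun p => sq_nonneg _) ((LB.of_cont hc).integrableOn Metric.isBounded_ball)] at hz2
  have := Measure.eqOn_open_of_ae_eq hz2 Metric.isOpen_ball hc.continuousOn continuousOn_const
  have := this (x := p) (by simp)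
  simpa using this

theorem liou (i0 : Fin d) {Y : EE d → ℝ} (hY : Sm Y) (hL : ∀ p, Lop i0 Idm Y p = 0) (h0 : Integrable fun p => Y p ^ 2)
    (h1 : ∀ j : Fin d, Integrable fun p => DD (some j) Y p ^ 2) (p : EE d) : Y p = 0 := by
  have ht := liou_t i0 hY hL h0 h1
  have hconst : ∀ t (x : Fin d → ℝ), Y (t, x) = Y (0, x) := by
    intro t x
    have hd : ∀ s, HasDerivAt (fun s => Y (s, x)) 0 s := by
      intro s
      have h2 : HasDerivAt (fun s : ℝ => (s, x)) (ev (d := d) none) s := (hasDerivAt_id s).prodMk (hasDerivAt_const s x)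
      have := (hY.diff (s, x)).hasFDerivAt.comp_hasDerivAt s h2
      have e : (fderiv ℝ Y (s, x)) (ev none) = 0 := ht (s, x)
      rw [e] at this
      exact this
    exact is_const_of_deriv_eq_zero (fun s => (hd s).differentiableAt) (fun s => (hd s).deriv) t 0
  have h3 : ∀ᵐ x : Fin d → ℝ, Y (0, x) ^ 2 = 0 := by
    have h4 : Integrable (fun p => Y p ^ 2) ((volume : Measure ℝ).prod (volume : Measure (Fin d → ℝ))) := h0
    filter_upwards [h4.prod_left_ae] with x hx
    simp only [hconst _ x] at hx
    rw [integrable_const_iff] at hx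
    rcases hx with hx | hx
    · exact hx
    · exact absurd hx.measure_univ_lt_top (by simp)
  have hc : Continuous fun x : Fin d → ℝ => Y (0, x) ^ 2 := (hY.cont.comp (by fun_prop)).pow 2
  have := (Continuous.ae_eq_iff_eq volume hc (continuous_const (y := (0:ℝ)))).1 h3
  have h5 := congrFun this p.2
  have h6 := hconst p.1 p.2
  rw [show p = (p.1, p.2) from rfl, h6]
  simpa using h5

theorem orth_zero (i0 : Fin d) {y : EE d → ℝ} (hy : Measurable y) (h2 : MemLp y 2 volume)
    (ho : ∀ φ, TF φ → ∫ q, y q * Lop i0 Idm φ q = 0) : ∀ᵐ q, y q = 0 := by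
  have hk := tau_ker hy h2
  refine ae_eq_zero_of_integral_contDiff_smul_eq_zero (h2.locallyIntegrable (by norm_num)) fun g hg hgc => ?_
  have htf : TF g := ⟨hg, hgc⟩
  have hρ : TF (fun q => g (0 + tau q)) := htf.tau 0
  have hS := Tm_Sm hk hρ
  have hz := liou i0 hS (fun p => ?_) (tau_sq hy h2 hρ) (fun j => ?_) 0
  · rw [← hz]
    unfold Tm
    simp only [zero_add, tau_tau, smul_eq_mul, mul_comm]
  · rw [Tm_Lop hk i0 (fun _ _ _ _ => rfl) hρ]
    have := ho _ (hρ.tau p)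
    simp only [Lop_tau i0 p hρ] at this
    exact this
  · rw [Tm_DD hk hρ]
    exact tau_sq hy h2 (hρ.DD _)

end Liou
end P14

section P15
section Bas
open MeasureTheory

variable {d : ℕ}

theorem CI.memLp {F : EE d → ℝ} (hF : CI F) : MemLp F 2 volume := by
  rw [memLp_two_iff_integrable_sq hF.1.1.aestronglyMeasurable]
  exact hF.sq.int

noncomputable def Kr (d : ℕ) (i0 : Fin d) : Submodule ℝ (Lp ℝ 2 (volume : Measure (EE d))) where
  carrier := {f | ∃ φ, TF φ ∧ ⇑f =ᵐ[volume] Lop i0 Idm φ}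
  add_mem' := by
    rintro f g ⟨φ, h1, h2⟩ ⟨ψ, h3, h4⟩
    refine ⟨_, tf_add h1 h3, ?_⟩
    rw [Lop_add i0 _ h1.1 h3.1]
    filter_upwards [Lp.coeFn_add f g, h2, h4] with p e1 e2 e3
    rw [e1, Pi.add_apply, e2, e3]
  zero_mem' := by
    refine ⟨_, tf_zero, ?_⟩
    filter_upwards [Lp.coeFn_zero ℝ 2 (volume : Measure (EE d))] with p hp
    rw [hp, Lop_zero]; rfl
  smul_mem' := by
    rintro c f ⟨φ, h1, h2⟩
    refine ⟨_, h1.cmul c, ?_⟩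
    rw [Lop_cmul i0 _ c h1.1]
    filter_upwards [Lp.coeFn_smul c f, h2] with p e1 e2
    rw [e1, Pi.smul_apply, e2, smul_eq_mul]

theorem Kr_top (i0 : Fin d) : (Kr d i0).topologicalClosure = ⊤ := by
  rw [Submodule.topologicalClosure_eq_top_iff, Submodule.eq_bot_iff]
  intro y hy
  rw [Submodule.mem_orthogonal] at hy
  have hz : ∀ᵐ q, (y : EE d → ℝ) q = 0 := by
    refine orth_zero i0 (Lp.stronglyMeasurable y).measurable (Lp.memLp y) fun φ hφ => ?_
    have hm := (Lop_CI one_pos Idm_ell i0 hφ).memLp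
    have := hy (hm.toLp _) ⟨φ, hφ, hm.coeFn_toLp⟩
    rw [L2.inner_def] at this
    rw [← this]
    refine integral_congr_ae ?_
    filter_upwards [hm.coeFn_toLp] with q hq
    rw [hq]
    simp
  exact Lp.ext (Filter.EventuallyEq.trans (g := 0) hz (Lp.coeFn_zero ℝ 2 _).symm)

theorem dns_base (i0 : Fin d) : Dns i0 (Idm (d := d)) := by
  intro F hF ε hε
  have hm := hF.memLp
  have h1 : hm.toLp F ∈ closure (Kr d i0 : Set (Lp ℝ 2 (volume : Measure (EE d)))) := by
    rw [← Submodule.topologicalClosure_coe, Kr_top]; trivial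
  obtain ⟨f, ⟨φ, hφ, hf⟩, hd⟩ := Metric.mem_closure_iff.1 h1 (Real.sqrt ε) (Real.sqrt_pos.2 hε)
  refine ⟨φ, hφ, ?_⟩
  rw [dist_comm, dist_eq_norm] at hd
  have h2 : ‖f - hm.toLp F‖ ^ 2 ≤ ε := by
    have := pow_le_pow_left₀ (norm_nonneg _) hd.le 2
    rwa [Real.sq_sqrt hε.le] at this
  refine le_trans (le_of_eq ?_) h2
  rw [← real_inner_self_eq_norm_sq, L2.inner_def]
  refine integral_congr_ae ?_
  filter_upwards [Lp.coeFn_sub f (hm.toLp F), hf, hm.coeFn_toLp] with p e1 e2 e3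
  rw [e1, Pi.sub_apply, e2, e3]
  simp [pow_two]

theorem dns {δ : ℝ} (hδ : δ ∈ Set.Ioo (0:ℝ) 1) (i0 : Fin d) {a : ℝ → Fin d → Fin d → ℝ} (h : Ell δ a) : Dns i0 a :=
  dns_of_base hδ i0 (dns_base i0) h

end Bas
end P15

section P16
section Moll
open MeasureTheory

variable {d : ℕ}

noncomputable def Pj (i0 : Fin d) : EE d →L[ℝ] EE d :=
  (ContinuousLinearMap.fst ℝ ℝ (Fin d → ℝ)).prod
    (ContinuousLinearMap.pi fun j => if j = i0 then 0 else (ContinuousLinearMap.proj (R := ℝ) (φ := fun _ : Fin d => ℝ) j).comp (ContinuousLinearMap.snd ℝ ℝ (Fin d → ℝ)))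

theorem Pj_fst (i0 : Fin d) (q : EE d) : (Pj i0 q).1 = q.1 := rfl
theorem Pj_snd (i0 : Fin d) (q : EE d) (j : Fin d) : (Pj i0 q).2 j = if j = i0 then 0 else q.2 j := by
  show (if j = i0 then (0 : EE d →L[ℝ] ℝ) else _) q = _
  split_ifs <;> rfl
theorem Pj_ev (i0 : Fin d) (i : Option (Fin d)) (hi : i ≠ some i0) : Pj i0 (ev i) = (1:ℝ) • ev i := by
  rw [one_smul]
  ext j
  · rfl
  · rw [Pj_snd]
    split_ifs with h
    · subst h
      cases i with
      | none => rfl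
      | some k =>
        have : k ≠ j := fun h => hi (by rw [h])
        simp [ev, Pi.single_apply, this.symm]
    · rfl
theorem Pj_norm (i0 : Fin d) (q : EE d) : ‖Pj i0 q‖ ≤ ‖q‖ := by
  rw [Prod.norm_def, Prod.norm_def]
  refine max_le_max le_rfl ?_
  refine (pi_norm_le_iff_of_nonneg (norm_nonneg _)).2 fun j => ?_
  rw [Pj_snd]
  split_ifs
  · simp
  · exact norm_le_pi_norm q.2 j

theorem ker_of_int {k : EE d → ℝ} {τ : EE d → EE d} (hτ : Measurable τ) (hk : Integrable k) : Ker k τ :=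
  ⟨hτ, hk.1, fun _ => hk.integrableOn⟩

theorem Pj_ker (i0 : Fin d) {ψ : EE d → ℝ} (h : TF ψ) : Ker ψ (fun q => Pj i0 q) :=
  ker_of_int (Pj i0).continuous.measurable h.CI.int

theorem Tm_ibp (i0 : Fin d) {ψ f : EE d → ℝ} (h : TF ψ) (hf : TF f) (i : Option (Fin d)) (hi : i ≠ some i0) (p : EE d) :
    Tm ψ (fun q => Pj i0 q) (DD i f) p = - Tm (DD i ψ) (fun q => Pj i0 q) f p := by
  have h1 : Sm (fun q => f (p + Pj i0 q)) := hf.1.aff _ p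
  have h2 := ibp_gen i (LB.const 1) (fun _ _ => rfl) (h.mul h1)
  simp only [one_mul] at h2
  rw [DD_mul h.1 h1, DD_affine (Pj i0) p i (Pj_ev i0 i hi) hf.1] at h2
  simp only [one_mul] at h2
  rw [integral_add ((Pj_ker i0 (h.DD i)).int hf.CI p) ((Pj_ker i0 h).int (hf.DD i).CI p)] at h2
  unfold Tm
  linarith

theorem Tm_ibpL (i0 : Fin d) {ψ f : EE d → ℝ} (h : TF ψ) (hf : TF f) (l : List (Option (Fin d))) (hl : Good i0 l) (p : EE d) :
    Tm ψ (fun q => Pj i0 q) (DL l f) p = (-1) ^ l.length * Tm (DL l ψ) (fun q => Pj i0 q) f p := by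
  induction l generalizing f with
  | nil => simp [DL]
  | cons i l ih =>
    show Tm ψ (fun q => Pj i0 q) (DL l (DD i f)) p = _
    rw [ih (hf.DD i) (fun j hj => hl j (List.mem_cons_of_mem _ hj)), Tm_ibp i0 (h.DL l) hf i (hl i List.mem_cons_self), DL_cons h.1, List.length_cons, pow_succ]
    ring

theorem Tm_cpt (i0 : Fin d) {ψ f : EE d → ℝ} (h : TF ψ) (hf : TF f) : TF (Tm ψ (fun q => Pj i0 q) f) := by
  refine ⟨Tm_Sm (Pj_ker i0 h) hf, ?_⟩
  obtain ⟨R, hR⟩ := hf.CI.2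
  obtain ⟨K, hK⟩ := h.CI.2
  refine HasCompactSupport.of_support_subset_isCompact (isCompact_closedBall (0 : EE d) (R + K)) fun p hp => ?_
  by_contra hn
  simp only [Metric.mem_closedBall, dist_zero_right, not_le] at hn
  apply hp
  unfold Tm
  refine integral_eq_zero_of_ae (Filter.Eventually.of_forall fun q => ?_)
  by_cases hq : K < ‖q‖
  · simp [hK q hq]
  · have h1 : ‖p‖ ≤ ‖p + Pj i0 q‖ + ‖Pj i0 q‖ := by
      calc ‖p‖ = ‖(p + Pj i0 q) - Pj i0 q‖ := by simp
        _ ≤ _ := norm_sub_le _ _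
    have h2 := Pj_norm i0 q
    have : f (p + Pj i0 q) = 0 := hR _ (by linarith [not_lt.1 hq])
    simp [this]

theorem Tm_meas {k F : EE d → ℝ} {τ : EE d → EE d} (hk : Measurable k) (hτ : Measurable τ) (hF : Measurable F) : Measurable (Tm k τ F) := by
  have hm : Measurable fun z : EE d × EE d => k z.2 * F (z.1 + τ z.2) :=
    (hk.comp measurable_snd).mul (hF.comp (measurable_fst.add (hτ.comp measurable_snd)))
  exact (hm.stronglyMeasurable.integral_prod_right' (ν := volume)).measurable

theorem young_real {k F : EE d → ℝ} {τ : EE d → EE d} (hk : Measurable k) (hki : Integrable k) (hτ : Measurable τ) (hF : CI F) :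
    Integrable (fun p => Tm k τ F p ^ 2) ∧ ∫ p, Tm k τ F p ^ 2 ≤ (∫ q, |k q|) ^ 2 * ∫ p, F p ^ 2 := by
  have hy := young_len hk hτ hF.1.1
  have e1 : ∫⁻ q, ‖k q‖ₑ = ENNReal.ofReal (∫ q, |k q|) := by
    rw [ofReal_integral_eq_lintegral_ofReal hki.abs (Filter.Eventually.of_forall fun q => abs_nonneg _)]
    refine lintegral_congr fun q => ?_
    rw [Real.enorm_eq_ofReal_abs]
  have esq : ∀ x : ℝ, ‖x‖ₑ ^ 2 = ENNReal.ofReal (x ^ 2) := by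
    intro x; rw [Real.enorm_eq_ofReal_abs, ← ENNReal.ofReal_pow (abs_nonneg _), sq_abs]
  have e2 : ∫⁻ p, ‖F p‖ₑ ^ 2 = ENNReal.ofReal (∫ p, F p ^ 2) := by
    rw [ofReal_integral_eq_lintegral_ofReal hF.sq.int (Filter.Eventually.of_forall fun q => sq_nonneg _)]
    simp only [esq]
  rw [e1, e2, ← ENNReal.ofReal_pow (integral_nonneg fun _ => abs_nonneg _), ← ENNReal.ofReal_mul (sq_nonneg _)] at hy
  have hi : Integrable (fun p => Tm k τ F p ^ 2) := by
    refine ⟨((Tm_meas hk hτ hF.1.1).pow_const 2).aestronglyMeasurable, ?_⟩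
    unfold HasFiniteIntegral
    simp only [enorm_pow]
    exact lt_of_le_of_lt hy ENNReal.ofReal_lt_top
  refine ⟨hi, ?_⟩
  simp only [esq] at hy
  rw [← ofReal_integral_eq_lintegral_ofReal hi (Filter.Eventually.of_forall fun q => sq_nonneg _)] at hy
  exact (ENNReal.ofReal_le_ofReal_iff (mul_nonneg (sq_nonneg _) (integral_nonneg fun _ => sq_nonneg _))).1 hy

theorem psi_exists (d : ℕ) {s0 : ℝ} (hs : 0 < s0) : ∃ ψ : EE d → ℝ, TF ψ ∧ (∀ q, 0 ≤ ψ q) ∧ ∫ q, ψ q = 1 ∧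
    ∀ q ∈ tsupport ψ, 0 < q.1 ∧ ‖q‖ < s0 := by
  let c : EE d := (s0/2, 0)
  let f : ContDiffBump c := ⟨s0/8, s0/4, by positivity, by linarith⟩
  refine ⟨f.normed volume, ⟨f.contDiff_normed, f.hasCompactSupport_normed⟩, f.nonneg_normed, f.integral_normed, fun q hq => ?_⟩
  rw [f.tsupport_normed_eq] at hq
  have hq' : ‖q - c‖ ≤ s0/4 := by simpa [dist_eq_norm] using hq
  have h1 : |q.1 - s0/2| ≤ s0/4 := (norm_fst_le (q - c)).trans hq'
  have h2 : ‖c‖ = s0/2 := by simp [c, Prod.norm_def, abs_of_pos hs]; positivity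
  have h3 := norm_sub_norm_le q c
  refine ⟨by linarith [neg_abs_le (q.1 - s0/2)], by linarith⟩

theorem osc_g {δ : ℝ} (hδ : 0 < δ) {a : ℝ → Fin d → Fin d → ℝ} (h : Ell δ a) (i0 : Fin d) {u : EE d → ℝ} (hu : TF u) {ε : ℝ} (hε : 0 < ε) :
    ∀ᶠ z in nhds (0 : EE d), z.2 i0 = 0 → ∀ p, |Lop i0 a u (p + z) - Lop i0 a u p| ≤ ε := by
  have key : ∀ w : EE d → ℝ, TF w → ∀ ε > 0, ∀ᶠ z in nhds (0 : EE d), ∀ p, |w (p + z) - w p| ≤ ε := by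
    intro w hw ε hε
    have hc := hw.2.uniformContinuous_of_continuous hw.1.cont
    obtain ⟨s, hs, hh⟩ := Metric.uniformContinuous_iff.1 hc ε hε
    filter_upwards [Metric.ball_mem_nhds (0 : EE d) hs] with z hz p
    have := hh (a := p + z) (b := p) (by simpa [dist_eq_norm] using hz)
    exact (by simpa [Real.dist_eq] using this : |w (p + z) - w p| < ε).le
  set B : ℝ := 1 + d ^ 2 * δ⁻¹ with hB
  have hi : 0 < δ⁻¹ := inv_pos.2 hδ
  have B0 : 0 < B := by positivity
  have h1 := key _ (hu.DD none) (ε / B) (by positivity)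
  have h2 : ∀ᶠ z in nhds (0 : EE d), ∀ j k : Fin d, ∀ p, |DD (some j) (DD (some k) u) (p + z) - DD (some j) (DD (some k) u) p| ≤ ε / B := by
    simp only [Filter.eventually_all]
    exact fun j k => key _ ((hu.DD _).DD _) _ (by positivity)
  filter_upwards [h1, h2] with z hz1 hz2 hz p
  have e : Lop i0 a u (p + z) - Lop i0 a u p = (DD none u (p + z) - DD none u p) + ∑ j, ∑ k, a (p.2 i0) j k * (DD (some j) (DD (some k) u) (p + z) - DD (some j) (DD (some k) u) p) := by
    have : (p + z).2 i0 = p.2 i0 := by simp [hz]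
    simp only [Lop, this, mul_sub, Finset.sum_sub_distrib]; ring
  rw [e]
  have := bd_sum hδ h (p.2 i0) (x := fun j k => DD (some j) (DD (some k) u) (p + z) - DD (some j) (DD (some k) u) p) (fun j k => hz2 j k p)
  calc _ ≤ ε / B + d ^ 2 * δ⁻¹ * (ε / B) := (abs_add_le _ _).trans (add_le_add (hz1 p) this)
    _ = B * (ε / B) := by rw [hB]; ring
    _ = ε := by field_simp

theorem in_Q1 (i0 : Fin d) {p q : EE d} (hp : p ∈ Qc d (1/2)) (h0 : 0 < q.1) (hq : ‖q‖ < 1 / (4 * (d + 1))) : p + Pj i0 q ∈ Qc d 1 := by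
  obtain ⟨⟨h1, h2⟩, h3⟩ := hp
  simp only [ballE, Set.mem_ofPred_eq] at h3
  have hd0 : (0:ℝ) ≤ d := Nat.cast_nonneg d
  have hs : 1 / (4 * ((d:ℝ) + 1)) ≤ 1/4 := by
    apply one_div_le_one_div_of_le <;> linarith
  have hq1 : q.1 ≤ ‖q‖ := (le_abs_self _).trans (norm_fst_le q)
  refine ⟨⟨?_, ?_⟩, ?_⟩
  · simp only [Prod.fst_add, Pj_fst]; linarith
  · simp only [Prod.fst_add, Pj_fst]; norm_num at h2 ⊢; linarith
  · simp only [ballE, Set.mem_ofPred_eq]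
    set N := 1 / (4 * ((d:ℝ) + 1)) with hN
    have hN0 : 0 < N := by positivity
    have hj : ∀ j, ((p + Pj i0 q).2 j) ^ 2 ≤ 2 * p.2 j ^ 2 + 2 * N ^ 2 := by
      intro j
      have h5 : |(Pj i0 q).2 j| ≤ N := ((norm_le_pi_norm (Pj i0 q).2 j).trans (norm_snd_le _)).trans ((Pj_norm i0 q).trans hq.le)
      have h6 : (Pj i0 q).2 j ^ 2 ≤ N ^ 2 := sq_le_sq.2 (h5.trans (le_abs_self _))
      simp only [Prod.snd_add, Pi.add_apply]
      nlinarith [sq_nonneg (p.2 j - (Pj i0 q).2 j)]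
    have h7 := Finset.sum_le_sum fun j (_ : j ∈ Finset.univ) => hj j
    rw [Finset.sum_add_distrib, ← Finset.mul_sum, Finset.sum_const, Finset.card_univ, Fintype.card_fin, nsmul_eq_mul] at h7
    have h8 : (d:ℝ) * N ≤ 1/4 := by
      rw [hN]; field_simp; linarith
    norm_num at h3 ⊢
    simp only [Prod.snd_add, Pi.add_apply] at h7
    nlinarith

end Moll
end P16

section P17
section Exi
open MeasureTheory

variable {d : ℕ}

theorem exist_v (d : ℕ) {δ : ℝ} (hδ : δ ∈ Set.Ioo (0:ℝ) 1) : ∃ C : ℝ, 0 < C ∧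
    ∀ (a : ℝ → Fin d → Fin d → ℝ) (_ : Ell δ a) (i0 : Fin d) (u : EE d → ℝ) (_ : TF u) (ε : ℝ) (_ : 0 < ε),
    ∃ v, TF v ∧ ∫ p, (DD none v p ^ 2 + HX v p) ≤ C * ((∫ p in Qc d 1, Lop i0 a u p ^ 2) + ε) ∧
      ∀ γ, Good i0 γ → γ.length ≤ d + 4 → ∫ p in Qc d (1/2), Lop i0 a (DL γ (fun p => u p - v p)) p ^ 2 ≤ ε := by
  obtain ⟨C, hC, hap⟩ := apriori_full d hδ.1
  refine ⟨2 * C, by positivity, fun a h i0 u hu ε hε => ?_⟩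
  set V := (volume (Qc d (1/2))).toReal with hV
  have V0 : 0 ≤ V := ENNReal.toReal_nonneg
  set ε1 := Real.sqrt (ε / (4 * (V + 1))) with hε1
  have e1p : 0 < ε1 := Real.sqrt_pos.2 (by positivity)
  have e1s : ε1 ^ 2 = ε / (4 * (V + 1)) := Real.sq_sqrt (by positivity)
  set Γ : Set (List (Option (Fin d))) := {l | l.length ≤ d + 4} with hΓ
  have hΓf : Γ.Finite := List.finite_length_le _ _
  have hev : ∀ᶠ z in nhds (0 : EE d), ∀ γ ∈ Γ, z.2 i0 = 0 → ∀ p, |Lop i0 a (DL γ u) (p + z) - Lop i0 a (DL γ u) p| ≤ ε1 :=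
    (Filter.eventually_all_finite hΓf).2 fun γ _ => osc_g hδ.1 h i0 (hu.DL γ) e1p
  obtain ⟨s, hs, hball⟩ := Metric.eventually_nhds_iff.1 hev
  have hd0 : (0:ℝ) ≤ d := Nat.cast_nonneg d
  obtain ⟨ψ, hψ, ψ0, ψ1, ψs⟩ := psi_exists d (s0 := min s (1 / (4 * (d + 1)))) (lt_min hs (by positivity))
  -- bound on kernels
  obtain ⟨M, hM⟩ : ∃ M : ℝ, ∀ γ ∈ Γ, ∫ q, |DL γ ψ q| ≤ M := by
    obtain ⟨M, hM⟩ := (hΓf.image fun γ => ∫ q, |DL γ ψ q|).bddAbove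
    exact ⟨M, fun γ hγ => hM ⟨γ, hγ, rfl⟩⟩
  set F : EE d → ℝ := (Qc d 1).indicator (Lop i0 a u) with hFd
  have hLu := Lop_CI hδ.1 h i0 hu
  have hF : CI F := by
    obtain ⟨⟨m1, m2⟩, R, hR⟩ := hLu
    refine ⟨⟨m1.indicator (Qc_meas 1), fun R => ?_⟩, R, fun p hp => ?_⟩
    · obtain ⟨K, hK⟩ := m2 R
      refine ⟨K, fun p hp => ?_⟩
      have := hK p hp
      by_cases hq : p ∈ Qc d 1
      · simpa [hFd, hq] using this
      · simpa [hFd, hq] using (abs_nonneg _).trans this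
    · by_cases hq : p ∈ Qc d 1 <;> simp [hFd, hq, hR p hp]
  have hFi : ∫ p, F p ^ 2 = ∫ p in Qc d 1, Lop i0 a u p ^ 2 := by
    rw [← integral_indicator (Qc_meas 1)]
    congr 1; funext p
    by_cases hq : p ∈ Qc d 1 <;> simp [hFd, hq]
  set ε' := min (ε / (4 * (M ^ 2 + 1))) ε with hε'
  obtain ⟨f, hf, hfe⟩ := dns hδ i0 h F hF ε' (lt_min (by positivity) hε)
  have hLf := Lop_CI hδ.1 h i0 hf
  set P : EE d → EE d := fun q => Pj i0 q with hP
  have hPm : Measurable P := (Pj i0).continuous.measurable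
  have hinv : ∀ p q : EE d, ∀ j k, a ((p + P q).2 i0) j k = a (p.2 i0) j k := by
    intro p q j k
    have : (p + P q).2 i0 = p.2 i0 := by simp [hP, Pj_snd]
    rw [this]
  have hv := Tm_cpt i0 hψ hf
  refine ⟨Tm ψ P f, hv, ?_, fun γ hγ hl => ?_⟩
  · have h1 := hap a h i0 _ hv
    refine h1.trans ?_
    rw [Tm_Lop (Pj_ker i0 hψ) i0 hinv hf]
    have h2 := (young_real hψ.1.cont.measurable hψ.CI.int hPm hLf).2
    have h3 : ∫ q, |ψ q| = 1 := by rw [← ψ1]; congr 1; funext q; exact abs_of_nonneg (ψ0 q)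
    rw [h3, one_pow, one_mul] at h2
    have h4 := int2 hLf.sq.int (hLf.sub hF).sq.int hF.sq.int 2 2 (fun p => by nlinarith [sq_nonneg ((Lop i0 a f p - F p) - F p)])
    rw [hFi] at h4
    have h5 : ε' ≤ ε := min_le_right _ _
    have h6 := h2.trans (h4.trans (add_le_add (mul_le_mul_of_nonneg_left (hfe.trans h5) (by norm_num)) le_rfl))
    calc _ ≤ C * (2 * ε + 2 * ∫ p in Qc d 1, Lop i0 a u p ^ 2) := mul_le_mul_of_nonneg_left h6 hC.le
      _ = _ := by ring
  · have hγΓ : γ ∈ Γ := hl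
    have kψ := Pj_ker i0 hψ
    have kγ := Pj_ker i0 (hψ.DL γ)
    set G : EE d → ℝ := Tm (DL γ ψ) P (fun p => Lop i0 a f p - F p) with hG
    have hy := young_real (hψ.DL γ).1.cont.measurable (hψ.DL γ).CI.int hPm (hLf.sub hF)
    have hpt : ∀ p ∈ Qc d (1/2), Lop i0 a (DL γ (fun p => u p - Tm ψ P f p)) p ^ 2 ≤ 2 * ε1 ^ 2 + 2 * G p ^ 2 := by
      intro p hp
      rw [DL_sub hu.1 hv.1, Lop_sub i0 a (hu.DL γ).1 (hv.DL γ).1]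
      -- the two representations
      have r : ∀ g : EE d → ℝ, TF g → Tm ψ P (Lop i0 a (DL γ g)) p = (-1) ^ γ.length * Tm (DL γ ψ) P (Lop i0 a g) p := by
        intro g hg
        have e1 : Tm ψ P (DL γ g) = fun p => (-1) ^ γ.length * Tm (DL γ ψ) P g p := by
          funext p; exact Tm_ibpL i0 hψ hg γ hγ p
        have e2 := congrArg (Lop i0 a) e1
        rw [Tm_Lop kψ i0 hinv (hg.DL γ), Lop_cmul i0 a _ (Tm_Sm kγ hg), Tm_Lop kγ i0 hinv hg] at e2
        exact congrFun e2 p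
      have e3 : Lop i0 a (DL γ (Tm ψ P f)) p = Tm ψ P (Lop i0 a (DL γ f)) p := by
        rw [Tm_DL kψ hf, Tm_Lop kψ i0 hinv (hf.DL γ)]
      have e4 : G p = Tm (DL γ ψ) P (Lop i0 a f) p - Tm (DL γ ψ) P (Lop i0 a u) p := by
        rw [hG]
        unfold Tm
        rw [← integral_sub (kγ.int hLf p) (kγ.int hLu p)]
        congr 1; funext q
        by_cases hq : q ∈ tsupport ψ
        · have hq2 := ψs q hq
          have hm : p + P q ∈ Qc d 1 := in_Q1 i0 hp hq2.1 (hq2.2.trans_le (min_le_right _ _))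
          simp only [hFd, Set.indicator_of_mem hm]; ring
        · rw [off_zero (DL_off hq γ)]; ring
      have e5 : |Tm ψ P (Lop i0 a (DL γ u)) p - Lop i0 a (DL γ u) p| ≤ ε1 := by
        have hLg := Lop_CI hδ.1 h i0 (hu.DL γ)
        have e6 : Lop i0 a (DL γ u) p = ∫ q, ψ q * Lop i0 a (DL γ u) p := by
          rw [integral_mul_const, ψ1, one_mul]
        rw [e6]
        unfold Tm
        rw [← integral_sub (kψ.int hLg p) (hψ.CI.int.mul_const _)]
        have e7 : ‖∫ q, (ψ q * Lop i0 a (DL γ u) (p + P q) - ψ q * Lop i0 a (DL γ u) p)‖ ≤ ∫ q, ψ q * ε1 := by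
          refine norm_integral_le_of_norm_le (hψ.CI.int.mul_const _) (Filter.Eventually.of_forall fun q => ?_)
          rw [← mul_sub, norm_mul, Real.norm_of_nonneg (ψ0 q)]
          by_cases hq : q ∈ tsupport ψ
          · refine mul_le_mul_of_nonneg_left ?_ (ψ0 q)
            have hq2 := ψs q hq
            refine hball (y := P q) ?_ γ hγΓ (by simp [hP, Pj_snd]) p
            rw [dist_zero_right]
            exact (Pj_norm i0 q).trans_lt (hq2.2.trans_le (min_le_left _ _))
          · rw [off_zero hq]; simp
        rwa [integral_mul_const, ψ1, one_mul] at e7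
      have e8 := r f hf
      have e9 := r u hu
      have e10 : ((-1:ℝ) ^ γ.length) ^ 2 = 1 := by rw [← pow_mul, mul_comm, pow_mul]; simp
      set σ := (-1:ℝ) ^ γ.length
      set A := Tm ψ P (Lop i0 a (DL γ u)) p - Lop i0 a (DL γ u) p with hA
      have e11 : Lop i0 a (DL γ u) p - Lop i0 a (DL γ (Tm ψ P f)) p = - (A + σ * G p) := by
        rw [e3, e8, e4, hA, e9]; ring
      have e12 : A ^ 2 ≤ ε1 ^ 2 := sq_le_sq.2 (e5.trans (le_abs_self _))
      show (Lop i0 a (DL γ u) p - Lop i0 a (DL γ (Tm ψ P f)) p) ^ 2 ≤ _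
      rw [e11]
      have e13 : (σ * G p) ^ 2 = G p ^ 2 := by rw [mul_pow, e10, one_mul]
      nlinarith [sq_nonneg (A - σ * G p)]
    have hLB : LB (fun p => Lop i0 a (DL γ (fun p => u p - Tm ψ P f p)) p ^ 2) :=
      (Lop_LB hδ.1 h i0 ((hu.1.sub hv.1).DL γ)).sq
    have hVf : volume (Qc d (1/2)) ≠ ⊤ := (Qc_bdd (1/2)).measure_lt_top.ne
    have hci : IntegrableOn (fun _ : EE d => 2 * ε1 ^ 2) (Qc d (1/2)) := integrableOn_const hVf
    have hGi : Integrable fun p => 2 * G p ^ 2 := hy.1.const_mul 2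
    have i1 := setIntegral_mono_on (hLB.iq (1/2)) (hci.add hGi.integrableOn) (Qc_meas _) hpt
    have i2 : ∫ p in Qc d (1/2), (2 * ε1 ^ 2 + 2 * G p ^ 2) = V * (2 * ε1 ^ 2) + ∫ p in Qc d (1/2), 2 * G p ^ 2 := by
      rw [integral_add hci hGi.integrableOn, setIntegral_const]; rfl
    have i3 : ∫ p in Qc d (1/2), 2 * G p ^ 2 ≤ 2 * ∫ p, G p ^ 2 := by
      rw [← integral_const_mul]
      exact setIntegral_le_integral hGi (Filter.Eventually.of_forall fun p => by positivity)
    have i4 : ∫ p, G p ^ 2 ≤ M ^ 2 * ε' := by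
      refine hy.2.trans (mul_le_mul ?_ hfe (integral_nonneg fun _ => sq_nonneg _) (sq_nonneg _))
      exact pow_le_pow_left₀ (integral_nonneg fun _ => abs_nonneg _) (hM γ hγΓ) 2
    have i5 : M ^ 2 * ε' ≤ ε / 4 := by
      calc M ^ 2 * ε' ≤ M ^ 2 * (ε / (4 * (M ^ 2 + 1))) := mul_le_mul_of_nonneg_left (min_le_left _ _) (sq_nonneg _)
        _ = (M ^ 2 / (M ^ 2 + 1)) * (ε / 4) := by field_simp
        _ ≤ 1 * (ε / 4) := by
          gcongr
          rw [div_le_one (by positivity)]; linarith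
        _ = _ := one_mul _
    have i6 : V * (2 * ε1 ^ 2) ≤ ε / 2 := by
      rw [e1s]
      calc V * (2 * (ε / (4 * (V + 1)))) = (V / (V + 1)) * (ε / 2) := by field_simp; ring
        _ ≤ 1 * (ε / 2) := by
          gcongr
          rw [div_le_one (by positivity)]; linarith
        _ = _ := one_mul _
    have i7 := i1.trans (le_of_eq i2)
    linarith

end Exi
end P17

section P18
open MeasureTheory
variable {d : ℕ}

theorem Qc_vpos {r : ℝ} (hr : 0 < r) : 0 < (volume (Qc d r)).toReal := by
  refine ENNReal.toReal_pos ?_ (Qc_bdd r).measure_lt_top.ne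
  have ho : IsOpen (Qc d r) := isOpen_Ioo.prod (ballE_open r)
  refine (ho.measure_pos volume ⟨(r^2/2, 0), ?_⟩).ne'
  have : 0 < r ^ 2 := by positivity
  refine ⟨⟨by simp only []; linarith, by simp only []; linarith⟩, ?_⟩
  simp only [ballE, Set.mem_ofPred_eq]; simpa using this

open scoped Pointwise in
theorem Qc_vol {r : ℝ} (hr : 0 < r) : (volume (Qc d r)).toReal = r ^ (d + 2) * (volume (Qc d 1)).toReal := by
  have h1 : ballE d r = r • ballE d 1 := by
    ext x
    rw [Set.mem_smul_set_iff_inv_smul_mem₀ hr.ne']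
    simp only [ballE, Set.mem_ofPred_eq, Pi.smul_apply, smul_eq_mul, mul_pow, ← Finset.mul_sum]
    rw [inv_pow, inv_mul_lt_iff₀ (by positivity)]; simp
  have h2 : volume (Qc d r) = ENNReal.ofReal (r ^ 2) * volume (ballE d r) := by
    unfold Qc; rw [Measure.volume_eq_prod, Measure.prod_prod, Real.volume_Ioo, sub_zero]
  have h3 : volume (Qc d 1) = volume (ballE d 1) := by
    unfold Qc; rw [Measure.volume_eq_prod, Measure.prod_prod, Real.volume_Ioo]; simp
  rw [h2, h3, h1, Measure.addHaar_smul, Module.finrank_fin_fun, ENNReal.toReal_mul, ENNReal.toReal_mul,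
    ENNReal.toReal_ofReal (by positivity), ENNReal.toReal_ofReal (by positivity), abs_of_nonneg (by positivity)]
  ring

theorem var_le {w : EE d → ℝ} (hw : LB w) {r : ℝ} (hr : 0 < r) (c : ℝ) :
    ∫ p in Qc d r, (w p - avg (Qc d r) w) ^ 2 ≤ ∫ p in Qc d r, (w p - c) ^ 2 := by
  set m := avg (Qc d r) w with hm
  have hV := Qc_vpos (d := d) hr
  have e1 : (volume (Qc d r)).toReal * m = ∫ p in Qc d r, w p := by
    rw [hm, avg]; field_simp
  have hc : ∀ c : ℝ, ∫ p in Qc d r, c = (volume (Qc d r)).toReal * c := fun c => by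
    rw [setIntegral_const]; rfl
  have e2 : ∫ p in Qc d r, ((w p - c) ^ 2 - (w p - m) ^ 2) = (volume (Qc d r)).toReal * (m - c) ^ 2 := by
    have : ∀ p, (w p - c) ^ 2 - (w p - m) ^ 2 = (2 * (m - c)) * w p + (c ^ 2 - m ^ 2) := fun p => by ring
    simp only [this]
    rw [integral_add ((hw.iq r).const_mul _) ((LB.const _).iq r), integral_const_mul, hc, ← e1]; ring
  rw [integral_sub (((hw.sub (LB.const c)).sq).iq r) (((hw.sub (LB.const m)).sq).iq r)] at e2
  nlinarith [mul_nonneg hV.le (sq_nonneg (m - c))]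

theorem HX_sub_le {u v : EE d → ℝ} (hu : Sm u) (hv : Sm v) (p : EE d) :
    HX (fun p => u p - v p) p ≤ 2 * HX u p + 2 * HX v p := by
  simp only [HX, Finset.mul_sum, ← Finset.sum_add_distrib]
  refine Finset.sum_le_sum fun j _ => Finset.sum_le_sum fun k _ => ?_
  rw [DD_sub hu hv, DD_sub (hu.DD _) (hv.DD _)]
  nlinarith [sq_nonneg (DD (some j) (DD (some k) u) p + DD (some j) (DD (some k) v) p)]

theorem HX_CI {v : EE d → ℝ} (hv : TF v) : CI (HX v) :=
  CI.sum _ fun j _ => CI.sum _ fun k _ => ((hv.DD _).DD _).CI.sq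

def Wt (i0 : Fin d) (w f : EE d → ℝ) : Prop := w = DD none f ∨ ∃ j k, k ≠ i0 ∧ w = DD (some j) (DD (some k) f)

theorem scale1 (d : ℕ) {δ : ℝ} (hδ : δ ∈ Set.Ioo (0:ℝ) 1) : ∃ N : ℝ, 0 < N ∧
    ∀ (a : ℝ → Fin d → Fin d → ℝ) (_ : Ell δ a) (i0 : Fin d) (u : EE d → ℝ) (_ : TF u) (r : ℝ), 0 < r → r ≤ 1/4 →
    ∀ w, Wt i0 w u → ∫ p in Qc d r, (w p - avg (Qc d r) w) ^ 2 ≤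
      N * (∫ p in Qc d 1, Lop i0 a u p ^ 2) + N * r ^ 2 * (volume (Qc d r)).toReal * ∫ p in Qc d 1, HX u p := by
  obtain ⟨C1, hC1, hv⟩ := exist_v d hδ
  obtain ⟨C2, hC2, ho⟩ := oscF d hδ.1
  set V1 := (volume (Qc d 1)).toReal with hV1
  have hV10 : 0 < V1 := Qc_vpos one_pos
  refine ⟨2 * C1 + 4 * C1 * C2 * V1 + 4 * C2, by positivity, fun a h i0 u hu r hr hr4 w hw => ?_⟩
  set V := (volume (Qc d r)).toReal with hV
  have hV0 : 0 < V := Qc_vpos hr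
  have hVV : V ≤ V1 := ENNReal.toReal_mono (Qc_bdd 1).measure_lt_top.ne (measure_mono (Qc_mono hr (by linarith)))
  set F := ∫ p in Qc d 1, Lop i0 a u p ^ 2 with hF
  set X := ∫ p in Qc d 1, HX u p with hX
  have hF0 : 0 ≤ F := integral_nonneg fun p => sq_nonneg _
  have hX0 : 0 ≤ X := integral_nonneg fun p => HX_nonneg u p
  have hr2 : r ^ 2 ≤ 1 := by nlinarith
  have key : ∀ ε, 0 < ε → ∫ p in Qc d r, (w p - avg (Qc d r) w) ^ 2 ≤
      2 * (C1 * (F + ε)) + 2 * (C2 * r ^ 2 * (((2 * X + 2 * (C1 * (F + ε))) + ε) * V + ε)) := by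
    intro ε hε
    obtain ⟨v, hvT, hv1, hv2⟩ := hv a h i0 u hu ε hε
    have hh : Sm (fun p => u p - v p) := hu.1.sub hvT.1
    have hvI : CI (fun p => DD none v p ^ 2 + HX v p) := (hvT.DD none).CI.sq.add (HX_CI hvT)
    have hv0 : ∀ p, 0 ≤ DD none v p ^ 2 + HX v p := fun p => add_nonneg (sq_nonneg _) (HX_nonneg v p)
    have hJ : ∀ ρ, ∫ p in Qc d ρ, (DD none v p ^ 2 + HX v p) ≤ C1 * (F + ε) := fun ρ =>
      (setIntegral_le_integral hvI.int (Filter.Eventually.of_forall hv0)).trans hv1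
    have hXh : ∫ p in Qc d (1/2), HX (fun p => u p - v p) p ≤ 2 * X + 2 * (C1 * (F + ε)) := by
      have := int2 ((HX_LB hh).iq (1/2)) ((HX_LB hu.1).iq (1/2)) (hvI.1.iq (1/2)) 2 2 (fun p => by
        nlinarith [HX_sub_le hu.1 hvT.1 p, sq_nonneg (DD none v p)])
      have h2 : ∫ p in Qc d (1/2), HX u p ≤ X := int_Qc_mono (HX_LB hu.1) (HX_nonneg u) (by norm_num) (by norm_num)
      linarith [hJ (1/2)]
    obtain ⟨wh, hwh, wv, hwv, hws, hwb, hwu⟩ : ∃ wh, Wt i0 wh (fun p => u p - v p) ∧ ∃ wv : EE d → ℝ, Sm wv ∧ 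
        (∀ p, w p = wv p + wh p) ∧ (∀ p, wv p ^ 2 ≤ DD none v p ^ 2 + HX v p) ∧ Sm w ∧ Sm wh := by
      rcases hw with hw | ⟨j, k, hk, hw⟩
      · refine ⟨_, Or.inl rfl, DD none v, hvT.1.DD _, fun p => ?_, fun p => ?_, hw ▸ hu.1.DD _, hh.DD _⟩
        · rw [DD_sub hu.1 hvT.1, hw]; ring
        · linarith [HX_nonneg v p]
      · refine ⟨_, Or.inr ⟨j, k, hk, rfl⟩, DD (some j) (DD (some k) v), (hvT.1.DD _).DD _, fun p => ?_, fun p => ?_, hw ▸ (hu.1.DD _).DD _, (hh.DD _).DD _⟩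
        · rw [DD_sub hu.1 hvT.1, DD_sub (hu.1.DD _) (hvT.1.DD _), hw]; ring
        · linarith [HX_le v p j k, sq_nonneg (DD none v p)]
    have b1 := ho a h i0 _ hh ε hv2 r hr hr4 wh hwh
    have b2 := var_le hwu.1.LB hr (wh 0)
    have b3 := int2 (((hwu.1.LB.sub (LB.const (wh 0))).sq).iq r) (hvI.1.iq r) (((hwu.2.LB.sub (LB.const (wh 0))).sq).iq r) 2 2 (fun p => by
      rw [hws p]
      nlinarith [hwb p, sq_nonneg (wv p - (wh p - wh 0))])
    have b4 : C2 * r ^ 2 * (((∫ p in Qc d (1/2), HX (fun p => u p - v p) p) + ε) * V + ε) ≤ C2 * r ^ 2 * (((2 * X + 2 * (C1 * (F + ε))) + ε) * V + ε) := by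
      gcongr
    linarith [hJ r]
  refine le_of_forall_pos_le_add fun ε hε => ?_
  set K := 2 * C1 + 2 * (C2 * ((2 * C1 + 1) * V1 + 1)) with hK
  have hK0 : 0 < K := by positivity
  have := key (ε / K) (by positivity)
  have hη : K * (ε / K) = ε := by field_simp
  set η := ε / K with hηd
  have hη0 : 0 < η := by positivity
  have c1 : r ^ 2 * (F * V) ≤ F * V1 := by
    calc r ^ 2 * (F * V) ≤ 1 * (F * V1) := by gcongr
      _ = _ := one_mul _
  have c2 : r ^ 2 * V ≤ V1 := by
    calc r ^ 2 * V ≤ 1 * V1 := by gcongr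
      _ = _ := one_mul _
  have c3 : C2 * r ^ 2 * (((2 * C1 + 1) * η) * V + η) ≤ C2 * ((2 * C1 + 1) * V1 + 1) * η := by
    have : C2 * r ^ 2 * (((2 * C1 + 1) * η) * V + η) = C2 * η * ((2 * C1 + 1) * (r ^ 2 * V) + r ^ 2) := by ring
    rw [this]
    have : C2 * ((2 * C1 + 1) * V1 + 1) * η = C2 * η * ((2 * C1 + 1) * V1 + 1) := by ring
    rw [this]; gcongr
  have c4 : C1 * C2 * (r ^ 2 * (F * V)) ≤ C1 * C2 * (F * V1) := by gcongr
  have c5 : 0 ≤ C1 * (r ^ 2 * V * X) := by positivity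
  have c6 : 0 ≤ C1 * C2 * V1 * (r ^ 2 * V * X) := by positivity
  have c7 : 0 ≤ C2 * F := by positivity
  rw [← hη, hK]
  nlinarith
end P18

section P19
open MeasureTheory
variable {d : ℕ}

noncomputable def AR (d : ℕ) (R : ℝ) : EE d →L[ℝ] EE d :=
  (R ^ 2 • ContinuousLinearMap.fst ℝ ℝ (Fin d → ℝ)).prod (R • ContinuousLinearMap.snd ℝ ℝ (Fin d → ℝ))

theorem AR_apply (R : ℝ) (q : EE d) : AR d R q = (R ^ 2 * q.1, R • q.2) := rfl

theorem AR_inv {R : ℝ} (hR : R ≠ 0) (q : EE d) : AR d R (AR d R⁻¹ q) = q := by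
  obtain ⟨t, x⟩ := q
  simp only [AR_apply, smul_smul]
  rw [mul_inv_cancel₀ hR, one_smul, ← mul_assoc, ← mul_pow, mul_inv_cancel₀ hR]; simp

theorem AR_inj {R : ℝ} (hR : R ≠ 0) : Function.Injective (AR d R) :=
  Function.LeftInverse.injective (g := AR d R⁻¹) fun q => by
    simpa using AR_inv (inv_ne_zero hR) q

theorem AR_mem {R : ℝ} (hR : 0 < R) {ρ : ℝ} (q : EE d) (h : q ∈ Qc d ρ) : AR d R q ∈ Qc d (R * ρ) := by
  obtain ⟨⟨h1, h2⟩, h3⟩ := h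
  simp only [ballE, Set.mem_ofPred_eq] at h3
  rw [AR_apply]
  have : 0 < R ^ 2 := by positivity
  refine ⟨⟨by positivity, ?_⟩, ?_⟩
  · show R ^ 2 * q.1 < (R * ρ) ^ 2
    rw [mul_pow]; gcongr
  · simp only [ballE, Set.mem_ofPred_eq, Pi.smul_apply, smul_eq_mul, mul_pow, ← Finset.mul_sum]
    gcongr

theorem AR_image {R : ℝ} (hR : 0 < R) (ρ : ℝ) : AR d R '' Qc d ρ = Qc d (R * ρ) := by
  ext q
  constructor
  · rintro ⟨q, hq, rfl⟩; exact AR_mem hR q hq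
  · intro h
    refine ⟨AR d R⁻¹ q, ?_, AR_inv hR.ne' q⟩
    have := AR_mem (inv_pos.2 hR) q h
    rwa [inv_mul_cancel_left₀ hR.ne'] at this

theorem avg_AR {R : ℝ} (hR : 0 < R) {ρ : ℝ} (hρ : 0 < ρ) (F : EE d → ℝ) :
    avg (Qc d ρ) (fun q => F (AR d R q)) = avg (Qc d (R * ρ)) F := by
  have key : ∀ G : EE d → ℝ, ∫ p in Qc d (R * ρ), G p = |(AR d R).det| * ∫ p in Qc d ρ, G (AR d R p) := by
    intro G
    rw [← AR_image hR, integral_image_eq_integral_abs_det_fderiv_smul volume (Qc_meas ρ)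
      (fun x _ => (AR d R).hasFDerivAt.hasFDerivWithinAt) (AR_inj hR.ne').injOn]
    simp only [smul_eq_mul]
    rw [integral_const_mul]
  have h1 := key (fun _ => 1)
  have e : ∀ σ : ℝ, ∫ p in Qc d σ, (1:ℝ) = (volume (Qc d σ)).toReal := fun c => by
    rw [setIntegral_const, smul_eq_mul, mul_one]; rfl
  rw [e, e] at h1
  have hp := Qc_vpos (d := d) (mul_pos hR hρ)
  have hp2 := Qc_vpos (d := d) hρ
  rw [avg, avg, key F, h1]
  have : |(AR d R).det| ≠ 0 := by
    intro h0; rw [h0, zero_mul] at h1; linarith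
  field_simp

theorem AR_none (R : ℝ) : AR d R (ev none) = R ^ 2 • ev none := by
  simp [AR_apply, ev]
theorem AR_some (R : ℝ) (j : Fin d) : AR d R (ev (some j)) = R • ev (some j) := by
  simp [AR_apply, ev]

theorem DDs_none (R : ℝ) {u : EE d → ℝ} (hu : Sm u) :
    DD none (fun q => u (AR d R q)) = fun q => R ^ 2 * DD none u (AR d R q) := by
  simpa using DD_affine (AR d R) 0 none (AR_none R) hu
theorem DDs_some (R : ℝ) (j : Fin d) {u : EE d → ℝ} (hu : Sm u) :
    DD (some j) (fun q => u (AR d R q)) = fun q => R * DD (some j) u (AR d R q) := by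
  simpa using DD_affine (AR d R) 0 (some j) (AR_some R j) hu
theorem Sm_AR (R : ℝ) {u : EE d → ℝ} (hu : Sm u) : Sm (fun q => u (AR d R q)) := by
  simpa using hu.aff (AR d R) 0
theorem DDs_two (R : ℝ) (j k : Fin d) {u : EE d → ℝ} (hu : Sm u) :
    DD (some j) (DD (some k) (fun q => u (AR d R q))) = fun q => R ^ 2 * DD (some j) (DD (some k) u) (AR d R q) := by
  rw [DDs_some R k hu, DD_cmul R (Sm_AR R (hu.DD _)), DDs_some R j (hu.DD _)]
  funext q; ring

theorem TF_AR {R : ℝ} (hR : R ≠ 0) {u : EE d → ℝ} (hu : TF u) : TF (fun q => u (AR d R q)) := by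
  refine ⟨Sm_AR R hu.1, ?_⟩
  refine HasCompactSupport.of_support_subset_isCompact (hu.2.isCompact.image (AR d R⁻¹).continuous) ?_
  intro q hq
  refine ⟨AR d R q, subset_tsupport _ hq, ?_⟩
  simpa using AR_inv (inv_ne_zero hR) q

theorem avg_cmul (s : Set (EE d)) (c : ℝ) (f : EE d → ℝ) : avg s (fun p => c * f p) = c * avg s f := by
  rw [avg, avg, integral_const_mul]; ring

theorem fin_avg (d : ℕ) {δ : ℝ} (hδ : δ ∈ Set.Ioo (0:ℝ) 1) : ∃ N : ℝ, 0 < N ∧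
    ∀ (a : ℝ → Fin d → Fin d → ℝ) (_ : Ell δ a) (i0 : Fin d) (κ r : ℝ), 4 ≤ κ → 0 < r → ∀ (u : EE d → ℝ) (_ : TF u),
    ∀ w, Wt i0 w u → avg (Qc d r) (fun p => (w p - avg (Qc d r) w) ^ 2) ≤
      N * κ ^ (d + 2) * avg (Qc d (κ * r)) (fun p => Lop i0 a u p ^ 2) + N * κ⁻¹ ^ 2 * avg (Qc d (κ * r)) (HX u) := by
  obtain ⟨N, hN, hs⟩ := scale1 d hδ
  have hV1 := Qc_vpos (d := d) one_pos
  set V1 := (volume (Qc d 1)).toReal with hV1d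
  refine ⟨N * (1 + V1), by positivity, fun a h i0 κ r hκ hr u hu w hw => ?_⟩
  have hκ0 : 0 < κ := by linarith
  set R := κ * r with hRd
  have hR : 0 < R := by positivity
  have hρ : 0 < κ⁻¹ := by positivity
  have hρ4 : κ⁻¹ ≤ 1/4 := by rw [inv_le_comm₀ hκ0 (by norm_num)]; norm_num; exact hκ
  have hRr : R * κ⁻¹ = r := by rw [hRd]; field_simp
  have hE : Ell δ (fun s => a (R * s)) :=
    ⟨fun j k => (h.meas j k).comp (measurable_const_mul R), fun s => h.symm _, fun s => h.low _, fun s => h.up _⟩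
  set U : EE d → ℝ := fun q => u (AR d R q) with hU
  have hwU : Wt i0 (fun q => R ^ 2 * w (AR d R q)) U := by
    rcases hw with hw | ⟨j, k, hk, hw⟩
    · left; rw [hU, DDs_none R hu.1, hw]
    · right; exact ⟨j, k, hk, by rw [hU, DDs_two R j k hu.1, hw]⟩
  have hLU : ∀ q, Lop i0 (fun s => a (R * s)) U q = R ^ 2 * Lop i0 a u (AR d R q) := by
    intro q
    simp only [Lop, hU, DDs_none R hu.1, DDs_two R _ _ hu.1, mul_add, Finset.mul_sum]
    congr 1
    refine Finset.sum_congr rfl fun j _ => Finset.sum_congr rfl fun k _ => ?_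
    simp only [AR_apply, Pi.smul_apply, smul_eq_mul]; ring
  have hHX : ∀ q, HX U q = R ^ 4 * HX u (AR d R q) := by
    intro q
    simp only [HX, hU, DDs_two R _ _ hu.1, Finset.mul_sum]
    refine Finset.sum_congr rfl fun j _ => Finset.sum_congr rfl fun k _ => ?_
    ring
  have hm := hs _ hE i0 U (TF_AR hR.ne' hu) κ⁻¹ hρ hρ4 _ hwU
  have hvol := Qc_vol (d := d) hρ
  have hVr := Qc_vpos (d := d) hρ
  set V := (volume (Qc d κ⁻¹)).toReal with hVd
  rw [← hV1d] at hvol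
  -- convert to averages
  have a1 : avg (Qc d κ⁻¹) (fun q => R ^ 2 * w (AR d R q)) = R ^ 2 * avg (Qc d r) w := by
    rw [avg_cmul, avg_AR hR hρ, hRr]
  have a2 : V⁻¹ * ∫ p in Qc d κ⁻¹, (R ^ 2 * w (AR d R p) - R ^ 2 * avg (Qc d r) w) ^ 2 =
      R ^ 4 * avg (Qc d r) (fun p => (w p - avg (Qc d r) w) ^ 2) := by
    have := avg_AR hR hρ (fun p => R ^ 4 * (w p - avg (Qc d r) w) ^ 2)
    rw [hRr] at this
    rw [← avg_cmul _ (R ^ 4) (fun p => (w p - avg (Qc d r) w) ^ 2), ← this, avg]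
    congr 2; funext p; ring
  have a3 : V1⁻¹ * ∫ p in Qc d 1, Lop i0 (fun s => a (R * s)) U p ^ 2 =
      R ^ 4 * avg (Qc d R) (fun p => Lop i0 a u p ^ 2) := by
    have := avg_AR hR one_pos (fun p => R ^ 4 * Lop i0 a u p ^ 2)
    rw [mul_one] at this
    rw [← avg_cmul, ← this, avg]
    congr 2; funext p; rw [hLU]; ring
  have a4 : V1⁻¹ * ∫ p in Qc d 1, HX U p = R ^ 4 * avg (Qc d R) (HX u) := by
    have := avg_AR hR one_pos (fun p => R ^ 4 * HX u p)
    rw [mul_one] at this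
    rw [← avg_cmul, ← this, avg]
    congr 2; funext p; rw [hHX]
  rw [a1] at hm
  set I1 := ∫ p in Qc d κ⁻¹, (R ^ 2 * w (AR d R p) - R ^ 2 * avg (Qc d r) w) ^ 2
  set I2 := ∫ p in Qc d 1, Lop i0 (fun s => a (R * s)) U p ^ 2
  set I3 := ∫ p in Qc d 1, HX U p
  set Y1 := avg (Qc d r) (fun p => (w p - avg (Qc d r) w) ^ 2)
  set Y2 := avg (Qc d R) (fun p => Lop i0 a u p ^ 2)
  set Y3 := avg (Qc d R) (HX u)
  have n2 : 0 ≤ Y2 := mul_nonneg (by positivity) (integral_nonneg fun p => sq_nonneg _)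
  have n3 : 0 ≤ Y3 := mul_nonneg (by positivity) (integral_nonneg fun p => HX_nonneg u p)
  have i1 : I1 = V * (R ^ 4 * Y1) := by rw [← a2]; field_simp
  have i2 : I2 = V1 * (R ^ 4 * Y2) := by rw [← a3]; field_simp
  have i3 : I3 = V1 * (R ^ 4 * Y3) := by rw [← a4]; field_simp
  rw [i1, i2, i3] at hm
  have hk : κ ^ (d + 2) * V = V1 := by
    rw [hvol, ← mul_assoc, ← mul_pow, mul_inv_cancel₀ hκ0.ne', one_pow, one_mul]
  have f1 : V * R ^ 4 * Y1 ≤ V * R ^ 4 * (N * κ ^ (d + 2) * Y2 + N * V1 * κ⁻¹ ^ 2 * Y3) := by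
    have : V * R ^ 4 * (N * κ ^ (d + 2) * Y2 + N * V1 * κ⁻¹ ^ 2 * Y3) = N * ((κ ^ (d + 2) * V) * (R ^ 4 * Y2)) + N * κ⁻¹ ^ 2 * V * (V1 * (R ^ 4 * Y3)) := by ring
    rw [this, hk]; linarith
  have f2 := le_of_mul_le_mul_left f1 (by positivity)
  refine f2.trans ?_
  have : N ≤ N * (1 + V1) := by nlinarith
  have : N * V1 ≤ N * (1 + V1) := by nlinarith
  gcongr
end P19

theorem stmt13 (d : ℕ) (hd : 2 ≤ d) (δ : ℝ) (hδ : δ ∈ Set.Ioo (0 : ℝ) 1) :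
    ∃ N : ℝ, 0 < N ∧
      ∀ a : ℝ → Fin d → Fin d → ℝ,
        (∀ j k, Measurable fun s => a s j k) →
        (∀ s j k, a s j k = a s k j) →
        (∀ (s : ℝ) (θ : Fin d → ℝ),
          δ * ∑ j, (θ j) ^ 2 ≤ ∑ j, ∑ k, a s j k * θ j * θ k ∧
          ∑ j, ∑ k, a s j k * θ j * θ k ≤ δ⁻¹ * ∑ j, (θ j) ^ 2) →
        ∀ κ r : ℝ, 4 ≤ κ → 0 < r →
          ∀ u : ℝ × (Fin d → ℝ) → ℝ, ContDiff ℝ (⊤ : ℕ∞) u → HasCompactSupport u →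
            (avg (Qc d r) (fun p => (pdt u p - avg (Qc d r) (pdt u)) ^ 2)
                ≤ N * κ ^ (d + 2) *
                    avg (Qc d (κ * r)) (fun p =>
                      (pdt u p
                        + ∑ j, ∑ k, a (p.2 ⟨0, by omega⟩) j k * pdxx j k u p) ^ 2)
                  + N * κ⁻¹ ^ 2 *
                    avg (Qc d (κ * r)) (fun p => ∑ j, ∑ k, (pdxx j k u p) ^ 2)) ∧
            ∀ j k : Fin d, k.val ≠ 0 →
              avg (Qc d r) (fun p => (pdxx j k u p - avg (Qc d r) (pdxx j k u)) ^ 2)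
                ≤ N * κ ^ (d + 2) *
                    avg (Qc d (κ * r)) (fun p =>
                      (pdt u p
                        + ∑ j', ∑ k', a (p.2 ⟨0, by omega⟩) j' k' * pdxx j' k' u p) ^ 2)
                  + N * κ⁻¹ ^ 2 *
                    avg (Qc d (κ * r)) (fun p => ∑ j', ∑ k', (pdxx j' k' u p) ^ 2) := by
  obtain ⟨N, hN, h⟩ := fin_avg d hδ
  refine ⟨N, hN, fun a hm hs he κ r hκ hr u hu hc => ⟨?_, fun j k hk => ?_⟩⟩
  · exact h a ⟨hm, hs, fun s θ => (he s θ).1, fun s θ => (he s θ).2⟩ ⟨0, by omega⟩ κ r hκ hr u ⟨hu, hc⟩ _ (Or.inl rfl)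
  · exact h a ⟨hm, hs, fun s θ => (he s θ).1, fun s θ => (he s θ).2⟩ ⟨0, by omega⟩ κ r hκ hr u ⟨hu, hc⟩ _
      (Or.inr ⟨j, k, fun e => hk (by rw [e]), rfl⟩)
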